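/- arXiv:2109.00496 — 5 statements merged into one kernel-verified Lean document; each statement's English description precedes it below -/
import Mathlib

section
/- Let T₀ > 0, let 0 < μ₁ < μ₂, let ω be a modulus of continuity, and let θ : (0,T₀) → (0,∞) be continuous and nonincreasing. Then for every coefficient c ∈ PS(T₀,μ₁,μ₂,ω,θ), every λ > 0, and every solution u of u'' + λ²·c(t)·u = 0 on [0,T₀], one has u'(t)² + λ²·u(t)² ≤ M₁·(u'(0)² + λ²·u(0)²)·exp(M₂·m(λ)) for every t ∈ [0,T₀]. -/
open Set Filter MeasureTheory

/-- A modulus of continuity: positive for positive arguments, tends to `0` at `0⁺`,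
nondecreasing, and `σ ↦ σ / ω σ` is nondecreasing on `(0, ∞)`. -/
def IsModulusOfContinuity (ω : ℝ → ℝ) : Prop :=
  (∀ σ : ℝ, 0 < σ → 0 < ω σ) ∧
  Tendsto ω (nhdsWithin 0 (Ioi 0)) (nhds 0) ∧
  (∀ s t : ℝ, 0 ≤ s → s ≤ t → ω s ≤ ω t) ∧
  (∀ s t : ℝ, 0 < s → s ≤ t → s / ω s ≤ t / ω t)

/-- Membership in the class `PS(T₀, μ₁, μ₂, ω, θ)` of propagation speeds. -/
def MemPS (T0 μ1 μ2 : ℝ) (ω θ : ℝ → ℝ) (c : ℝ → ℝ) : Prop :=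
  ContinuousOn c (Icc 0 T0) ∧
  LocallyLipschitzOn (Ioo 0 T0) c ∧
  (∀ t ∈ Ioo 0 T0, μ1 ≤ c t ∧ c t ≤ μ2) ∧
  (∀ t ∈ Icc 0 T0, ∀ s ∈ Icc 0 T0, |c t - c s| ≤ ω |t - s|) ∧
  (∀ᵐ t ∂(volume.restrict (Ioo 0 T0)), |deriv c t| ≤ θ t)

/-- The key quantity `m(λ) = inf { λ ω(1/λ) s + ∫_s^{T₀} θ : s ∈ (0, T₀] }`. -/
noncomputable def mFun (T0 : ℝ) (ω θ : ℝ → ℝ) (lam : ℝ) : ℝ :=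
  sInf ((fun s => lam * ω (1 / lam) * s + ∫ t in s..T0, θ t) '' Ioc 0 T0)

/-- Derivative within the time interval `[0, T₀]`. -/
noncomputable def der (T0 : ℝ) (u : ℝ → ℝ) : ℝ → ℝ :=
  fun t => derivWithin u (Icc 0 T0) t

/-- `u` is a (twice differentiable) solution of `u'' + λ² c(t) u = 0` on `[0, T₀]`. -/
def IsSol (T0 lam : ℝ) (c u : ℝ → ℝ) : Prop :=
  ∀ t ∈ Icc 0 T0,
    HasDerivWithinAt u (der T0 u t) (Icc 0 T0) t ∧
    HasDerivWithinAt (der T0 u) (-(lam ^ 2 * c t * u t)) (Icc 0 T0) t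

/-- Constant `M₁ = (max{1,μ₂}/min{1,μ₁})²`. -/
noncomputable def M1 (μ1 μ2 : ℝ) : ℝ := (max 1 μ2 / min 1 μ1) ^ 2

/-- Constant `M₂ = 1/μ₁ + 1/√μ₁`. -/
noncomputable def M2 (μ1 : ℝ) : ℝ := 1 / μ1 + 1 / Real.sqrt μ1

/-- A function with a continuous derivative on a compact interval is absolutely continuous. -/
lemma ac_of_hasDerivWithinAt {a b : ℝ} (hab : a ≤ b) {f f' : ℝ → ℝ}
    (hf : ∀ x ∈ Icc a b, HasDerivWithinAt f (f' x) (Icc a b) x)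
    (hf' : ContinuousOn f' (Icc a b)) : AbsolutelyContinuousOnInterval f a b := by
  obtain ⟨C, hC⟩ := isCompact_Icc.exists_bound_of_continuousOn hf'
  have : LipschitzOnWith (Real.toNNReal C) f (Icc a b) := by
    refine (convex_Icc a b).lipschitzOnWith_of_nnnorm_hasDerivWithin_le hf ?_
    intro x hx
    have := hC x hx
    rw [← NNReal.coe_le_coe]
    simp only [coe_nnnorm]
    exact this.trans (Real.le_coe_toNNReal C)
  apply LipschitzOnWith.absolutelyContinuousOnInterval (K := Real.toNNReal C)
  rwa [uIcc_of_le hab]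

/-- Second regime: the hyperbolic energy. -/
lemma energy_second (T0 μ1 : ℝ) (θ c u v : ℝ → ℝ) (lam a b : ℝ)
    (hμ1 : 0 < μ1) (ha : 0 < a) (hab : a ≤ b) (hb : b < T0)
    (hθcont : ContinuousOn θ (Ioo 0 T0))
    (hθpos : ∀ t ∈ Ioo 0 T0, 0 < θ t)
    (hcc : ContinuousOn c (Icc 0 T0))
    (hlip : LocallyLipschitzOn (Ioo 0 T0) c)
    (hcl : ∀ t ∈ Icc 0 T0, μ1 ≤ c t)
    (hder : ∀ᵐ t ∂(volume.restrict (Ioo 0 T0)), |deriv c t| ≤ θ t)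
    (hu : ∀ t ∈ Icc 0 T0, HasDerivWithinAt u (v t) (Icc 0 T0) t)
    (hv : ∀ t ∈ Icc 0 T0, HasDerivWithinAt v (-(lam ^ 2 * c t * u t)) (Icc 0 T0) t) :
    v b ^ 2 + lam ^ 2 * (c b * u b ^ 2) ≤
      (v a ^ 2 + lam ^ 2 * (c a * u a ^ 2)) * Real.exp ((1 / μ1) * ∫ t in a..b, θ t) := by
  have hsub : Icc a b ⊆ Ioo 0 T0 := fun x hx => ⟨ha.trans_le hx.1, hx.2.trans_lt hb⟩
  have hsub' : Icc a b ⊆ Icc 0 T0 := hsub.trans Ioo_subset_Icc_self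
  have hud : ∀ t ∈ Ioo 0 T0, HasDerivAt u (v t) t := fun t ht =>
    (hu t (Ioo_subset_Icc_self ht)).hasDerivAt (Icc_mem_nhds ht.1 ht.2)
  have hvd : ∀ t ∈ Ioo 0 T0, HasDerivAt v (-(lam ^ 2 * c t * u t)) t := fun t ht =>
    (hv t (Ioo_subset_Icc_self ht)).hasDerivAt (Icc_mem_nhds ht.1 ht.2)
  have huc : ContinuousOn u (Icc 0 T0) := fun t ht => (hu t ht).continuousWithinAt
  have hvc : ContinuousOn v (Icc 0 T0) := fun t ht => (hv t ht).continuousWithinAt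
  have hPd : ∀ t ∈ Ioo 0 T0, HasDerivAt (fun x => ∫ y in a..x, θ y) (θ t) t := by
    intro t ht
    apply intervalIntegral.integral_hasDerivAt_right
    · apply ContinuousOn.intervalIntegrable
      apply hθcont.mono
      have : a ∈ Ioo 0 T0 := hsub ⟨le_rfl, hab⟩
      exact ordConnected_Ioo.uIcc_subset this ht
    · exact hθcont.stronglyMeasurableAtFilter isOpen_Ioo t ht
    · exact hθcont.continuousAt (isOpen_Ioo.mem_nhds ht)
  set P : ℝ → ℝ := fun x => ∫ y in a..x, θ y with hP
  set F : ℝ → ℝ := fun x => Real.exp (-(1 / μ1) * P x) with hF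
  have hFd : ∀ t ∈ Ioo 0 T0, HasDerivAt F (F t * (-(1 / μ1) * θ t)) t := fun t ht =>
    ((hPd t ht).const_mul _).exp
  have hFc : ContinuousOn F (Ioo 0 T0) := fun t ht => (hFd t ht).continuousAt.continuousWithinAt
  have acu : AbsolutelyContinuousOnInterval u a b :=
    ac_of_hasDerivWithinAt hab (fun x hx => (hud x (hsub hx)).hasDerivWithinAt) (hvc.mono hsub')
  have acv : AbsolutelyContinuousOnInterval v a b :=
    ac_of_hasDerivWithinAt hab (fun x hx => (hvd x (hsub hx)).hasDerivWithinAt)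
      (((continuousOn_const.mul hcc).mul huc).neg.mono hsub')
  have acF : AbsolutelyContinuousOnInterval F a b :=
    ac_of_hasDerivWithinAt hab (fun x hx => (hFd x (hsub hx)).hasDerivWithinAt)
      ((hFc.mul (continuousOn_const.mul hθcont)).mono hsub)
  have acc : AbsolutelyContinuousOnInterval c a b := by
    obtain ⟨K, hK⟩ := (hlip.mono hsub).exists_lipschitzOnWith_of_compact isCompact_Icc
    rw [← uIcc_of_le hab] at hK
    exact hK.absolutelyContinuousOnInterval
  have acE : AbsolutelyContinuousOnInterval
      (fun x => (v x * v x + lam ^ 2 * (c x * (u x * u x))) * F x) a b :=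
    ((acv.fun_mul acv).fun_add ((acc.fun_mul (acu.fun_mul acu)).const_mul (lam ^ 2))).fun_mul acF
  have key := acE.integral_deriv_eq_sub
  have hnonpos : ∫ x in a..b, deriv
      (fun x => (v x * v x + lam ^ 2 * (c x * (u x * u x))) * F x) x ≤ 0 := by
    rw [intervalIntegral.integral_of_le hab]
    apply integral_nonpos_of_ae
    have h1 : ∀ᵐ t ∂(volume.restrict (Ioc a b)), |deriv c t| ≤ θ t :=
      ae_restrict_of_ae_restrict_of_subset (Ioc_subset_Icc_self.trans hsub) hder
    have h2 : ∀ᵐ t ∂(volume.restrict (Ioc a b)), t ∈ uIcc a b → DifferentiableAt ℝ c t :=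
      ae_restrict_of_ae acc.ae_differentiableAt
    filter_upwards [h1, h2, ae_restrict_mem measurableSet_Ioc] with t ht1 ht2 ht3
    have htI : t ∈ Icc a b := Ioc_subset_Icc_self ht3
    have hcd := (ht2 (by rwa [uIcc_of_le hab])).hasDerivAt
    have htO := hsub htI
    have hD := (((hvd t htO).mul (hvd t htO)).add
      ((hcd.mul ((hud t htO).mul (hud t htO))).const_mul (lam ^ 2))).mul (hFd t htO)
    have hD' : deriv (fun x => (v x * v x + lam ^ 2 * (c x * (u x * u x))) * F x) t = _ :=
      hD.deriv
    rw [hD']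
    simp only [Pi.mul_apply, Pi.add_apply, Pi.zero_apply]
    have hFpos : 0 < F t := Real.exp_pos _
    have hcm := hcl t (hsub' htI)
    have hθt := hθpos t htO
    have hd := (abs_le.1 ht1).2
    have e1 : lam ^ 2 * u t ^ 2 * deriv c t ≤ lam ^ 2 * u t ^ 2 * θ t :=
      mul_le_mul_of_nonneg_left hd (by positivity)
    have e2 : lam ^ 2 * u t ^ 2 * θ t ≤
        (1 / μ1) * θ t * (v t * v t + lam ^ 2 * (c t * (u t * u t))) := by
      have : 1 ≤ (1 / μ1) * c t := by
        rw [one_div, inv_mul_eq_div, le_div_iff₀ hμ1]; linarith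
      have h3 : lam ^ 2 * u t ^ 2 * θ t * 1 ≤ lam ^ 2 * u t ^ 2 * θ t * ((1 / μ1) * c t) :=
        mul_le_mul_of_nonneg_left this (by positivity)
      have h4 : 0 ≤ (1 / μ1) * θ t * (v t * v t) :=
        mul_nonneg (by positivity) (mul_self_nonneg _)
      nlinarith
    have e3 : (lam ^ 2 * u t ^ 2 * deriv c t -
        (1 / μ1) * θ t * (v t * v t + lam ^ 2 * (c t * (u t * u t)))) * F t ≤ 0 :=
      mul_nonpos_of_nonpos_of_nonneg (by linarith) hFpos.le
    refine le_trans (le_of_eq ?_) e3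
    ring
  rw [key] at hnonpos
  have hFa : F a = 1 := by simp [hF, hP]
  have hFb : F b * Real.exp ((1 / μ1) * ∫ t in a..b, θ t) = 1 := by
    rw [hF, ← Real.exp_add]; simp [hP]
  rw [hFa] at hnonpos
  have h5 : (v b * v b + lam ^ 2 * (c b * (u b * u b))) * F b ≤
    v a * v a + lam ^ 2 * (c a * (u a * u a)) := by linarith
  have h6 := mul_le_mul_of_nonneg_right h5
    (Real.exp_pos ((1 / μ1) * ∫ t in a..b, θ t)).le
  rw [mul_assoc, hFb] at h6
  nlinarith

/-- First regime: approximated energies. -/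
lemma energy_first (T0 μ1 μ2 : ℝ) (ω c u v : ℝ → ℝ) (lam t : ℝ)
    (hT0 : 0 < T0) (hμ1 : 0 < μ1) (hμ12 : μ1 < μ2) (hlam : 0 < lam)
    (hω : IsModulusOfContinuity ω)
    (hcc : ContinuousOn c (Icc 0 T0))
    (hcl : ∀ t ∈ Icc 0 T0, μ1 ≤ c t ∧ c t ≤ μ2)
    (hcω : ∀ t ∈ Icc 0 T0, ∀ s ∈ Icc 0 T0, |c t - c s| ≤ ω |t - s|)
    (hu : ∀ t ∈ Icc 0 T0, HasDerivWithinAt u (v t) (Icc 0 T0) t)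
    (hv : ∀ t ∈ Icc 0 T0, HasDerivWithinAt v (-(lam ^ 2 * c t * u t)) (Icc 0 T0) t)
    (ht : t ∈ Icc 0 T0) :
    min 1 μ1 * (v t ^ 2 + lam ^ 2 * u t ^ 2) ≤
      max 1 μ2 * (v 0 ^ 2 + lam ^ 2 * u 0 ^ 2) *
        Real.exp (M2 μ1 * (lam * ω (1 / lam) * t)) := by
  obtain ⟨hωpos, -, hωmono, -⟩ := hω
  have hud : ∀ t ∈ Ioo 0 T0, HasDerivAt u (v t) t := fun t ht =>
    (hu t (Ioo_subset_Icc_self ht)).hasDerivAt (Icc_mem_nhds ht.1 ht.2)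
  have hvd : ∀ t ∈ Ioo 0 T0, HasDerivAt v (-(lam ^ 2 * c t * u t)) t := fun t ht =>
    (hv t (Ioo_subset_Icc_self ht)).hasDerivAt (Icc_mem_nhds ht.1 ht.2)
  have huc : ContinuousOn u (Icc 0 T0) := fun t ht => (hu t ht).continuousWithinAt
  have hvc : ContinuousOn v (Icc 0 T0) := fun t ht => (hv t ht).continuousWithinAt
  -- extension of c
  set p : ℝ → ℝ := fun x => max 0 (min x T0) with hp
  have hpm : ∀ x, p x ∈ Icc 0 T0 := fun x =>
    ⟨le_max_left _ _, max_le hT0.le (min_le_right _ _)⟩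
  have hpc : Continuous p := by fun_prop
  have hpid : ∀ x ∈ Icc 0 T0, p x = x := fun x hx => by
    simp [hp, hx.1, hx.2]
  have hpl : ∀ x y, |p x - p y| ≤ |x - y| := by
    intro x y
    simp only [hp]
    refine (abs_max_sub_max_le_max _ _ _ _).trans ?_
    simp only [sub_self, abs_zero]
    refine max_le (abs_nonneg _) ((abs_min_sub_min_le_max _ _ _ _).trans ?_)
    simp
  set d : ℝ → ℝ := fun x => c (p x) with hd
  have hdc : Continuous d := hcc.comp_continuous hpc hpm
  set ε : ℝ := 1 / lam with hε
  have hεpos : 0 < ε := by positivity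
  set W : ℝ := ω ε with hW
  have hWpos : 0 < W := hωpos _ hεpos
  have hdW : ∀ x y, |x - y| ≤ ε → |d x - d y| ≤ W := by
    intro x y hxy
    exact (hcω _ (hpm x) _ (hpm y)).trans
      (hωmono _ _ (abs_nonneg _) ((hpl x y).trans hxy))
  have hdi : ∀ x y, IntervalIntegrable d volume x y := fun x y => hdc.intervalIntegrable x y
  set g : ℝ → ℝ := fun x => lam * ∫ y in x..(x + ε), d y with hg
  have hle : lam * ε = 1 := by rw [hε]; field_simp
  have hgd : ∀ x, HasDerivAt g (lam * (d (x + ε) - d x)) x := by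
    intro x
    have h1 : ∀ z, HasDerivAt (fun x => ∫ y in (0:ℝ)..x, d y) (d z) z := fun z =>
      intervalIntegral.integral_hasDerivAt_right (hdi _ _)
        (hdc.stronglyMeasurableAtFilter _ _) hdc.continuousAt
    have h2 : HasDerivAt (fun x => ∫ y in (0:ℝ)..(x + ε), d y) (d (x + ε)) x :=
      (h1 (x + ε)).comp_add_const x ε
    have h3 := (h2.sub (h1 x)).const_mul lam
    refine h3.congr_of_eventuallyEq (Eventually.of_forall fun z => ?_)
    simp only [hg, Pi.sub_apply]
    rw [intervalIntegral.integral_interval_sub_left (hdi _ _) (hdi _ _)]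
  have hglo : ∀ x k, (∀ y ∈ Icc x (x + ε), k ≤ d y) → k ≤ g x := by
    intro x k hk
    have h := intervalIntegral.integral_mono_on (a := x) (b := x + ε) (f := fun _ => k) (g := d)
      (μ := volume) (by linarith) intervalIntegrable_const (hdi _ _) hk
    rw [intervalIntegral.integral_const] at h
    have h' := mul_le_mul_of_nonneg_left h hlam.le
    simp only [add_sub_cancel_left, smul_eq_mul] at h'
    rw [← mul_assoc, hle, one_mul] at h'
    exact h'
  have hghi : ∀ x k, (∀ y ∈ Icc x (x + ε), d y ≤ k) → g x ≤ k := by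
    intro x k hk
    have h := intervalIntegral.integral_mono_on (a := x) (b := x + ε) (f := d) (g := fun _ => k)
      (μ := volume) (by linarith) (hdi _ _) intervalIntegrable_const hk
    rw [intervalIntegral.integral_const] at h
    have h' := mul_le_mul_of_nonneg_left h hlam.le
    simp only [add_sub_cancel_left, smul_eq_mul] at h'
    rw [← mul_assoc, hle, one_mul] at h'
    exact h'
  have hg1 : ∀ x, μ1 ≤ g x := fun x => hglo x _ fun y _ => (hcl _ (hpm y)).1
  have hg2 : ∀ x, g x ≤ μ2 := fun x => hghi x _ fun y _ => (hcl _ (hpm y)).2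
  have hgc : ∀ x ∈ Icc 0 T0, |g x - c x| ≤ W := by
    intro x hx
    have hdx : d x = c x := by simp only [hd, hpid x hx]
    have hb : ∀ y ∈ Icc x (x + ε), |d y - d x| ≤ W := fun y hy => hdW _ _ (by
      rw [abs_le]; constructor <;> linarith [hy.1, hy.2])
    rw [abs_le, ← hdx]
    constructor
    · have := hglo x (d x - W) fun y hy => by linarith [(abs_le.1 (hb y hy)).1]
      linarith
    · have := hghi x (d x + W) fun y hy => by linarith [(abs_le.1 (hb y hy)).2]
      linarith
  have hgcont : Continuous g := continuous_iff_continuousAt.2 fun x => (hgd x).continuousAt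
  set K : ℝ := M2 μ1 * (lam * W) with hK
  set r : ℝ := Real.sqrt μ1 with hr
  have hrpos : 0 < r := Real.sqrt_pos.2 hμ1
  have hr2 : r ^ 2 = μ1 := Real.sq_sqrt hμ1.le
  have hanti : AntitoneOn
      (fun x => (v x * v x + lam ^ 2 * (g x * (u x * u x))) * Real.exp (-K * x)) (Icc 0 T0) := by
    refine antitoneOn_of_hasDerivWithinAt_nonpos (convex_Icc 0 T0)
      (f' := fun x => (lam ^ 2 * (lam * (d (x + ε) - d x)) * u x ^ 2 +
        2 * lam ^ 2 * (g x - c x) * u x * v x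
        - K * (v x * v x + lam ^ 2 * (g x * (u x * u x)))) * Real.exp (-K * x)) ?_ ?_ ?_
    · exact ((hvc.mul hvc).add (continuousOn_const.mul
        (hgcont.continuousOn.mul (huc.mul huc)))).mul (by fun_prop)
    · intro x hx
      rw [interior_Icc] at hx
      have hE : HasDerivAt (fun x => Real.exp (-K * x)) (Real.exp (-K * x) * (-K * 1)) x :=
        ((hasDerivAt_id x).const_mul (-K)).exp
      have hD := (((hvd x hx).mul (hvd x hx)).add
        (((hgd x).mul ((hud x hx).mul (hud x hx))).const_mul (lam ^ 2))).mul hE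
      refine HasDerivAt.hasDerivWithinAt (hD.congr_deriv ?_)
      simp only [Pi.mul_apply, Pi.add_apply]
      ring
    · intro x hx
      rw [interior_Icc] at hx
      refine mul_nonpos_of_nonpos_of_nonneg ?_ (Real.exp_pos _).le
      have a1 : d (x + ε) - d x ≤ W := (abs_le.1 (hdW (x + ε) x (by
        rw [add_sub_cancel_left, abs_of_pos hεpos]))).2
      have a2 := hgc x (Ioo_subset_Icc_self hx)
      have a3 := hg1 x
      set G := g x
      set U := u x
      set V := v x
      have b1 : lam ^ 2 * (lam * (d (x + ε) - d x)) * U ^ 2 ≤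
          lam * W * ((1 / μ1) * (V * V + lam ^ 2 * (G * (U * U)))) := by
        have : 1 ≤ (1 / μ1) * G := by
          rw [one_div, inv_mul_eq_div, le_div_iff₀ hμ1]; linarith
        have h1 : (lam ^ 3 * U ^ 2) * (d (x + ε) - d x) ≤ (lam ^ 3 * U ^ 2) * W :=
          mul_le_mul_of_nonneg_left a1 (by positivity)
        have h2 : (lam ^ 3 * U ^ 2 * W) * 1 ≤ (lam ^ 3 * U ^ 2 * W) * ((1 / μ1) * G) :=
          mul_le_mul_of_nonneg_left this (by positivity)
        have h3 : 0 ≤ lam * W * ((1 / μ1) * (V ^ 2)) := by positivity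
        nlinarith
      have b2 : 2 * lam ^ 2 * (G - c x) * U * V ≤
          lam * W * ((1 / r) * (V * V + lam ^ 2 * (G * (U * U)))) := by
        have h1 : 2 * lam ^ 2 * (G - c x) * U * V ≤ 2 * lam ^ 2 * W * |U * V| := by
          have : (G - c x) * (U * V) ≤ W * |U * V| := by
            refine (le_abs_self _).trans ?_
            rw [abs_mul]
            exact mul_le_mul_of_nonneg_right a2 (abs_nonneg _)
          nlinarith [sq_nonneg lam, mul_le_mul_of_nonneg_left this (sq_nonneg lam)]
        have h2 : 2 * lam * r * |U * V| ≤ V * V + lam ^ 2 * (G * (U * U)) := by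
          have h3 : lam ^ 2 * U ^ 2 * r ^ 2 ≤ lam ^ 2 * U ^ 2 * G :=
            mul_le_mul_of_nonneg_left (by rw [hr2]; exact a3) (by positivity)
          have h4 := sq_nonneg (lam * r * |U| - |V|)
          have h5 : (lam * r * |U| - |V|) ^ 2 =
              lam ^ 2 * U ^ 2 * r ^ 2 + V ^ 2 - 2 * lam * r * (|U| * |V|) := by
            rw [← sq_abs U, ← sq_abs V]; ring
          rw [abs_mul]
          nlinarith
        have h3 : 2 * lam * |U * V| ≤ (1 / r) * (V * V + lam ^ 2 * (G * (U * U))) := by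
          rw [one_div, inv_mul_eq_div, le_div_iff₀ hrpos]; linarith
        have h4 := mul_le_mul_of_nonneg_left h3 (mul_pos hlam hWpos).le
        nlinarith
      have : K * (V * V + lam ^ 2 * (G * (U * U))) =
          lam * W * ((1 / μ1) * (V * V + lam ^ 2 * (G * (U * U)))) +
          lam * W * ((1 / r) * (V * V + lam ^ 2 * (G * (U * U)))) := by
        rw [hK, M2]; ring
      linarith
  have h := hanti ⟨le_rfl, hT0.le⟩ ht ht.1
  simp only [mul_zero, Real.exp_zero, mul_one] at h
  have h6 := mul_le_mul_of_nonneg_right h (Real.exp_pos (K * t)).le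
  rw [mul_assoc, ← Real.exp_add] at h6
  simp only [neg_mul, neg_add_cancel, Real.exp_zero, mul_one] at h6
  have hKt : M2 μ1 * (lam * W * t) = K * t := by rw [hK]; ring
  rw [hKt]
  have l1 : min 1 μ1 * (v t ^ 2 + lam ^ 2 * u t ^ 2) ≤
      v t * v t + lam ^ 2 * (g t * (u t * u t)) := by
    have i1 := mul_le_mul_of_nonneg_right (min_le_left 1 μ1) (sq_nonneg (v t))
    have i2 := mul_le_mul_of_nonneg_right ((min_le_right 1 μ1).trans (hg1 t))
      (mul_nonneg (sq_nonneg lam) (sq_nonneg (u t)))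
    nlinarith
  have l2 : v 0 * v 0 + lam ^ 2 * (g 0 * (u 0 * u 0)) ≤
      max 1 μ2 * (v 0 ^ 2 + lam ^ 2 * u 0 ^ 2) := by
    have i1 := mul_le_mul_of_nonneg_right (le_max_left 1 μ2) (sq_nonneg (v 0))
    have i2 := mul_le_mul_of_nonneg_right ((hg2 0).trans (le_max_right 1 μ2))
      (mul_nonneg (sq_nonneg lam) (sq_nonneg (u 0)))
    nlinarith
  exact l1.trans (h6.trans (mul_le_mul_of_nonneg_right l2 (Real.exp_pos _).le))

/-- energy estimate from above, Theorem 1.(1). -/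
theorem energy_estimate_from_above
    (T0 μ1 μ2 : ℝ) (ω θ : ℝ → ℝ)
    (hT0 : 0 < T0) (hμ1 : 0 < μ1) (hμ12 : μ1 < μ2)
    (hω : IsModulusOfContinuity ω)
    (hθcont : ContinuousOn θ (Ioo 0 T0))
    (hθpos : ∀ t ∈ Ioo 0 T0, 0 < θ t)
    (hθmono : AntitoneOn θ (Ioo 0 T0))
    (c : ℝ → ℝ) (hc : MemPS T0 μ1 μ2 ω θ c)
    (lam : ℝ) (hlam : 0 < lam)
    (u : ℝ → ℝ) (hu : IsSol T0 lam c u) :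
    ∀ t ∈ Icc 0 T0,
      (der T0 u t) ^ 2 + lam ^ 2 * (u t) ^ 2 ≤
        M1 μ1 μ2 * ((der T0 u 0) ^ 2 + lam ^ 2 * (u 0) ^ 2) *
          Real.exp (M2 μ1 * mFun T0 ω θ lam) := by


  obtain ⟨hcc, hlip, hcb, hcω, hder⟩ := hc
  set v := der T0 u with hvdef
  have hu1 : ∀ t ∈ Icc 0 T0, HasDerivWithinAt u (v t) (Icc 0 T0) t := fun t ht => (hu t ht).1
  have hv1 : ∀ t ∈ Icc 0 T0, HasDerivWithinAt v (-(lam ^ 2 * c t * u t)) (Icc 0 T0) t :=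
    fun t ht => (hu t ht).2
  have huc : ContinuousOn u (Icc 0 T0) := fun t ht => (hu1 t ht).continuousWithinAt
  have hvc : ContinuousOn v (Icc 0 T0) := fun t ht => (hv1 t ht).continuousWithinAt
  have hclos : closure (Ioo 0 T0) = Icc 0 T0 := closure_Ioo hT0.ne
  have hcl : ∀ t ∈ Icc 0 T0, μ1 ≤ c t ∧ c t ≤ μ2 := by
    intro t ht
    have htc : t ∈ closure (Ioo 0 T0) := by rwa [hclos]
    have hcw : ContinuousWithinAt c (Ioo 0 T0) t := (hcc t ht).mono Ioo_subset_Icc_self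
    exact ⟨ContinuousWithinAt.closure_le htc continuousWithinAt_const hcw fun y hy => (hcb y hy).1,
      ContinuousWithinAt.closure_le htc hcw continuousWithinAt_const fun y hy => (hcb y hy).2⟩
  set e : ℝ → ℝ := fun t => v t ^ 2 + lam ^ 2 * u t ^ 2 with he
  have he0 : ∀ t, 0 ≤ e t := fun t => by simp only [he]; positivity
  have hmin : 0 < min 1 μ1 := lt_min one_pos hμ1
  have hmax : 1 ≤ max 1 μ2 := le_max_left _ _
  set R : ℝ := max 1 μ2 / min 1 μ1 with hR
  have hR1 : 1 ≤ R := by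
    rw [hR, le_div_iff₀ hmin, one_mul]; exact (min_le_left _ _).trans hmax
  have hM2 : 0 < M2 μ1 := by
    have := Real.sqrt_pos.2 hμ1
    unfold M2; positivity
  have hM1 : M1 μ1 μ2 = R ^ 2 := rfl
  have hWpos : 0 < lam * ω (1 / lam) := mul_pos hlam (hω.1 _ (by positivity))
  -- integrability of θ away from zero
  have hθi : ∀ s ∈ Ioo 0 T0, IntervalIntegrable θ volume s T0 := by
    intro s hs
    rw [intervalIntegrable_iff_integrableOn_Ioo_of_le hs.2.le]
    have hsub : Ioo s T0 ⊆ Ioo 0 T0 := Ioo_subset_Ioo_left hs.1.le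
    refine IntegrableOn.of_bound (by simp)
      ((hθcont.mono hsub).aestronglyMeasurable measurableSet_Ioo) (θ s) ?_
    filter_upwards [ae_restrict_mem measurableSet_Ioo] with x hx
    rw [Real.norm_eq_abs, abs_of_pos (hθpos x (hsub hx))]
    exact hθmono hs (hsub hx) hx.1.le
  have hθn : ∀ s ∈ Ioc 0 T0, ∀ b ∈ Icc s T0, 0 ≤ ∫ t in b..T0, θ t := by
    intro s hs b hb
    rw [intervalIntegral.integral_of_le hb.2, integral_Ioc_eq_integral_Ioo]
    refine setIntegral_nonneg measurableSet_Ioo fun x hx => (hθpos x ⟨?_, hx.2⟩).le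
    exact hs.1.trans_le (hb.1.trans hx.1.le)
  have first : ∀ t ∈ Icc 0 T0, e t ≤ R * e 0 * Real.exp (M2 μ1 * (lam * ω (1 / lam) * t)) := by
    intro t ht
    have h := energy_first T0 μ1 μ2 ω c u v lam t hT0 hμ1 hμ12 hlam hω hcc hcl hcω hu1 hv1 ht
    rw [hR, div_mul_eq_mul_div, div_mul_eq_mul_div, le_div_iff₀ hmin, mul_comm]
    exact h
  have second : ∀ a b, 0 < a → a ≤ b → b < T0 →
      e b ≤ R * e a * Real.exp ((1 / μ1) * ∫ t in a..b, θ t) := by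
    intro a b ha hab hb
    have h := energy_second T0 μ1 θ c u v lam a b hμ1 ha hab hb hθcont hθpos hcc hlip
      (fun t ht => (hcl t ht).1) hder hu1 hv1
    have hca := hcl a ⟨ha.le, hab.trans hb.le⟩
    have hcb' := hcl b ⟨ha.le.trans hab, hb.le⟩
    have l1 : min 1 μ1 * e b ≤ v b ^ 2 + lam ^ 2 * (c b * u b ^ 2) := by
      have i1 := mul_le_mul_of_nonneg_right (min_le_left 1 μ1) (sq_nonneg (v b))
      have i2 := mul_le_mul_of_nonneg_right ((min_le_right 1 μ1).trans hcb'.1)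
        (mul_nonneg (sq_nonneg lam) (sq_nonneg (u b)))
      simp only [he]
      nlinarith
    have l2 : v a ^ 2 + lam ^ 2 * (c a * u a ^ 2) ≤ max 1 μ2 * e a := by
      have i1 := mul_le_mul_of_nonneg_right (le_max_left 1 μ2) (sq_nonneg (v a))
      have i2 := mul_le_mul_of_nonneg_right (hca.2.trans (le_max_right 1 μ2))
        (mul_nonneg (sq_nonneg lam) (sq_nonneg (u a)))
      simp only [he]
      nlinarith
    rw [hR, div_mul_eq_mul_div, div_mul_eq_mul_div, le_div_iff₀ hmin, mul_comm]
    exact l1.trans (h.trans (mul_le_mul_of_nonneg_right l2 (Real.exp_pos _).le))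
  -- the estimate for a fixed splitting time
  have main : ∀ s ∈ Ioc 0 T0, ∀ t ∈ Ico 0 T0, e t ≤ R ^ 2 * e 0 *
      Real.exp (M2 μ1 * (lam * ω (1 / lam) * s + ∫ t in s..T0, θ t)) := by
    intro s hs t ht
    have hI := hθn s hs s ⟨le_rfl, hs.2⟩
    rcases le_or_gt t s with hts | hts
    · refine (first t ⟨ht.1, ht.2.le⟩).trans ?_
      have h1 : R * e 0 ≤ R ^ 2 * e 0 := by
        apply mul_le_mul_of_nonneg_right _ (he0 0); nlinarith
      have h2 : M2 μ1 * (lam * ω (1 / lam) * t) ≤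
          M2 μ1 * (lam * ω (1 / lam) * s + ∫ t in s..T0, θ t) := by
        apply mul_le_mul_of_nonneg_left _ hM2.le
        have := mul_le_mul_of_nonneg_left hts hWpos.le
        linarith
      exact mul_le_mul h1 (Real.exp_le_exp.2 h2) (Real.exp_pos _).le
        (mul_nonneg (sq_nonneg _) (he0 0))
    · have hsT : s < T0 := hts.trans ht.2
      have h1 := second s t hs.1 hts.le ht.2
      have h2 := first s ⟨hs.1.le, hs.2⟩
      have hint : ∫ x in s..t, θ x ≤ ∫ x in s..T0, θ x := by
        have hadd := intervalIntegral.integral_add_adjacent_intervals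
          (a := s) (b := t) (c := T0) (μ := volume) (f := θ)
          ((hθi s ⟨hs.1, hsT⟩).mono_set (by
            rw [uIcc_of_le hts.le, uIcc_of_le hsT.le]; exact Icc_subset_Icc_right ht.2.le))
          (hθi t ⟨hs.1.trans hts, ht.2⟩)
        have := hθn s hs t ⟨hts.le, ht.2.le⟩
        linarith
      have hM : 1 / μ1 ≤ M2 μ1 := by
        have : 0 ≤ 1 / Real.sqrt μ1 := by positivity
        unfold M2; linarith
      have h3 : (1 / μ1) * ∫ x in s..t, θ x ≤ M2 μ1 * ∫ x in s..T0, θ x :=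
        (mul_le_mul_of_nonneg_left hint (by positivity)).trans
          (mul_le_mul_of_nonneg_right hM hI)
      calc e t ≤ R * e s * Real.exp ((1 / μ1) * ∫ t in s..t, θ t) := h1
        _ ≤ R * (R * e 0 * Real.exp (M2 μ1 * (lam * ω (1 / lam) * s))) *
            Real.exp (M2 μ1 * ∫ x in s..T0, θ x) := by
          have hR0 : 0 ≤ R := by linarith
          have := he0 0
          exact mul_le_mul (mul_le_mul_of_nonneg_left h2 hR0) (Real.exp_le_exp.2 h3)
            (Real.exp_pos _).le (by positivity)
        _ = _ := by rw [mul_add (M2 μ1), Real.exp_add]; ring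
  -- passing to the infimum
  have fin : ∀ t ∈ Ico 0 T0, e t ≤ R ^ 2 * e 0 * Real.exp (M2 μ1 * mFun T0 ω θ lam) := by
    intro t ht
    set S := (fun s => lam * ω (1 / lam) * s + ∫ t in s..T0, θ t) '' Ioc 0 T0 with hS
    have hne : S.Nonempty := ⟨_, T0, ⟨hT0, le_rfl⟩, rfl⟩
    have hbd : BddBelow S := by
      refine ⟨0, ?_⟩
      rintro _ ⟨s, hs, rfl⟩
      exact add_nonneg (mul_nonneg hWpos.le hs.1.le) (hθn s hs s ⟨le_rfl, hs.2⟩)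
    have hmon : Monotone (fun x => R ^ 2 * e 0 * Real.exp (M2 μ1 * x)) := by
      intro x y hxy
      exact mul_le_mul_of_nonneg_left
        (Real.exp_le_exp.2 (mul_le_mul_of_nonneg_left hxy hM2.le))
        (mul_nonneg (sq_nonneg _) (he0 0))
    have hcont : Continuous (fun x => R ^ 2 * e 0 * Real.exp (M2 μ1 * x)) := by fun_prop
    have hinf := hmon.map_csInf_of_continuousAt (A := S) hcont.continuousAt hne hbd
    have hm : mFun T0 ω θ lam = sInf S := rfl
    rw [hm]
    refine le_of_le_of_eq ?_ hinf.symm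
    apply le_csInf (hne.image _)
    rintro _ ⟨_, ⟨s, hs, rfl⟩, rfl⟩
    exact main s hs t ht
  intro t ht
  have htc : t ∈ closure (Ico 0 T0) := by rwa [closure_Ico hT0.ne]
  have hec : ContinuousOn e (Icc 0 T0) := (hvc.pow 2).add (continuousOn_const.mul (huc.pow 2))
  exact ContinuousWithinAt.closure_le htc ((hec t ht).mono Ico_subset_Icc_self)
    continuousWithinAt_const fin
end

section
/- In the setting of the ω-construction (c* ∈ D(T₀,μ₁,μ₂,ω,θ;T₁,γ,η), ν₁ := min{1, √μ₁/π}, λ > 0 with ν₁·ω(1/λ) ≤ 8γ³ and (ν₁/(2γ))·ω(1/λ) ≤ min{γ² − μ₁, μ₂ − γ²}, 0 < a < b < T₁ with a·γ·λ/(2π), b·γ·λ/(2π) ∈ ℕ, ω(b) ≤ η·ω(T₁ − b), ν₁·λ·ω(1/λ) ≤ θ(b), ε := ν₁·λ·ω(1/λ), c_λ := c* on [0,a] ∪ [b,T₀] and c_λ := γ² − φ_{ε,γ,λ} on [a,b]), the solution u_λ of u'' + λ²·c_λ(t)·u = 0 with u_λ(0) = 0 and u_λ'(0) = 1 satisfies,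 for every t ∈ [b,T₀], u_λ'(t)² + λ²·u_λ(t)² ≥ min{1, 1/μ₂}·exp(−(1/μ₁)·∫_{T₁}^{T₀} θ(τ) dτ)·exp((ν₁/(8μ₂))·λ·ω(1/λ)·(b − a)). -/
open Set Filter MeasureTheory

/-- Membership in the class `D(T₀,μ₁,μ₂,ω,θ; T₁,γ,η)`. -/
def MemD (T0 μ1 μ2 : ℝ) (ω θ : ℝ → ℝ) (T1 γ η : ℝ) (c : ℝ → ℝ) : Prop :=
  MemPS T0 μ1 μ2 ω θ c ∧
  (∀ t ∈ Icc 0 T1, c t = γ ^ 2) ∧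
  (∀ t ∈ Icc 0 T0, ∀ s ∈ Icc 0 T0, |c t - c s| ≤ (1 - η) * ω |t - s|)

/-- The building-block perturbation
`φ_{ε,γ,λ}(t) = (ε/(4γλ)) sin(2γλt) + (ε²/(64γ⁴λ²)) sin⁴(γλt)`. -/
noncomputable def phiF (ε γ lam t : ℝ) : ℝ :=
  ε / (4 * γ * lam) * Real.sin (2 * γ * lam * t) +
    ε ^ 2 / (64 * γ ^ 4 * lam ^ 2) * (Real.sin (γ * lam * t)) ^ 4

/-- The constant `ν₁ = min{1, √μ₁/π}`. -/
noncomputable def nu1 (μ1 : ℝ) : ℝ := min 1 (Real.sqrt μ1 / Real.pi)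

/-- The coefficient of the `ω`-construction: `c* ` outside `[a,b]`, and
`γ² - φ_{ε,γ,λ}` on `[a,b]`. -/
noncomputable def omegaConstr (cstar : ℝ → ℝ) (ε γ lam a b : ℝ) : ℝ → ℝ :=
  fun t => if a ≤ t ∧ t ≤ b then γ ^ 2 - phiF ε γ lam t else cstar t



lemma aux_zero_uniq (p q K : ℝ) (z y k : ℝ → ℝ)
    (hz : ∀ t ∈ Icc p q, HasDerivWithinAt z (y t) (Icc p q) t)
    (hy : ∀ t ∈ Icc p q, HasDerivWithinAt y (-(k t * z t)) (Icc p q) t)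
    (hk : ∀ t ∈ Icc p q, |k t| ≤ K) (hz0 : z p = 0) (hy0 : y p = 0) :
    ∀ t ∈ Icc p q, z t = 0 ∧ y t = 0 := by
  have hd : ∀ t ∈ Icc p q, HasDerivWithinAt (fun t => z t ^ 2 + y t ^ 2)
      (2 * z t * y t + 2 * y t * (-(k t * z t))) (Icc p q) t := by
    intro t ht
    have := ((hz t ht).pow 2).add ((hy t ht).pow 2)
    refine this.congr_deriv ?_
    simp
  have h0 := eq_zero_of_abs_deriv_le_mul_abs_self_of_eq_zero_right (K := 1 + K)
    (f := fun t => z t ^ 2 + y t ^ 2)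
    (f' := fun t => 2 * z t * y t + 2 * y t * (-(k t * z t))) (a := p) (b := q)
    (fun t ht => (hd t ht).continuousWithinAt)
    (fun t ht => (hd t (Ico_subset_Icc_self ht)).mono_of_mem_nhdsWithin (Icc_mem_nhdsGE_of_mem ht))
    (by simp [hz0, hy0])
    (by
      intro t ht
      have h1 := abs_le.1 (hk t (Ico_subset_Icc_self ht))
      rw [Real.norm_eq_abs, Real.norm_eq_abs, abs_of_nonneg (by positivity : 0 ≤ z t ^ 2 + y t ^ 2)]
      have e : 2 * z t * y t + 2 * y t * (-(k t * z t)) = (1 - k t) * (2 * z t * y t) := by ring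
      rw [e, abs_mul]
      apply mul_le_mul _ _ (abs_nonneg _) (by linarith)
      · rw [abs_le]; constructor <;> linarith
      · rw [abs_le]; constructor <;> nlinarith [sq_nonneg (z t + y t), sq_nonneg (z t - y t)])
  intro t ht
  have := h0 t ht
  constructor <;> nlinarith [sq_nonneg (z t), sq_nonneg (y t)]

lemma aux_uniq (p q K : ℝ) (u v w x k : ℝ → ℝ)
    (hu : ∀ t ∈ Icc p q, HasDerivWithinAt u (v t) (Icc p q) t)
    (hv : ∀ t ∈ Icc p q, HasDerivWithinAt v (-(k t * u t)) (Icc p q) t)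
    (hw : ∀ t ∈ Icc p q, HasDerivWithinAt w (x t) (Icc p q) t)
    (hx : ∀ t ∈ Icc p q, HasDerivWithinAt x (-(k t * w t)) (Icc p q) t)
    (hk : ∀ t ∈ Icc p q, |k t| ≤ K) (h0 : u p = w p) (h1 : v p = x p) :
    ∀ t ∈ Icc p q, u t = w t ∧ v t = x t := by
  intro t ht
  have := aux_zero_uniq p q K (fun t => u t - w t) (fun t => v t - x t) k
    (fun t ht => (hu t ht).sub (hw t ht))
    (fun t ht => ((hv t ht).sub (hx t ht)).congr_deriv (by ring)) hk
    (by simp [h0]) (by simp [h1]) t ht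
  exact ⟨sub_eq_zero.1 this.1, sub_eq_zero.1 this.2⟩

lemma aux_ac (p q : ℝ) (hpq : p ≤ q) (f f' : ℝ → ℝ)
    (hf : ∀ t ∈ Icc p q, HasDerivWithinAt f (f' t) (Icc p q) t)
    (hf' : ContinuousOn f' (Icc p q)) : AbsolutelyContinuousOnInterval f p q := by
  obtain ⟨C, hC⟩ := isCompact_Icc.exists_bound_of_continuousOn hf'
  refine LipschitzOnWith.absolutelyContinuousOnInterval (K := C.toNNReal) ?_
  rw [uIcc_of_le hpq]
  refine (convex_Icc p q).lipschitzOnWith_of_nnnorm_hasDerivWithin_le hf ?_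
  intro x hx
  rw [← NNReal.coe_le_coe]
  exact (hC x hx).trans (Real.le_coe_toNNReal C)

lemma aux_energy (p q μ1 lam : ℝ) (hpq : p ≤ q) (hμ : 0 < μ1) (u v c θ : ℝ → ℝ)
    (hu : ∀ t ∈ Icc p q, HasDerivWithinAt u (v t) (Icc p q) t)
    (hv : ∀ t ∈ Icc p q, HasDerivWithinAt v (-(lam ^ 2 * c t * u t)) (Icc p q) t)
    (hc : LocallyLipschitzOn (Icc p q) c) (hcμ : ∀ t ∈ Icc p q, μ1 ≤ c t)
    (hθ : Continuous θ)
    (hd : ∀ᵐ t : ℝ, t ∈ Ioo p q → |deriv c t| ≤ θ t) :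
    (v p ^ 2 + lam ^ 2 * (c p * u p ^ 2)) * Real.exp (-(1 / μ1) * ∫ τ in p..q, θ τ) ≤
      v q ^ 2 + lam ^ 2 * (c q * u q ^ 2) := by
  have huc : ContinuousOn u (Icc p q) := fun t ht => (hu t ht).continuousWithinAt
  have hvc : ContinuousOn v (Icc p q) := fun t ht => (hv t ht).continuousWithinAt
  have hcc := hc.continuousOn
  have acu := aux_ac p q hpq u v hu hvc
  have acv := aux_ac p q hpq v _ hv (by fun_prop)
  obtain ⟨K, hK⟩ := hc.exists_lipschitzOnWith_of_compact isCompact_Icc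
  rw [← uIcc_of_le hpq] at hK
  have acc := hK.absolutelyContinuousOnInterval
  have hI : ∀ t, HasDerivAt (fun t => ∫ τ in p..t, θ τ) (θ t) t := fun t =>
    intervalIntegral.integral_hasDerivAt_right (hθ.intervalIntegrable _ _)
      (hθ.stronglyMeasurableAtFilter _ _) hθ.continuousAt
  have hE : ∀ t, HasDerivAt (fun t => Real.exp ((1 / μ1) * ∫ τ in p..t, θ τ))
      (Real.exp ((1 / μ1) * ∫ τ in p..t, θ τ) * ((1 / μ1) * θ t)) t := fun t =>
    ((hI t).const_mul (1 / μ1)).exp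
  have hIc : Continuous (fun t => ∫ τ in p..t, θ τ) :=
    continuous_iff_continuousAt.2 fun t => (hI t).continuousAt
  have acE := aux_ac p q hpq _ _ (fun t _ => (hE t).hasDerivWithinAt) (by fun_prop)
  have acG := ((acv.fun_mul acv).fun_add
    ((acc.fun_mul (acu.fun_mul acu)).const_mul (lam ^ 2))).fun_mul acE
  have key := acG.integral_deriv_eq_sub
  have hnn : 0 ≤ ∫ (x : ℝ) in p..q, deriv (fun t => (v t * v t + lam ^ 2 * (c t * (u t * u t))) *
      Real.exp ((1 / μ1) * ∫ τ in p..t, θ τ)) x := by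
    apply intervalIntegral.integral_nonneg_of_ae_restrict hpq
    rw [Filter.EventuallyLE, ae_restrict_iff' measurableSet_Icc]
    have e1 : ∀ᵐ x : ℝ, x ≠ p := by simp [ae_iff]
    have e2 : ∀ᵐ x : ℝ, x ≠ q := by simp [ae_iff]
    filter_upwards [hd, e1, e2, acc.ae_differentiableAt] with t h1 h2 h3 h4 ht
    have ht' : t ∈ Ioo p q := ⟨lt_of_le_of_ne ht.1 (Ne.symm h2), lt_of_le_of_ne ht.2 h3⟩
    have hcd := (h4 (by rwa [uIcc_of_le hpq])).hasDerivAt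
    have hud := (hu t ht).hasDerivAt (Icc_mem_nhds ht'.1 ht'.2)
    have hvd := (hv t ht).hasDerivAt (Icc_mem_nhds ht'.1 ht'.2)
    have hG := ((hvd.fun_mul hvd).fun_add
      ((hcd.fun_mul (hud.fun_mul hud)).const_mul (lam ^ 2))).fun_mul (hE t)
    rw [hG.deriv]
    have hθ1 := h1 ht'
    have hθ0 : 0 ≤ θ t := (abs_nonneg _).trans hθ1
    have hl := (abs_le.1 hθ1).1
    have hcm := hcμ t ht
    set E := Real.exp ((1 / μ1) * ∫ τ in p..t, θ τ) with hEdef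
    have hEp : 0 < E := Real.exp_pos _
    have hX : 0 ≤ lam ^ 2 * (deriv c t * (u t) ^ 2) +
        (v t ^ 2 + lam ^ 2 * (c t * u t ^ 2)) * ((1 / μ1) * θ t) := by
      have a1 : lam ^ 2 * u t ^ 2 * (-θ t) ≤ lam ^ 2 * u t ^ 2 * deriv c t :=
        mul_le_mul_of_nonneg_left hl (by positivity)
      have a2 : 0 ≤ v t ^ 2 * ((1 / μ1) * θ t) := by positivity
      have a3 : 1 ≤ c t * (1 / μ1) := by
        rw [mul_one_div, le_div_iff₀ hμ]; linarith
      have a4 : lam ^ 2 * u t ^ 2 * θ t * 1 ≤ lam ^ 2 * u t ^ 2 * θ t * (c t * (1 / μ1)) :=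
        mul_le_mul_of_nonneg_left a3 (by positivity)
      nlinarith
    have := mul_nonneg hX hEp.le
    simp only [Pi.zero_apply]
    nlinarith
  rw [key] at hnn
  simp only [intervalIntegral.integral_same, mul_zero, Real.exp_zero, mul_one] at hnn
  rw [neg_mul, Real.exp_neg, ← div_eq_mul_inv, div_le_iff₀ (Real.exp_pos _)]
  nlinarith

lemma aux_sin (n : ℕ) (s t : ℝ) (h : s * t = 2 * Real.pi * n) :
    Real.sin (s * t) = 0 ∧ Real.cos (s * t) = 1 ∧ Real.sin (2 * (s * t)) = 0 := by
  have e : s * t = n * (2 * Real.pi) := by rw [h]; ring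
  have h1 : Real.sin (s * t) = 0 := by
    have := Real.sin_nat_mul_pi (2 * n)
    rw [e, ← this]; push_cast; ring_nf
  refine ⟨h1, ?_, ?_⟩
  · rw [e]; exact Real.cos_nat_mul_two_pi n
  · rw [Real.sin_two_mul, h1]; ring

lemma aux_explicit (a s κ : ℝ) (hs : 0 < s) (t : ℝ) :
    HasDerivAt (fun t => Real.sin (s * t) / s *
        Real.exp (κ * ((t - a) / 2 - Real.sin (2 * (s * t)) / (4 * s))))
      ((Real.cos (s * t) + κ / s * Real.sin (s * t) ^ 3) *
        Real.exp (κ * ((t - a) / 2 - Real.sin (2 * (s * t)) / (4 * s)))) t ∧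
    HasDerivAt (fun t => (Real.cos (s * t) + κ / s * Real.sin (s * t) ^ 3) *
        Real.exp (κ * ((t - a) / 2 - Real.sin (2 * (s * t)) / (4 * s))))
      (-((s ^ 2 - 2 * s * κ * Real.sin (2 * (s * t)) - κ ^ 2 * Real.sin (s * t) ^ 4) *
        (Real.sin (s * t) / s *
        Real.exp (κ * ((t - a) / 2 - Real.sin (2 * (s * t)) / (4 * s)))))) t := by
  have hl : HasDerivAt (fun t => s * t) s t := by
    simpa using (hasDerivAt_id t).const_mul s
  have hsin := hl.sin
  have hcos := hl.cos
  have h2 := (hl.const_mul 2).sin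
  have hpsi : HasDerivAt (fun t => κ * ((t - a) / 2 - Real.sin (2 * (s * t)) / (4 * s)))
      (κ * Real.sin (s * t) ^ 2) t := by
    have := ((((hasDerivAt_id t).sub_const a).div_const 2).sub (h2.div_const (4 * s))).const_mul κ
    refine this.congr_deriv ?_
    rw [Real.cos_two_mul, Real.cos_sq']
    field_simp
    ring
  have hexp := hpsi.exp
  constructor
  · refine ((hsin.div_const s).mul hexp).congr_deriv ?_
    field_simp
  · refine ((hcos.add ((hsin.pow 3).const_mul (κ / s))).mul hexp).congr_deriv ?_
    rw [Real.sin_two_mul]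
    simp only [Pi.add_apply, Pi.pow_apply]
    field_simp
    push_cast
    try ring

lemma aux_integrable (T0 T1 : ℝ) (θ : ℝ → ℝ) (hθcont : ContinuousOn θ (Ioo 0 T0))
    (hθpos : ∀ t ∈ Ioo 0 T0, 0 < θ t)
    (hθmono : AntitoneOn θ (Ioo 0 T0))
    (hT1 : T1 ∈ Ioo 0 T0) : IntervalIntegrable θ volume T1 T0 := by
  rw [intervalIntegrable_iff_integrableOn_Ioo_of_le hT1.2.le]
  have hsub : Ioo T1 T0 ⊆ Ioo 0 T0 := Ioo_subset_Ioo_left hT1.1.le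
  refine Integrable.of_bound
    ((hθcont.mono hsub).aestronglyMeasurable measurableSet_Ioo) (θ T1) ?_
  rw [ae_restrict_iff' measurableSet_Ioo]
  refine ae_of_all _ fun t ht => ?_
  rw [Real.norm_eq_abs, abs_of_pos (hθpos t (hsub ht))]
  exact hθmono hT1 (hsub ht) ht.1.le

/-- `ω`-construction, Proposition `prop:omega`, statement (2). -/
theorem omega_construction_energy_growth
    (T0 μ1 μ2 T1 γ η : ℝ) (ω θ : ℝ → ℝ)
    (hT0 : 0 < T0) (hμ1 : 0 < μ1) (hμ12 : μ1 < μ2)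
    (hω : IsModulusOfContinuity ω)
    (hθcont : ContinuousOn θ (Ioo 0 T0))
    (hθpos : ∀ t ∈ Ioo 0 T0, 0 < θ t)
    (hθmono : AntitoneOn θ (Ioo 0 T0))
    (hT1 : T1 ∈ Ioo 0 T0) (hγ : 0 < γ) (hγ2 : γ ^ 2 ∈ Ioo μ1 μ2) (hη : η ∈ Ioo 0 1)
    (cstar : ℝ → ℝ) (hcstar : MemD T0 μ1 μ2 ω θ T1 γ η cstar)
    (lam : ℝ) (hlam : 0 < lam)
    (hlam1 : nu1 μ1 * ω (1 / lam) ≤ 8 * γ ^ 3)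
    (hlam2 : nu1 μ1 / (2 * γ) * ω (1 / lam) ≤ min (γ ^ 2 - μ1) (μ2 - γ ^ 2))
    (a b : ℝ) (ha : 0 < a) (hab : a < b) (hb : b < T1)
    (haN : ∃ n : ℕ, a * γ * lam / (2 * Real.pi) = n)
    (hbN : ∃ n : ℕ, b * γ * lam / (2 * Real.pi) = n)
    (hωb : ω b ≤ η * ω (T1 - b))
    (hθb : nu1 μ1 * lam * ω (1 / lam) ≤ θ b)
    (u : ℝ → ℝ)
    (hu : IsSol T0 lam (omegaConstr cstar (nu1 μ1 * lam * ω (1 / lam)) γ lam a b) u)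
    (hu0 : u 0 = 0) (hu1 : der T0 u 0 = 1) :
    ∀ t ∈ Icc b T0,
      min 1 (1 / μ2) *
          Real.exp (-(1 / μ1) * ∫ τ in T1..T0, θ τ) *
          Real.exp (nu1 μ1 / (8 * μ2) * (lam * ω (1 / lam)) * (b - a)) ≤
        (der T0 u t) ^ 2 + lam ^ 2 * (u t) ^ 2 := by
  obtain ⟨⟨hcC, hcL, hcμ, -, hcd⟩, hcγ, -⟩ := hcstar
  obtain ⟨na, hna⟩ := haN
  obtain ⟨nb, hnb⟩ := hbN
  have hω0 : 0 < ω (1 / lam) := hω.1 _ (by positivity)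
  have hν : 0 < nu1 μ1 := by
    unfold nu1
    exact lt_min one_pos (div_pos (Real.sqrt_pos.2 hμ1) Real.pi_pos)
  set ε := nu1 μ1 * lam * ω (1 / lam) with hε
  have hεp : 0 < ε := by positivity
  set C := omegaConstr cstar ε γ lam a b with hC
  set v := der T0 u with hv
  have hμ2 : 0 < μ2 := hμ1.trans hμ12
  obtain ⟨s, hs⟩ : ∃ s, s = γ * lam := ⟨_, rfl⟩
  have hsp : 0 < s := by rw [hs]; positivity
  have hsa : s * a = 2 * Real.pi * na := by
    rw [← hna, hs]; field_simp
  have hsb : s * b = 2 * Real.pi * nb := by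
    rw [← hnb, hs]; field_simp
  obtain ⟨sa1, sa2, sa3⟩ := aux_sin na s a hsa
  obtain ⟨sb1, sb2, sb3⟩ := aux_sin nb s b hsb
  have hphi : ∀ t, phiF ε γ lam t = ε / (4 * γ * lam) * Real.sin (2 * (s * t)) +
      ε ^ 2 / (64 * γ ^ 4 * lam ^ 2) * (Real.sin (s * t)) ^ 4 := by
    intro t
    unfold phiF
    rw [hs]; ring_nf
  have hT1' := hT1.1
  have hT1'' := hT1.2
  have hbT0 : b < T0 := hb.trans hT1''
  have hC1 : ∀ t ∈ Icc 0 a, C t = γ ^ 2 := by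
    intro t ht
    by_cases h : a ≤ t
    · have : t = a := le_antisymm ht.2 h
      subst this
      rw [hC]; unfold omegaConstr
      rw [if_pos ⟨le_rfl, hab.le⟩, hphi, sa1, sa3]; ring
    · rw [hC]; unfold omegaConstr
      rw [if_neg (fun h' => h h'.1)]
      exact hcγ t ⟨ht.1, by linarith [ht.2]⟩
  have hC2 : ∀ t ∈ Icc a b, C t = γ ^ 2 - phiF ε γ lam t := by
    intro t ht
    rw [hC]; unfold omegaConstr
    rw [if_pos ⟨ht.1, ht.2⟩]
  have hC3 : ∀ t ∈ Icc b T0, C t = cstar t := by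
    intro t ht
    by_cases h : t = b
    · subst h
      rw [hC2 t ⟨hab.le, le_rfl⟩, hphi, sb1, sb3, hcγ t ⟨by linarith, hb.le⟩]; ring
    · rw [hC]; unfold omegaConstr
      rw [if_neg (fun h' => h (le_antisymm h'.2 ht.1))]
  have hsol : ∀ p q, 0 ≤ p → q ≤ T0 → ∀ t ∈ Icc p q,
      HasDerivWithinAt u (v t) (Icc p q) t ∧
      HasDerivWithinAt v (-(lam ^ 2 * C t * u t)) (Icc p q) t := by
    intro p q hp hq t ht
    have hsub : Icc p q ⊆ Icc 0 T0 := Icc_subset_Icc hp hq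
    exact ⟨((hu t (hsub ht)).1).mono hsub, ((hu t (hsub ht)).2).mono hsub⟩
  have hA : u a = 0 ∧ v a = 1 := by
    have := aux_uniq 0 a (s ^ 2) u v _ _ (fun _ => s ^ 2)
      (fun t ht => (hsol 0 a le_rfl (by linarith) t ht).1)
      (fun t ht => ((hsol 0 a le_rfl (by linarith) t ht).2).congr_deriv
        (by rw [hC1 t ht, hs]; ring))
      (fun t _ => ((aux_explicit 0 s 0 hsp t).1).hasDerivWithinAt)
      (fun t _ => ((aux_explicit 0 s 0 hsp t).2).hasDerivWithinAt.congr_deriv (by ring))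
      (fun t _ => by rw [abs_of_nonneg (by positivity)])
      (by simp [hu0]) (by simp [hu1]) a ⟨ha.le, le_rfl⟩
    refine ⟨this.1.trans ?_, this.2.trans ?_⟩
    · simp [sa1]
    · simp [sa2]
  set κ := ε / (8 * γ ^ 2) with hκ
  have hB : u b = 0 ∧ v b = Real.exp (κ * ((b - a) / 2)) := by
    have hcont : Continuous (fun t => s ^ 2 - 2 * s * κ * Real.sin (2 * (s * t)) -
        κ ^ 2 * Real.sin (s * t) ^ 4) := by fun_prop
    obtain ⟨K, hK⟩ := (isCompact_Icc (a := a) (b := b)).exists_bound_of_continuousOn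
      hcont.continuousOn
    have := aux_uniq a b K u v _ _ (fun t => s ^ 2 - 2 * s * κ * Real.sin (2 * (s * t)) -
        κ ^ 2 * Real.sin (s * t) ^ 4)
      (fun t ht => (hsol a b ha.le hbT0.le t ht).1)
      (fun t ht => ((hsol a b ha.le hbT0.le t ht).2).congr_deriv
        (by
          rw [hC2 t ht, hphi]
          have : lam ^ 2 * (γ ^ 2 - (ε / (4 * γ * lam) * Real.sin (2 * (s * t)) +
            ε ^ 2 / (64 * γ ^ 4 * lam ^ 2) * (Real.sin (s * t)) ^ 4)) =
            s ^ 2 - 2 * s * κ * Real.sin (2 * (s * t)) - κ ^ 2 * Real.sin (s * t) ^ 4 := by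
            generalize Real.sin (2 * (s * t)) = A
            generalize Real.sin (s * t) = B
            rw [hκ, hs]; field_simp; ring
          rw [this]))
      (fun t _ => ((aux_explicit a s κ hsp t).1).hasDerivWithinAt)
      (fun t _ => ((aux_explicit a s κ hsp t).2).hasDerivWithinAt)
      hK
      (by simp [hA.1, sa1]) (by simp [hA.2, sa1, sa2, sa3]) b ⟨hab.le, le_rfl⟩
    refine ⟨this.1.trans ?_, this.2.trans ?_⟩
    · simp [sb1]
    · simp [sb1, sb2, sb3]
  have hvb : Real.exp (nu1 μ1 / (8 * μ2) * (lam * ω (1 / lam)) * (b - a)) ≤ v b ^ 2 := by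
    rw [hB.2, sq, ← Real.exp_add]
    apply Real.exp_le_exp.2
    have e1 : nu1 μ1 / (8 * μ2) * (lam * ω (1 / lam)) * (b - a) = ε * (b - a) / (8 * μ2) := by
      rw [hε]; ring
    have e2 : κ * ((b - a) / 2) + κ * ((b - a) / 2) = ε * (b - a) / (8 * γ ^ 2) := by
      rw [hκ]; ring
    rw [e1, e2]
    have : 0 ≤ b - a := by linarith
    have h3 := hγ2.2.le
    gcongr
  have hint := aux_integrable T0 T1 θ hθcont hθpos hθmono hT1
  have hIoc0 : ∀ᵐ t ∂(volume.restrict (Ioc T1 T0)), 0 ≤ θ t := by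
    rw [ae_restrict_iff' measurableSet_Ioc]
    have e2 : ∀ᵐ x : ℝ, x ≠ T0 := by simp [ae_iff]
    filter_upwards [e2] with t h1 ht
    exact (hθpos t ⟨hT1'.trans ht.1, lt_of_le_of_ne ht.2 h1⟩).le
  have hen : ∀ t ∈ Ico b T0, v b ^ 2 * Real.exp (-(1 / μ1) * ∫ τ in T1..T0, θ τ) ≤
      v t ^ 2 + lam ^ 2 * (cstar t * u t ^ 2) := by
    have hgen : ∀ p q, b ≤ p → p ≤ q → q < T0 → ∀ θ' : ℝ → ℝ, Continuous θ' →
        (∀ᵐ t : ℝ, t ∈ Ioo p q → |deriv cstar t| ≤ θ' t) →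
        (v p ^ 2 + lam ^ 2 * (cstar p * u p ^ 2)) *
          Real.exp (-(1 / μ1) * ∫ τ in p..q, θ' τ) ≤
        v q ^ 2 + lam ^ 2 * (cstar q * u q ^ 2) := by
      intro p q hp hpq hq θ' hθ' hae
      have hsub : Icc p q ⊆ Ioo 0 T0 := fun t ht =>
        ⟨by linarith [ht.1], by linarith [ht.2]⟩
      refine aux_energy p q μ1 lam hpq hμ1 u v cstar θ'
        (fun t ht => (hsol p q (by linarith) hq.le t ht).1)
        (fun t ht => ((hsol p q (by linarith) hq.le t ht).2).congr_deriv ?_)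
        (hcL.mono hsub) (fun t ht => (hcμ t (hsub ht)).1) hθ' hae
      rw [hC3 t ⟨hp.trans ht.1, ht.2.trans hq.le⟩]
    have hfirst : ∀ t ∈ Icc b T1, v b ^ 2 ≤ v t ^ 2 + lam ^ 2 * (cstar t * u t ^ 2) := by
      intro t ht
      have := hgen b t le_rfl ht.1 (by linarith [ht.2]) (fun _ => 0) continuous_const
        (ae_of_all _ (by
          intro x hx
          have : cstar =ᶠ[nhds x] fun _ => γ ^ 2 := by
            filter_upwards [Ioo_mem_nhds hx.1 hx.2] with y hy
            exact hcγ y ⟨by linarith [hy.1], by linarith [hy.2, ht.2]⟩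
          rw [this.deriv_eq]; simp))
      simpa [hB.1] using this
    have hI0 : 0 ≤ ∫ τ in T1..T0, θ τ := by
      have := intervalIntegral.integral_mono_interval (c := T1) (d := T0) (a := T1) (b := T1)
        le_rfl le_rfl hT1''.le hIoc0 hint
      simpa using this
    intro t ht
    rcases le_total t T1 with h | h
    · refine le_trans ?_ (hfirst t ⟨ht.1, h⟩)
      refine mul_le_of_le_one_right (sq_nonneg _) ?_
      apply Real.exp_le_one_iff.2
      rw [neg_mul]
      have : 0 ≤ 1 / μ1 * ∫ τ in T1..T0, θ τ := by positivity
      linarith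
    · have hsub : Icc T1 t ⊆ Ioo 0 T0 := fun y hy =>
        ⟨by linarith [hy.1], by linarith [hy.2, ht.2]⟩
      have hext : Continuous (IccExtend h ((Icc T1 t).restrict θ)) :=
        (continuousOn_iff_continuous_restrict.1 (hθcont.mono hsub)).Icc_extend'
      have heq : ∀ y ∈ Icc T1 t, IccExtend h ((Icc T1 t).restrict θ) y = θ y := by
        intro y hy
        rw [IccExtend_of_mem _ _ hy]; rfl
      have h1 := hgen T1 t hb.le h ht.2 _ hext (by
        rw [ae_restrict_iff' measurableSet_Ioo] at hcd
        filter_upwards [hcd] with y hy hy'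
        rw [heq y (Ioo_subset_Icc_self hy')]
        exact hy (hsub (Ioo_subset_Icc_self hy')))
      have h2 : ∫ τ in T1..t, IccExtend h ((Icc T1 t).restrict θ) τ = ∫ τ in T1..t, θ τ := by
        apply intervalIntegral.integral_congr
        intro y hy
        rw [uIcc_of_le h] at hy
        exact heq y hy
      rw [h2] at h1
      have h3 : ∫ τ in T1..t, θ τ ≤ ∫ τ in T1..T0, θ τ :=
        intervalIntegral.integral_mono_interval le_rfl h ht.2.le hIoc0 hint
      refine le_trans ?_ h1
      apply mul_le_mul (hfirst T1 ⟨hb.le, le_rfl⟩) _ (Real.exp_pos _).le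
      · exact (sq_nonneg _).trans (hfirst T1 ⟨hb.le, le_rfl⟩)
      · apply Real.exp_le_exp.2
        rw [neg_mul, neg_mul]
        apply neg_le_neg
        exact mul_le_mul_of_nonneg_left h3 (by positivity)
  have hfin : ∀ t ∈ Ico b T0, min 1 (1 / μ2) *
          Real.exp (-(1 / μ1) * ∫ τ in T1..T0, θ τ) *
          Real.exp (nu1 μ1 / (8 * μ2) * (lam * ω (1 / lam)) * (b - a)) ≤
        (v t) ^ 2 + lam ^ 2 * (u t) ^ 2 := by
    intro t ht
    have h1 := hen t ht
    have hm0 : 0 < min 1 (1 / μ2) := lt_min one_pos (by positivity)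
    have hm1 : min 1 (1 / μ2) ≤ 1 := min_le_left _ _
    have hm2 : min 1 (1 / μ2) * μ2 ≤ 1 := by
      have := mul_le_mul_of_nonneg_right (min_le_right 1 (1 / μ2)) hμ2.le
      rwa [one_div_mul_cancel hμ2.ne'] at this
    have hct := (hcμ t ⟨by linarith [ht.1], ht.2⟩).2
    have hX := Real.exp_pos (-(1 / μ1) * ∫ τ in T1..T0, θ τ)
    have h2 : min 1 (1 / μ2) *
          Real.exp (-(1 / μ1) * ∫ τ in T1..T0, θ τ) *
          Real.exp (nu1 μ1 / (8 * μ2) * (lam * ω (1 / lam)) * (b - a)) ≤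
        min 1 (1 / μ2) * (v b ^ 2 * Real.exp (-(1 / μ1) * ∫ τ in T1..T0, θ τ)) := by
      rw [mul_assoc]
      apply mul_le_mul_of_nonneg_left _ hm0.le
      rw [mul_comm]
      exact mul_le_mul_of_nonneg_right hvb hX.le
    refine h2.trans ((mul_le_mul_of_nonneg_left h1 hm0.le).trans ?_)
    rw [mul_add]
    apply add_le_add
    · exact mul_le_of_le_one_left (sq_nonneg _) hm1
    · have e : min 1 (1 / μ2) * (lam ^ 2 * (cstar t * u t ^ 2)) =
        (min 1 (1 / μ2) * cstar t) * (lam ^ 2 * u t ^ 2) := by ring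
      rw [e]
      apply mul_le_of_le_one_left (by positivity)
      exact (mul_le_mul_of_nonneg_left hct hm0.le).trans hm2
  intro t ht
  rcases lt_or_eq_of_le ht.2 with h | h
  · exact hfin t ⟨ht.1, h⟩
  · subst h
    have hcon : ContinuousWithinAt (fun y => v y ^ 2 + lam ^ 2 * u y ^ 2) (Icc 0 t) t :=
      (((hu t ⟨hT0.le, le_rfl⟩).2.continuousWithinAt).pow 2).add
        (continuousWithinAt_const.mul (((hu t ⟨hT0.le, le_rfl⟩).1.continuousWithinAt).pow 2))
    have hcon' := hcon.mono (show Ico b t ⊆ Icc 0 t from fun y hy =>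
      ⟨by linarith [hy.1], hy.2.le⟩)
    have hne : (nhdsWithin t (Ico b t)).NeBot := by
      rw [← mem_closure_iff_nhdsWithin_neBot, closure_Ico hbT0.ne]
      exact ⟨hbT0.le, le_rfl⟩
    refine ge_of_tendsto hcon' ?_
    filter_upwards [self_mem_nhdsWithin] with y hy
    exact hfin y hy
end

section
/- In the setting of the θ-construction (c* ∈ D(T₀,μ₁,μ₂,ω,θ;T₁,γ,η), ν₂ := (1/2)·min{1, √μ₁/π}, λ > 0 with ν₂·ω(1/λ) ≤ 8γ³ and (ν₂/(2γ))·ω(1/λ) ≤ min{γ² − μ₁, μ₂ − γ²}, 0 < a < b < T₁ with a·γ·λ/(2π), b·γ·λ/(2π) ∈ ℕ, ω(b) ≤ η·ω(T₁ − b), λ·ω(1/λ) ≥ θ(a), t_i := a + (2π/(γλ))·i, ε_i := ν₂·θ(t_i), c_λ := c* on [0,a] ∪ [b,T₀] and c_λ := γ² − φ_{ε_i,γ,λ} on [t_{i−1},t_i] for i = 1,…,k where k := γλ(b−a)/(2π)), the solution u_λ of u'' + λ²·c_λ(t)·u = 0 with u_λ(0) = 0 and u_λ'(0) = 1 satisfies,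 for every t ∈ [b,T₀], u_λ'(t)² + λ²·u_λ(t)² ≥ min{1, 1/μ₂}·exp(−(1/μ₁)·∫_{T₁}^{T₀} θ(τ) dτ − 2π)·exp((ν₂/(8μ₂))·∫_a^b θ(τ) dτ). -/
open Set Filter MeasureTheory

/-- The constant `ν₂ = (1/2) · min{1, √μ₁/π}`. -/
noncomputable def nu2 (μ1 : ℝ) : ℝ := 1 / 2 * min 1 (Real.sqrt μ1 / Real.pi)

/-- The nodes `tᵢ = a + (2π/(γλ)) i` of the `θ`-construction. -/
noncomputable def tNode (a γ lam : ℝ) (i : ℕ) : ℝ := a + 2 * Real.pi / (γ * lam) * i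


lemma ode_zero (p q lam M : ℝ) (c v v1 : ℝ → ℝ)
    (hc : ∀ t ∈ Icc p q, |c t| ≤ M)
    (hv : ∀ t ∈ Icc p q, HasDerivWithinAt v (v1 t) (Icc p q) t)
    (hv1 : ∀ t ∈ Icc p q, HasDerivWithinAt v1 (-(lam ^ 2 * c t * v t)) (Icc p q) t)
    (h0 : v p = 0) (h1 : v1 p = 0) :
    ∀ t ∈ Icc p q, v t = 0 ∧ v1 t = 0 := by
  intro t ht
  have hpq : p ≤ q := ht.1.trans ht.2
  set K := 1 + lam ^ 2 * M with hK
  set E : ℝ → ℝ := fun t => (v t ^ 2 + v1 t ^ 2) * Real.exp (-K * t) with hE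
  have hder : ∀ s ∈ Icc p q, HasDerivWithinAt E
      ((2 * v s * v1 s + 2 * v1 s * (-(lam ^ 2 * c s * v s))) * Real.exp (-K * s)
        + (v s ^ 2 + v1 s ^ 2) * (Real.exp (-K * s) * (-K))) (Icc p q) s := by
    intro s hs
    have e1 := ((hv s hs).pow 2).add ((hv1 s hs).pow 2)
    have e2 : HasDerivWithinAt (fun t => Real.exp (-K * t)) (Real.exp (-K * s) * (-K)) (Icc p q) s := by
      have := ((hasDerivAt_id s).const_mul (-K)).exp.hasDerivWithinAt (s := Icc p q)
      simpa using this
    refine (e1.mul e2).congr_deriv ?_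
    simp
  have hanti : AntitoneOn E (Icc p q) := by
    refine antitoneOn_of_hasDerivWithinAt_nonpos (convex_Icc p q)
      (fun s hs => (hder s hs).continuousWithinAt)
      (fun s hs => (hder s (interior_subset hs)).mono interior_subset) ?_
    intro s hs
    have hs' := interior_subset hs
    have hcs := abs_le.1 (hc s hs')
    have hM : 0 ≤ M := (abs_nonneg _).trans (hc s hs')
    have : 2 * v s * v1 s + 2 * v1 s * (-(lam ^ 2 * c s * v s)) ≤ K * (v s ^ 2 + v1 s ^ 2) := by
      have hm : |1 - lam ^ 2 * c s| ≤ K := by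
        rw [abs_le]; constructor <;> nlinarith [sq_nonneg lam, mul_nonneg (sq_nonneg lam) hM]
      have h2 : |2 * v s * v1 s| ≤ v s ^ 2 + v1 s ^ 2 := by
        rw [abs_le]; constructor <;> nlinarith [sq_nonneg (v s + v1 s), sq_nonneg (v s - v1 s)]
      calc _ = (1 - lam ^ 2 * c s) * (2 * v s * v1 s) := by ring
        _ ≤ |(1 - lam ^ 2 * c s) * (2 * v s * v1 s)| := le_abs_self _
        _ = |1 - lam ^ 2 * c s| * |2 * v s * v1 s| := abs_mul _ _
        _ ≤ _ := mul_le_mul hm h2 (abs_nonneg _) ((abs_nonneg _).trans hm)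
    have he := Real.exp_pos (-K * s)
    nlinarith
  have h := hanti (left_mem_Icc.2 hpq) ht ht.1
  have hEp : E p = 0 := by simp [hE, h0, h1]
  rw [hEp] at h
  have h' : v t ^ 2 + v1 t ^ 2 ≤ 0 := by
    by_contra hcon
    push Not at hcon
    exact absurd h (not_le.2 (mul_pos hcon (Real.exp_pos _)))
  constructor <;> nlinarith [sq_nonneg (v t), sq_nonneg (v1 t)]

lemma cell (p q lam γ ε A : ℝ) (hlam : 0 < lam) (hγ : 0 < γ) (hpq : p ≤ q)
    (n m : ℕ) (hp : γ * lam * p = n * (2 * Real.pi)) (hq : γ * lam * q = m * (2 * Real.pi))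
    (c v v1 : ℝ → ℝ)
    (hc : ∀ t ∈ Icc p q, c t = γ ^ 2 - phiF ε γ lam t)
    (hv : ∀ t ∈ Icc p q, HasDerivWithinAt v (v1 t) (Icc p q) t)
    (hv1 : ∀ t ∈ Icc p q, HasDerivWithinAt v1 (-(lam ^ 2 * c t * v t)) (Icc p q) t)
    (h0 : v p = 0) (h1 : v1 p = A) :
    v q = 0 ∧ v1 q = A * Real.exp (ε / (16 * γ ^ 2) * (q - p)) := by
  set κ := γ * lam with hκ
  have hκ0 : 0 < κ := mul_pos hγ hlam
  set α := ε / (8 * γ ^ 2) with hα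
  have sp : Real.sin (κ * p) = 0 := by rw [hp]; simpa using Real.sin_add_nat_mul_two_pi 0 n
  have cp : Real.cos (κ * p) = 1 := by rw [hp]; exact Real.cos_nat_mul_two_pi n
  have sq : Real.sin (κ * q) = 0 := by rw [hq]; simpa using Real.sin_add_nat_mul_two_pi 0 m
  have cq : Real.cos (κ * q) = 1 := by rw [hq]; exact Real.cos_nat_mul_two_pi m
  set g : ℝ → ℝ := fun t => Real.exp (α / 2 * (t - p) - α / (2 * κ) * (Real.sin (κ * t) * Real.cos (κ * t))) with hg
  set w : ℝ → ℝ := fun t => A / κ * (Real.sin (κ * t) * g t) with hw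
  set w1 : ℝ → ℝ := fun t => A / κ * ((κ * Real.cos (κ * t) + α * Real.sin (κ * t) ^ 3) * g t) with hw1
  have dl : ∀ t, HasDerivAt (fun t : ℝ => κ * t) κ t := fun t => by
    simpa using (hasDerivAt_id t).const_mul κ
  have ds : ∀ t, HasDerivAt (fun t => Real.sin (κ * t)) (Real.cos (κ * t) * κ) t := fun t => (dl t).sin
  have dc : ∀ t, HasDerivAt (fun t => Real.cos (κ * t)) (-Real.sin (κ * t) * κ) t := fun t => (dl t).cos
  have dg : ∀ t, HasDerivAt g (g t * (α * Real.sin (κ * t) ^ 2)) t := by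
    intro t
    have e := ((((hasDerivAt_id t).sub_const p).const_mul (α / 2)).sub
      (((ds t).mul (dc t)).const_mul (α / (2 * κ)))).exp
    refine e.congr_deriv ?_
    simp only [hg]
    congr 1
    have := Real.sin_sq_add_cos_sq (κ * t)
    have h2 : Real.cos (κ * t) ^ 2 = 1 - Real.sin (κ * t) ^ 2 := by linarith
    field_simp
    rw [h2]; ring
  have dw : ∀ t, HasDerivAt w (w1 t) t := by
    intro t
    refine (((ds t).mul (dg t)).const_mul (A / κ)).congr_deriv ?_
    simp only [hw1]; ring
  have dw1 : ∀ t, HasDerivAt w1 (-(lam ^ 2 * (γ ^ 2 - phiF ε γ lam t) * w t)) t := by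
    intro t
    refine (((((dc t).const_mul κ).add (((ds t).pow 3).const_mul α)).mul (dg t)).const_mul (A / κ)).congr_deriv ?_
    have e2 : Real.sin (2 * γ * lam * t) = 2 * Real.sin (κ * t) * Real.cos (κ * t) := by
      rw [← Real.sin_two_mul]; congr 1; simp only [hκ]; ring
    simp only [hw, phiF, e2]
    have e3 : Real.sin (γ * lam * t) = Real.sin (κ * t) := rfl
    rw [e3]
    have l1 : lam ^ 2 * (γ ^ 2 - (ε / (4 * γ * lam) * (2 * Real.sin (κ * t) * Real.cos (κ * t)) +
        ε ^ 2 / (64 * γ ^ 4 * lam ^ 2) * Real.sin (κ * t) ^ 4)) =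
        κ ^ 2 - 4 * α * κ * Real.sin (κ * t) * Real.cos (κ * t) - α ^ 2 * Real.sin (κ * t) ^ 4 := by
      simp only [hα, hκ]; field_simp; ring
    rw [l1]
    simp; ring
  have hz := ode_zero p q lam (γ ^ 2 + (|ε / (4 * γ * lam)| + |ε ^ 2 / (64 * γ ^ 4 * lam ^ 2)|)) c
    (fun t => v t - w t) (fun t => v1 t - w1 t) ?_ ?_ ?_ ?_ ?_ q (right_mem_Icc.2 hpq)
  · have hwq : w q = 0 := by simp [hw, sq]
    have hw1q : w1 q = A * Real.exp (ε / (16 * γ ^ 2) * (q - p)) := by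
      have hx : α / 2 * (q - p) - α / (2 * κ) * (0 * 1) = ε / (16 * γ ^ 2) * (q - p) := by
        rw [hα]; field_simp; ring
      simp only [hw1, hg, sq, cq]
      rw [hx]
      field_simp
      ring
    constructor
    · linarith [hz.1]
    · linarith [hz.2]
  · intro t ht
    rw [hc t ht, phiF]
    refine (abs_sub _ _).trans ?_
    rw [abs_of_nonneg (sq_nonneg γ)]
    gcongr
    refine (abs_add_le _ _).trans ?_
    rw [abs_mul, abs_mul]
    gcongr
    · exact mul_le_of_le_one_right (abs_nonneg _) (Real.abs_sin_le_one _)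
    · refine mul_le_of_le_one_right (abs_nonneg _) ?_
      rw [abs_pow]
      exact pow_le_one₀ (abs_nonneg _) (Real.abs_sin_le_one _)
  · intro t ht
    exact (hv t ht).sub (dw t).hasDerivWithinAt
  · intro t ht
    refine ((hv1 t ht).sub (dw1 t).hasDerivWithinAt).congr_deriv ?_
    rw [hc t ht]; ring
  · simp [hw, sp, h0]
  · simp only [hw1, hg, sp, cp, h1]
    field_simp
    simp

lemma ac_of_deriv (p q C : ℝ) (hpq : p ≤ q) (f f' : ℝ → ℝ)
    (hf : ∀ t ∈ Icc p q, HasDerivWithinAt f (f' t) (Icc p q) t)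
    (hC : ∀ t ∈ Icc p q, |f' t| ≤ C) : AbsolutelyContinuousOnInterval f p q := by
  have hC0 : 0 ≤ C := (abs_nonneg _).trans (hC p (left_mem_Icc.2 hpq))
  have h : LipschitzOnWith ⟨C, hC0⟩ f (uIcc p q) := by
    rw [uIcc_of_le hpq]
    exact (convex_Icc p q).lipschitzOnWith_of_nnnorm_hasDerivWithin_le hf (fun t ht => hC t ht)
  exact h.absolutelyContinuousOnInterval

lemma energy_decay (p q μ lam : ℝ) (hpq : p ≤ q) (hμ : 0 < μ) (c θ v v1 : ℝ → ℝ)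
    (hcAC : AbsolutelyContinuousOnInterval c p q)
    (hθ : Continuous θ)
    (hcμ : ∀ t ∈ Icc p q, μ ≤ c t)
    (hv : ∀ t ∈ Icc p q, HasDerivWithinAt v (v1 t) (Icc p q) t)
    (hv1 : ∀ t ∈ Icc p q, HasDerivWithinAt v1 (-(lam ^ 2 * c t * v t)) (Icc p q) t)
    (had : ∀ᵐ t, t ∈ Ioo p q → |deriv c t| ≤ θ t) :
    (v1 p ^ 2 + lam ^ 2 * c p * v p ^ 2) * Real.exp (-(1 / μ) * ∫ τ in p..q, θ τ)
      ≤ v1 q ^ 2 + lam ^ 2 * c q * v q ^ 2 := by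
  have hcC : ContinuousOn c (Icc p q) := by
    have := hcAC.continuousOn
    rwa [uIcc_of_le hpq] at this
  have hvC : ContinuousOn v (Icc p q) := fun t ht => (hv t ht).continuousWithinAt
  have hv1C : ContinuousOn v1 (Icc p q) := fun t ht => (hv1 t ht).continuousWithinAt
  obtain ⟨C1, hC1⟩ := isCompact_Icc.exists_bound_of_continuousOn hv1C
  obtain ⟨C2, hC2⟩ := isCompact_Icc.exists_bound_of_continuousOn
    (((continuousOn_const (c := lam ^ 2)).mul hcC).mul hvC).neg
  have hvAC := ac_of_deriv p q C1 hpq v v1 hv hC1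
  have hv1AC := ac_of_deriv p q C2 hpq v1 _ hv1 hC2
  set g : ℝ → ℝ := fun t => Real.exp (1 / μ * ∫ τ in p..t, θ τ) with hg
  have dg : ∀ t, HasDerivAt g (g t * (1 / μ * θ t)) t := fun t =>
    ((intervalIntegral.integral_hasDerivAt_right (hθ.intervalIntegrable _ _)
      hθ.stronglyMeasurable.stronglyMeasurableAtFilter hθ.continuousAt).const_mul (1 / μ)).exp
  have hgC : Continuous g := continuous_iff_continuousAt.2 fun t => (dg t).continuousAt
  obtain ⟨C3, hC3⟩ := (isCompact_Icc (a := p) (b := q)).exists_bound_of_continuousOn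
    (hgC.mul (continuous_const.mul hθ) : Continuous fun t => g t * (1 / μ * θ t)).continuousOn
  have hgAC := ac_of_deriv p q C3 hpq g _ (fun t _ => (dg t).hasDerivWithinAt) hC3
  have hWAC : AbsolutelyContinuousOnInterval
      (fun t => (v1 t * v1 t + lam ^ 2 * (c t * (v t * v t))) * g t) p q :=
    ((hv1AC.fun_mul hv1AC).fun_add ((hcAC.fun_mul (hvAC.fun_mul hvAC)).const_mul (lam ^ 2))).fun_mul hgAC
  have hint := hWAC.integral_deriv_eq_sub
  have hpos : 0 ≤ ∫ x in p..q,
      deriv (fun t => (v1 t * v1 t + lam ^ 2 * (c t * (v t * v t))) * g t) x := by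
    refine intervalIntegral.integral_nonneg_of_ae_restrict hpq ?_
    have hq : ∀ᵐ t : ℝ, t ≠ q := by simp [ae_iff]
    have hp : ∀ᵐ t : ℝ, t ≠ p := by simp [ae_iff]
    refine (ae_restrict_iff' measurableSet_Icc).2 ?_
    filter_upwards [had, hcAC.ae_differentiableAt, hq, hp] with t h1 h2 h3 h4 ht
    have ht' : t ∈ Ioo p q := ⟨lt_of_le_of_ne ht.1 (Ne.symm h4), lt_of_le_of_ne ht.2 h3⟩
    have hn : Icc p q ∈ nhds t := Icc_mem_nhds ht'.1 ht'.2
    have dc := (h2 (by rwa [uIcc_of_le hpq])).hasDerivAt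
    have dv := (hv t ht).hasDerivAt hn
    have dv1 := (hv1 t ht).hasDerivAt hn
    have hD := (((dv1.mul dv1).add ((dc.mul (dv.mul dv)).const_mul (lam ^ 2))).mul (dg t)).deriv
    have hD' : deriv (fun t => (v1 t * v1 t + lam ^ 2 * (c t * (v t * v t))) * g t) t = _ := hD
    simp only [Pi.zero_apply, hD']
    have hb := abs_le.1 (h1 ht')
    have hgp : 0 < g t := Real.exp_pos _
    have hcm := hcμ t ht
    have hθ0 : 0 ≤ θ t := (abs_nonneg _).trans (h1 ht')
    have key : 0 ≤ lam ^ 2 * v t ^ 2 * deriv c t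
        + (v1 t ^ 2 + lam ^ 2 * c t * v t ^ 2) * (1 / μ * θ t) := by
      have k1 : θ t ≤ c t * (1 / μ * θ t) := by
        rw [← mul_assoc]
        refine le_mul_of_one_le_left hθ0 ?_
        rw [mul_one_div, le_div_iff₀ hμ]; linarith
      have k2 : 0 ≤ 1 / μ * θ t := by positivity
      have k3 : 0 ≤ lam ^ 2 * v t ^ 2 := by positivity
      nlinarith [mul_nonneg (sq_nonneg (v1 t)) k2,
        mul_nonneg k3 (by linarith : 0 ≤ deriv c t + c t * (1 / μ * θ t))]
    refine (mul_nonneg hgp.le key).trans_eq ?_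
    simp only [Pi.add_apply, Pi.mul_apply]
    ring
  rw [hint] at hpos
  have gp : g p = 1 := by simp [hg]
  have gq : Real.exp (-(1 / μ) * ∫ τ in p..q, θ τ) * g q = 1 := by
    rw [hg, ← Real.exp_add]; simp
  rw [gp] at hpos
  have hE := Real.exp_pos (-(1 / μ) * ∫ τ in p..q, θ τ)
  set e := Real.exp (-(1 / μ) * ∫ τ in p..q, θ τ)
  have h5 := mul_nonneg hE.le hpos
  have h6 : e * ((v1 q * v1 q + lam ^ 2 * (c q * (v q * v q))) * g q)
      = v1 q * v1 q + lam ^ 2 * (c q * (v q * v q)) := by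
    linear_combination (v1 q * v1 q + lam ^ 2 * (c q * (v q * v q))) * gq
  nlinarith

set_option maxHeartbeats 2000000 in
/-- `θ`-construction, Proposition `prop:theta`, statement (2). -/
theorem theta_construction_energy_growth
    (T0 μ1 μ2 T1 γ η : ℝ) (ω θ : ℝ → ℝ)
    (hT0 : 0 < T0) (hμ1 : 0 < μ1) (hμ12 : μ1 < μ2)
    (hω : IsModulusOfContinuity ω)
    (hθcont : ContinuousOn θ (Ioo 0 T0))
    (hθpos : ∀ t ∈ Ioo 0 T0, 0 < θ t)
    (hθmono : AntitoneOn θ (Ioo 0 T0))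
    (hT1 : T1 ∈ Ioo 0 T0) (hγ : 0 < γ) (hγ2 : γ ^ 2 ∈ Ioo μ1 μ2) (hη : η ∈ Ioo 0 1)
    (cstar : ℝ → ℝ) (hcstar : MemD T0 μ1 μ2 ω θ T1 γ η cstar)
    (lam : ℝ) (hlam : 0 < lam)
    (hlam1 : nu2 μ1 * ω (1 / lam) ≤ 8 * γ ^ 3)
    (hlam2 : nu2 μ1 / (2 * γ) * ω (1 / lam) ≤ min (γ ^ 2 - μ1) (μ2 - γ ^ 2))
    (a b : ℝ) (ha : 0 < a) (hab : a < b) (hb : b < T1)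
    (k : ℕ) (hk : (k : ℝ) = γ * lam * (b - a) / (2 * Real.pi))
    (haN : ∃ n : ℕ, a * γ * lam / (2 * Real.pi) = n)
    (hbN : ∃ n : ℕ, b * γ * lam / (2 * Real.pi) = n)
    (hωb : ω b ≤ η * ω (T1 - b))
    (hθa : θ a ≤ lam * ω (1 / lam))
    (cl : ℝ → ℝ)
    (hclOut : ∀ t ∈ Icc 0 a ∪ Icc b T0, cl t = cstar t)
    (hclIn : ∀ i : ℕ, 1 ≤ i → i ≤ k →
      ∀ t ∈ Icc (tNode a γ lam (i - 1)) (tNode a γ lam i),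
        cl t = γ ^ 2 - phiF (nu2 μ1 * θ (tNode a γ lam i)) γ lam t)
    (u : ℝ → ℝ) (hu : IsSol T0 lam cl u)
    (hu0 : u 0 = 0) (hu1 : der T0 u 0 = 1) :
    ∀ t ∈ Icc b T0,
      min 1 (1 / μ2) *
          Real.exp (-(1 / μ1) * (∫ τ in T1..T0, θ τ) - 2 * Real.pi) *
          Real.exp (nu2 μ1 / (8 * μ2) * ∫ τ in a..b, θ τ) ≤
        (der T0 u t) ^ 2 + lam ^ 2 * (u t) ^ 2 := by
  obtain ⟨⟨hcC, hcL, hcB, _, hcD⟩, hcc, _⟩ := hcstar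
  have hpi := Real.pi_pos
  have hκ : 0 < γ * lam := mul_pos hγ hlam
  have hbT : b < T0 := hb.trans hT1.2
  have hν : 0 < nu2 μ1 := by
    unfold nu2
    have := Real.sqrt_pos.2 hμ1
    have : 0 < min 1 (Real.sqrt μ1 / Real.pi) := lt_min one_pos (by positivity)
    positivity
  set ν := nu2 μ1 with hνdef
  set du := der T0 u with hdu
  have hμ2 : 0 < μ2 := hμ1.trans hμ12
  -- restriction of the equation to subintervals
  have hU : ∀ p q : ℝ, 0 ≤ p → q ≤ T0 → ∀ t ∈ Icc p q, HasDerivWithinAt u (du t) (Icc p q) t := by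
    intro p q hp hq t ht
    exact (hu t ⟨hp.trans ht.1, ht.2.trans hq⟩).1.mono (Icc_subset_Icc hp hq)
  have hU1 : ∀ p q : ℝ, 0 ≤ p → q ≤ T0 → ∀ t ∈ Icc p q,
      HasDerivWithinAt du (-(lam ^ 2 * cl t * u t)) (Icc p q) t := by
    intro p q hp hq t ht
    exact (hu t ⟨hp.trans ht.1, ht.2.trans hq⟩).2.mono (Icc_subset_Icc hp hq)
  set D := 2 * Real.pi / (γ * lam) with hD
  have hD0 : 0 < D := by positivity
  have hκD : γ * lam * D = 2 * Real.pi := by rw [hD]; field_simp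
  obtain ⟨n, hn⟩ := haN
  have hna : γ * lam * a = n * (2 * Real.pi) := by
    rw [div_eq_iff (by positivity)] at hn
    linarith
  have htn : ∀ j : ℕ, tNode a γ lam j = a + D * j := fun j => rfl
  have htk : tNode a γ lam k = b := by
    have : γ * lam * (D * k) = γ * lam * (b - a) := by
      rw [← mul_assoc, hκD, hk]; field_simp
    have := mul_left_cancel₀ hκ.ne' this
    rw [htn, this]; ring
  have htle : ∀ j : ℕ, j ≤ k → tNode a γ lam j ≤ b := by
    intro j hj
    rw [← htk, htn, htn]
    have : (j : ℝ) ≤ k := by exact_mod_cast hj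
    nlinarith
  have hage : ∀ j : ℕ, a ≤ tNode a γ lam j := by
    intro j
    rw [htn]
    have : (0 : ℝ) ≤ j := Nat.cast_nonneg j
    nlinarith
  have hθint : ∀ p q : ℝ, 0 < p → p ≤ q → q < T0 → IntervalIntegrable θ volume p q := by
    intro p q hp hpq hq
    refine ContinuousOn.intervalIntegrable (hθcont.mono ?_)
    rw [uIcc_of_le hpq]
    exact fun x hx => ⟨hp.trans_le hx.1, hx.2.trans_lt hq⟩
  -- the first interval
  have hstart := cell 0 a lam γ 0 1 hlam hγ ha.le 0 n (by simp) hna cl u du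
    (by
      intro t ht
      rw [hclOut t (Or.inl ht), hcc t ⟨ht.1, ht.2.trans (hab.trans hb).le⟩]
      simp [phiF])
    (hU 0 a le_rfl (hab.trans hbT).le) (hU1 0 a le_rfl (hab.trans hbT).le) hu0 hu1
  -- growth along the nodes
  have hind : ∀ j : ℕ, j ≤ k → u (tNode a γ lam j) = 0 ∧
      ∃ S : ℝ, du (tNode a γ lam j) = Real.exp (ν / (16 * γ ^ 2) * S) ∧
        (∫ τ in a..tNode a γ lam j, θ τ) - D * (θ a - θ (tNode a γ lam j)) ≤ S := by
    intro j
    induction j with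
    | zero =>
      intro _
      have h0 : tNode a γ lam 0 = a := by simp [htn]
      rw [h0]
      refine ⟨hstart.1, 0, ?_, by simp⟩
      rw [hstart.2]; simp
    | succ j ih =>
      intro hj
      obtain ⟨ih0, S, ih1, ih2⟩ := ih (by omega)
      set p := tNode a γ lam j with hp
      set q := tNode a γ lam (j + 1) with hq
      have hqp : q = p + D := by rw [hq, hp, htn, htn]; push_cast; ring
      have hpa : a ≤ p := hage j
      have hp0 : 0 < p := ha.trans_le hpa
      have hqb : q ≤ b := htle (j + 1) hj
      have hqT : q < T0 := hqb.trans_lt hbT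
      have hpq : p ≤ q := by linarith
      have hcell := cell p q lam γ (ν * θ q) (Real.exp (ν / (16 * γ ^ 2) * S)) hlam hγ hpq
        (n + j) (n + j + 1)
        (by rw [hp, htn]; push_cast; linear_combination hna + (j : ℝ) * hκD)
        (by rw [hq, htn]; push_cast; linear_combination hna + (j + 1 : ℝ) * hκD)
        cl u du
        (fun t ht => hclIn (j + 1) (by omega) hj t (by simpa using ht))
        (hU p q hp0.le hqT.le) (hU1 p q hp0.le hqT.le) ih0 ih1
      refine ⟨hcell.1, S + θ q * D, ?_, ?_⟩
      · rw [hcell.2, ← Real.exp_add]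
        congr 1
        rw [hqp]; ring
      · have hadd := intervalIntegral.integral_add_adjacent_intervals
          (hθint a p ha hpa (hpq.trans_lt hqT)) (hθint p q hp0 hpq hqT)
        have hle : ∫ τ in p..q, θ τ ≤ θ p * D := by
          have := intervalIntegral.integral_mono_on hpq (hθint p q hp0 hpq hqT)
            (intervalIntegrable_const (c := θ p))
            (fun x hx => hθmono ⟨hp0, hpq.trans_lt hqT⟩
              ⟨hp0.trans_le hx.1, hx.2.trans_lt hqT⟩ hx.1)
          refine this.trans_eq ?_
          simp [hqp]; ring
        rw [← hadd]
        linarith [mul_sub D (θ a) (θ p), mul_sub D (θ a) (θ q), mul_comm D (θ p), mul_comm D (θ q)]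
  obtain ⟨hub, S, hdub, hS⟩ := hind k le_rfl
  rw [htk] at hub hdub hS
  set I := ∫ τ in a..b, θ τ with hI
  have hI0 : 0 ≤ I := intervalIntegral.integral_nonneg hab.le
    (fun x hx => (hθpos x ⟨ha.trans_le hx.1, hx.2.trans_lt hbT⟩).le)
  have hFb : Real.exp (-(2 * Real.pi)) * Real.exp (ν / (8 * μ2) * I) ≤ du b ^ 2 := by
    rw [hdub, ← Real.exp_add, ← Real.exp_nat_mul]
    refine Real.exp_le_exp.2 ?_
    have hθb := hθpos b ⟨ha.trans hab, hbT⟩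
    have hS2 : I - D * θ a ≤ S := by linarith [mul_pos hD0 hθb, mul_sub D (θ a) (θ b)]
    have e1 : ν / (8 * γ ^ 2) * (D * θ a) ≤ 2 * Real.pi := by
      have : ν / (8 * γ ^ 2) * (D * θ a) ≤ ν / (8 * γ ^ 2) * (D * (lam * ω (1 / lam))) := by
        gcongr
      refine this.trans ?_
      have h3 : ν / (8 * γ ^ 2) * (D * (lam * ω (1 / lam)))
          = 2 * Real.pi * ((ν * ω (1 / lam)) / (8 * γ ^ 3)) := by
        rw [hD]; field_simp
      rw [h3]
      refine mul_le_of_le_one_right (by positivity) ?_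
      rw [div_le_one (by positivity)]
      exact hlam1
    have e2 : ν / (8 * μ2) * I ≤ ν / (8 * γ ^ 2) * I := by
      have := hγ2.2.le
      gcongr
    have e3 : ν / (8 * γ ^ 2) * (I - D * θ a) ≤ ν / (8 * γ ^ 2) * S := by gcongr
    have e4 : ((2 : ℕ) : ℝ) * (ν / (16 * γ ^ 2) * S) = ν / (8 * γ ^ 2) * S := by
      push_cast; field_simp; ring
    rw [e4]
    linarith
  set G := Real.exp (-(2 * Real.pi)) * Real.exp (ν / (8 * μ2) * I) with hG
  have hG0 : 0 < G := by positivity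
  -- integrability and positivity of θ on [T1, T0]
  have hT10 := hT1.1
  have hT1T := hT1.2
  have hclR : ∀ t ∈ Icc b T0, cl t = cstar t := fun t ht => hclOut t (Or.inr ht)
  have hb0 : 0 < b := ha.trans hab
  have hθintT : IntervalIntegrable θ volume T1 T0 := by
    rw [intervalIntegrable_iff_integrableOn_Ioo_of_le hT1T.le]
    have hfin : IntegrableOn (fun _ : ℝ => θ T1) (Ioo T1 T0) := integrableOn_const (by simp)
    refine Integrable.mono' hfin ?_ ?_
    · exact (hθcont.mono (Ioo_subset_Ioo_left hT10.le)).aestronglyMeasurable measurableSet_Ioo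
    · refine (ae_restrict_iff' measurableSet_Ioo).2 (Eventually.of_forall fun x hx => ?_)
      have hx0 : x ∈ Ioo 0 T0 := ⟨hT10.trans hx.1, hx.2⟩
      rw [Real.norm_of_nonneg (hθpos x hx0).le]
      exact hθmono hT1 hx0 hx.1.le
  have hJmono : ∀ s ∈ Ico T1 T0, ∫ τ in T1..s, θ τ ≤ ∫ τ in T1..T0, θ τ := by
    intro s hs
    refine intervalIntegral.integral_mono_interval le_rfl hs.1 hs.2.le ?_ hθintT
    have hq : ∀ᵐ t : ℝ, t ≠ T0 := by simp [ae_iff]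
    refine (ae_restrict_iff' measurableSet_Ioc).2 ?_
    filter_upwards [hq] with x hx1 hx
    exact (hθpos x ⟨hT10.trans hx.1, lt_of_le_of_ne hx.2 hx1⟩).le
  set J := ∫ τ in T1..T0, θ τ with hJ
  have hJ0 : 0 ≤ J := by
    have := hJmono T1 ⟨le_rfl, hT1T⟩
    simpa using this
  have hAC : ∀ p q : ℝ, 0 < p → p ≤ q → q < T0 → AbsolutelyContinuousOnInterval cstar p q := by
    intro p q hp hpq hq
    have hsub : Icc p q ⊆ Ioo 0 T0 := fun x hx => ⟨hp.trans_le hx.1, hx.2.trans_lt hq⟩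
    obtain ⟨K, hK⟩ := (hcL.mono hsub).exists_lipschitzOnWith_of_compact isCompact_Icc
    rw [← uIcc_of_le hpq] at hK
    exact hK.absolutelyContinuousOnInterval
  have hstar1 : ∀ p q : ℝ, b ≤ p → q ≤ T0 → ∀ t ∈ Icc p q,
      HasDerivWithinAt du (-(lam ^ 2 * cstar t * u t)) (Icc p q) t := by
    intro p q hp hq t ht
    rw [← hclR t ⟨hp.trans ht.1, ht.2.trans hq⟩]
    exact hU1 p q (hb0.le.trans hp) hq t ht
  -- the energy on [b, T1]
  have hF1 : ∀ s ∈ Icc b T1, G ≤ du s ^ 2 + lam ^ 2 * cstar s * u s ^ 2 := by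
    intro s hs
    have hsT : s < T0 := hs.2.trans_lt hT1T
    have h := energy_decay b s μ1 lam hs.1 hμ1 cstar (fun _ => 0) u du
      (hAC b s hb0 hs.1 hsT) continuous_const
      (fun t ht => (hcB t ⟨hb0.trans_le ht.1, ht.2.trans_lt hsT⟩).1)
      (hU b s hb0.le hsT.le) (hstar1 b s le_rfl hsT.le)
      (Eventually.of_forall fun t ht => by
        have : cstar =ᶠ[nhds t] fun _ => γ ^ 2 := by
          filter_upwards [Ioo_mem_nhds ht.1 ht.2] with x hx
          exact hcc x ⟨(hb0.trans hx.1).le, hx.2.le.trans hs.2⟩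
        rw [this.deriv_eq]; simp)
    simp only [hub, intervalIntegral.integral_zero, mul_zero, Real.exp_zero, mul_one] at h
    have : (0 : ℝ) ^ 2 = 0 := by norm_num
    rw [this, mul_zero, add_zero] at h
    exact hFb.trans h
  have hF : ∀ s ∈ Ico b T0, G * Real.exp (-(1 / μ1) * J) ≤ du s ^ 2 + lam ^ 2 * cstar s * u s ^ 2 := by
    intro s hs
    rcases le_total s T1 with hsT1 | hsT1
    · refine le_trans ?_ (hF1 s ⟨hs.1, hsT1⟩)
      refine mul_le_of_le_one_right hG0.le ?_
      rw [Real.exp_le_one_iff]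
      have : 0 ≤ 1 / μ1 * J := by positivity
      linarith
    · set θt : ℝ → ℝ := IccExtend hsT1 ((Icc T1 s).domRestrict θ) with hθt
      have hsub : Icc T1 s ⊆ Ioo 0 T0 := fun x hx => ⟨hT10.trans_le hx.1, hx.2.trans_lt hs.2⟩
      have hθtC : Continuous θt :=
        (continuousOn_iff_continuous_domRestrict.1 (hθcont.mono hsub)).Icc_extend'
      have hθte : ∀ t ∈ Icc T1 s, θt t = θ t := fun t ht => by
        rw [hθt, IccExtend_of_mem hsT1 _ ht]; rfl
      have h := energy_decay T1 s μ1 lam hsT1 hμ1 cstar θt u du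
        (hAC T1 s hT10 hsT1 hs.2) hθtC
        (fun t ht => (hcB t (hsub ht)).1)
        (hU T1 s hT10.le hs.2.le) (hstar1 T1 s hb.le hs.2.le)
        (by
          have h1 := (ae_restrict_iff' measurableSet_Ioo).1 hcD
          filter_upwards [h1] with t ht ht2
          have ht3 := Ioo_subset_Icc_self ht2
          rw [hθte t ht3]
          exact ht (hsub ht3))
      have hi : ∫ τ in T1..s, θt τ = ∫ τ in T1..s, θ τ := by
        refine intervalIntegral.integral_congr fun t ht => ?_
        rw [uIcc_of_le hsT1] at ht
        exact hθte t ht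
      rw [hi] at h
      refine le_trans ?_ h
      have hm := hJmono s ⟨hsT1, hs.2⟩
      have hg := hF1 T1 ⟨hb.le, le_rfl⟩
      refine mul_le_mul hg (Real.exp_le_exp.2 ?_) (Real.exp_pos _).le (hG0.le.trans hg)
      have : 1 / μ1 * ∫ τ in T1..s, θ τ ≤ 1 / μ1 * J := by gcongr
      linarith
  have hlhs : min 1 (1 / μ2) * Real.exp (-(1 / μ1) * J - 2 * Real.pi) *
      Real.exp (ν / (8 * μ2) * I) = min 1 (1 / μ2) * (G * Real.exp (-(1 / μ1) * J)) := by
    rw [hG, sub_eq_add_neg, Real.exp_add]; ring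
  rw [hlhs]
  have hIco : ∀ t ∈ Ico b T0,
      min 1 (1 / μ2) * (G * Real.exp (-(1 / μ1) * J)) ≤ du t ^ 2 + lam ^ 2 * u t ^ 2 := by
    intro t ht
    have h := hF t ht
    have hct := hcB t ⟨hb0.trans_le ht.1, ht.2⟩
    have hm0 : 0 < min 1 (1 / μ2) := lt_min one_pos (by positivity)
    refine (mul_le_mul_of_nonneg_left h hm0.le).trans ?_
    have m1 : min 1 (1 / μ2) * du t ^ 2 ≤ du t ^ 2 :=
      mul_le_of_le_one_left (sq_nonneg _) (min_le_left _ _)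
    have m2 : min 1 (1 / μ2) * cstar t ≤ 1 := by
      calc min 1 (1 / μ2) * cstar t ≤ 1 / μ2 * μ2 :=
            mul_le_mul (min_le_right _ _) hct.2 (hμ1.le.trans hct.1) (by positivity)
        _ = 1 := by field_simp
    have m3 : 0 ≤ lam ^ 2 * u t ^ 2 := by positivity
    nlinarith [mul_le_mul_of_nonneg_right m2 m3]
  intro t ht
  have hcont : ContinuousOn (fun t => du t ^ 2 + lam ^ 2 * u t ^ 2) (Icc b T0) := by
    have c1 : ContinuousOn u (Icc b T0) := fun s hs => (hU b T0 hb0.le le_rfl s hs).continuousWithinAt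
    have c2 : ContinuousOn du (Icc b T0) := fun s hs => (hU1 b T0 hb0.le le_rfl s hs).continuousWithinAt
    exact (c2.pow 2).add (continuousOn_const.mul (c1.pow 2))
  have hcl : Icc b T0 = closure (Ico b T0) := (closure_Ico hbT.ne).symm
  rw [hcl] at ht hcont
  exact ContinuousWithinAt.closure_le ht continuousWithinAt_const
    ((hcont t ht).mono subset_closure) hIco
end

section
/- Let T₀ > 0, 0 < μ₁ < μ₂, ω a modulus of continuity, θ : (0,T₀) → (0,∞) continuous and nonincreasing, and assume m(λ) → +∞ as λ → +∞. Then for every coefficient c* ∈ D(T₀,μ₁,μ₂,ω,θ;T₁,γ,η) (for any admissible T₁, γ, η) there exists a family {c_λ}_{λ>0} ⊆ PS(T₀,μ₁,μ₂,ω,θ) of asymptotic activators with rate φ(λ) := M₃·m(λ) such that c_λ → c* uniformly on [0,T₀] as λ → +∞. -/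
open Set Filter MeasureTheory

/-- Constant `M₃ = (1/(128 μ₂)) · min{1, √μ₁/π}`. -/
noncomputable def M3 (μ1 μ2 : ℝ) : ℝ := 1 / (128 * μ2) * min 1 (Real.sqrt μ1 / Real.pi)

lemma floor_eq_of_Ico {h t : ℝ} (hh : 0 < h) (k : ℤ) (h1 : k * h ≤ t) (h2 : t < (k + 1) * h) :
    ⌊t / h⌋ = k := by
  rw [Int.floor_eq_iff]
  exact ⟨by rwa [le_div_iff₀ hh], by rwa [div_lt_iff₀ hh]⟩

lemma floor_bounds {h : ℝ} (hh : 0 < h) (t : ℝ) :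
    (⌊t / h⌋ : ℝ) * h ≤ t ∧ t < ((⌊t / h⌋ : ℝ) + 1) * h :=
  ⟨by rw [← le_div_iff₀ hh]; exact Int.floor_le _, by
    rw [← div_lt_iff₀ hh]; exact Int.lt_floor_add_one _⟩

/-- Gluing functions vanishing at the lattice points keeps a Lipschitz bound. -/
lemma glue_lip {h L : ℝ} (hh : 0 < h) (f : ℤ → ℝ → ℝ)
    (hL : ∀ k s t, |f k s - f k t| ≤ L * |s - t|)
    (hz : ∀ k (j : ℤ), f k (j * h) = 0) (s t : ℝ) :
    |f ⌊s / h⌋ s - f ⌊t / h⌋ t| ≤ L * |s - t| := by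
  have hL0 : 0 ≤ L := by
    have := hL 0 0 1
    have h2 := abs_nonneg (f 0 0 - f 0 1)
    norm_num at this
    linarith
  have key : ∀ s t : ℝ, s ≤ t → |f ⌊s / h⌋ s - f ⌊t / h⌋ t| ≤ L * |s - t| := by
    intro s t hst
    obtain ⟨s1, s2⟩ := floor_bounds hh s
    obtain ⟨t1, t2⟩ := floor_bounds hh t
    have hle : ⌊s / h⌋ ≤ ⌊t / h⌋ := Int.floor_mono (by gcongr)
    rcases hle.eq_or_lt with he | hlt
    · rw [he]; exact hL _ _ _
    · have hlt' : ((⌊s / h⌋ : ℝ) + 1) ≤ ⌊t / h⌋ := by exact_mod_cast hlt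
      have hz1 := hz ⌊s / h⌋ (⌊s / h⌋ + 1)
      have hz2 := hz ⌊t / h⌋ ⌊t / h⌋
      push_cast at hz1
      have a1 := hL ⌊s / h⌋ s (((⌊s / h⌋ : ℝ) + 1) * h)
      have a2 := hL ⌊t / h⌋ t ((⌊t / h⌋ : ℝ) * h)
      rw [hz1, sub_zero, abs_of_nonpos (by linarith : s - ((⌊s / h⌋ : ℝ) + 1) * h ≤ 0)] at a1
      rw [hz2, sub_zero, abs_of_nonneg (by linarith : 0 ≤ t - (⌊t / h⌋ : ℝ) * h)] at a2
      have a3 := abs_sub (f ⌊s / h⌋ s) (f ⌊t / h⌋ t)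
      have a4 : ((⌊s / h⌋ : ℝ) + 1) * h ≤ (⌊t / h⌋ : ℝ) * h := by gcongr
      rw [abs_of_nonpos (by linarith : s - t ≤ 0)]
      have : L * (t - (⌊t / h⌋ : ℝ) * h) + L * (-(s - ((⌊s / h⌋ : ℝ) + 1) * h)) ≤ L * -(s - t) := by
        rw [← mul_add]; gcongr; linarith
      linarith
  rcases le_total s t with hst | hst
  · exact key s t hst
  · rw [abs_sub_comm, abs_sub_comm s]; exact key t s hst

lemma sin_lattice {h ν : ℝ} (hν : ν * h = Real.pi) (j : ℤ) : Real.sin (ν * (j * h)) = 0 := by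
  rw [show ν * (j * h) = j * Real.pi by rw [← hν]; ring]
  exact Real.sin_int_mul_pi j

/-- The integrand `α sin²`. -/
noncomputable def Afun (α : ℤ → ℝ) (h ν t : ℝ) : ℝ := α ⌊t / h⌋ * Real.sin (ν * t) ^ 2

lemma Afun_hasDerivAt {α : ℤ → ℝ} {h ν M : ℝ} (hh : 0 < h) (hν : ν * h = Real.pi)
    (hα : ∀ k, |α k| ≤ M) (t : ℝ) :
    HasDerivAt (Afun α h ν)
      (2 * α ⌊t / h⌋ * ν * Real.sin (ν * t) * Real.cos (ν * t)) t := by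
  obtain ⟨t1, t2⟩ := floor_bounds hh t
  rcases t1.eq_or_lt with he | hlt
  · have hs : Real.sin (ν * t) = 0 := by rw [← he]; exact sin_lattice hν _
    rw [hs]
    have hM : 0 ≤ M := (abs_nonneg _).trans (hα 0)
    have hA0 : Afun α h ν t = 0 := by simp [Afun, hs]
    rw [hasDerivAt_iff_isLittleO]
    have hb : ∀ y, ‖Afun α h ν y - Afun α h ν t - (y - t) • (2 * α ⌊t / h⌋ * ν * 0 * Real.cos (ν * t))‖
        ≤ M * ν ^ 2 * ‖(y - t) ^ 2‖ := by
      intro y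
      rw [hA0]
      simp only [Afun, mul_zero, zero_mul, smul_zero, sub_zero, Real.norm_eq_abs, abs_mul, abs_pow]
      have e : |Real.sin (ν * y)| ≤ |ν * y - ν * t| := by
        have h1 : Real.sin (ν * y) = Real.sin (ν * y - ν * t) * Real.cos (ν * t) := by
          have := Real.sin_add (ν * y - ν * t) (ν * t)
          rw [hs] at this; simpa using this
        rw [h1, abs_mul]
        have h2 := Real.abs_sin_sub_sin_le (ν * y - ν * t) 0
        have h3 := Real.abs_cos_le_one (ν * t)
        simp only [Real.sin_zero, sub_zero] at h2
        nlinarith [abs_nonneg (Real.sin (ν * y - ν * t))]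
      calc |α ⌊y / h⌋| * |Real.sin (ν * y)| ^ 2 ≤ M * |ν * y - ν * t| ^ 2 := by
            gcongr; exact hα _
        _ = M * ν ^ 2 * |y - t| ^ 2 := by
            rw [← mul_sub, abs_mul, mul_pow, sq_abs ν]; ring
    refine (Asymptotics.isBigO_of_le' (c := M * ν ^ 2) (nhds t) hb).trans_isLittleO ?_
    simpa using! Asymptotics.isLittleO_pow_sub_sub t (by norm_num : 1 < 2)
  · have hev : Afun α h ν =ᶠ[nhds t] fun y => α ⌊t / h⌋ * Real.sin (ν * y) ^ 2 := by
      filter_upwards [Ioo_mem_nhds hlt t2] with y hy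
      rw [Afun, floor_eq_of_Ico hh _ hy.1.le hy.2]
    refine HasDerivAt.congr_of_eventuallyEq ?_ hev
    have h1 : HasDerivAt (fun y => ν * y) ν t := by simpa using (hasDerivAt_id t).const_mul ν
    convert! ((h1.sin.pow 2).const_mul (α ⌊t / h⌋)) using 1
    simp; ring

noncomputable def bfun (α : ℤ → ℝ) (h ν t : ℝ) : ℝ := ∫ s in (0:ℝ)..t, Afun α h ν s

noncomputable def wfun (α : ℤ → ℝ) (h ν t : ℝ) : ℝ :=
  Real.exp (bfun α h ν t) * Real.sin (ν * t) / ν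

noncomputable def w1fun (α : ℤ → ℝ) (h ν t : ℝ) : ℝ :=
  Real.exp (bfun α h ν t) * (Real.cos (ν * t) + Afun α h ν t * Real.sin (ν * t) / ν)

section
variable {α : ℤ → ℝ} {h ν M : ℝ}

lemma Afun_continuous (hh : 0 < h) (hν : ν * h = Real.pi) (hα : ∀ k, |α k| ≤ M) :
    Continuous (Afun α h ν) :=
  continuous_iff_continuousAt.2 fun t => (Afun_hasDerivAt hh hν hα t).continuousAt

lemma bfun_hasDerivAt (hh : 0 < h) (hν : ν * h = Real.pi) (hα : ∀ k, |α k| ≤ M) (t : ℝ) :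
    HasDerivAt (bfun α h ν) (Afun α h ν t) t :=
  intervalIntegral.integral_hasDerivAt_right
    ((Afun_continuous hh hν hα).intervalIntegrable _ _)
    ((Afun_continuous hh hν hα).stronglyMeasurableAtFilter _ _)
    (Afun_continuous hh hν hα).continuousAt

lemma bfun_mono (hh : 0 < h) (hν : ν * h = Real.pi) (hα : ∀ k, |α k| ≤ M) (h0 : ∀ k, 0 ≤ α k) :
    Monotone (bfun α h ν) := by
  apply monotone_of_deriv_nonneg (fun t => (bfun_hasDerivAt hh hν hα t).differentiableAt)
  intro t
  rw [(bfun_hasDerivAt hh hν hα t).deriv]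
  exact mul_nonneg (h0 _) (sq_nonneg _)

lemma wfun_hasDerivAt (hh : 0 < h) (hν : ν * h = Real.pi) (hν0 : 0 < ν) (hα : ∀ k, |α k| ≤ M)
    (t : ℝ) : HasDerivAt (wfun α h ν) (w1fun α h ν t) t := by
  have h1 : HasDerivAt (fun y => ν * y) ν t := by simpa using (hasDerivAt_id t).const_mul ν
  convert! (((bfun_hasDerivAt hh hν hα t).exp.mul h1.sin).div_const ν) using 1
  rw [w1fun]; field_simp; ring

lemma w1fun_hasDerivAt (hh : 0 < h) (hν : ν * h = Real.pi) (hν0 : 0 < ν) (hα : ∀ k, |α k| ≤ M)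
    (t : ℝ) : HasDerivAt (w1fun α h ν)
      (-((ν ^ 2 - 4 * ν * α ⌊t / h⌋ * Real.sin (ν * t) * Real.cos (ν * t)
        - (α ⌊t / h⌋) ^ 2 * Real.sin (ν * t) ^ 4) * wfun α h ν t)) t := by
  have h1 : HasDerivAt (fun y => ν * y) ν t := by simpa using (hasDerivAt_id t).const_mul ν
  convert! ((bfun_hasDerivAt hh hν hα t).exp.mul
    (h1.cos.add (((Afun_hasDerivAt hh hν hα t).mul h1.sin).div_const ν))) using 1
  simp only [wfun, Afun, Pi.mul_apply, Pi.add_apply]; field_simp; ring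

lemma bfun_step (hh : 0 < h) (hν : ν * h = Real.pi) (hν0 : 0 < ν) (hα : ∀ k, |α k| ≤ M) (k : ℤ) :
    bfun α h ν ((k + 1) * h) = bfun α h ν (k * h) + α k * h / 2 := by
  have hc := Afun_continuous hh hν hα
  have e1 : bfun α h ν ((k + 1) * h) = bfun α h ν (k * h) + ∫ s in (k * h)..((k + 1) * h), Afun α h ν s := by
    rw [bfun, bfun, intervalIntegral.integral_add_adjacent_intervals] <;>
      exact hc.intervalIntegrable _ _
  have hz2 : Real.sin (ν * ((k + 1) * h)) = 0 := by
    have := sin_lattice hν (k + 1); push_cast at this; exact this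
  have hz1 : Real.sin (ν * (k * h)) = 0 := sin_lattice hν k
  have e2 : ∫ s in (k * h)..((k + 1) * h), Afun α h ν s =
      ∫ s in (k * h)..((k + 1) * h), α k * Real.sin (ν * s) ^ 2 := by
    apply intervalIntegral.integral_congr
    intro s hs
    rw [uIcc_of_le (by nlinarith)] at hs
    rcases hs.2.eq_or_lt with he | hlt
    · simp only [Afun]; rw [he, hz2]; simp
    · simp only [Afun]; rw [floor_eq_of_Ico hh k hs.1 hlt]
  have e3 : ∫ s in (k * h)..((k + 1) * h), α k * Real.sin (ν * s) ^ 2 = α k * h / 2 := by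
    rw [intervalIntegral.integral_eq_sub_of_hasDerivAt
      (f := fun s => α k * (s / 2 - Real.sin (ν * s) * Real.cos (ν * s) / (2 * ν)))]
    · simp only [hz1, hz2]; ring
    · intro t _
      have h1 : HasDerivAt (fun y => ν * y) ν t := by simpa using (hasDerivAt_id t).const_mul ν
      convert! (((hasDerivAt_id t).div_const 2).sub ((h1.sin.mul h1.cos).div_const (2 * ν))).const_mul (α k) using 1
      have := Real.sin_sq_add_cos_sq (ν * t)
      have h2 : Real.cos (ν * t) ^ 2 = 1 - Real.sin (ν * t) ^ 2 := by linarith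
      field_simp
      rw [h2]; ring
    · exact (by fun_prop : Continuous fun s => α k * Real.sin (ν * s) ^ 2).intervalIntegrable _ _
  rw [e1, e2, e3]

lemma exact_energy (hh : 0 < h) (hν0 : 0 < ν) {lam γ : ℝ} (hγ : 0 < γ) (hνl : ν = γ * lam)
    (h0 : ∀ k, 0 ≤ α k) (h1 : ∀ k, α k ≤ ν) (t : ℝ) :
    Real.exp (2 * bfun α h ν t) / (2 + 3 * γ ^ 2) ≤
      (w1fun α h ν t) ^ 2 + lam ^ 2 * (wfun α h ν t) ^ 2 := by
  have hlam : lam = ν / γ := by rw [hνl]; field_simp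
  have hE : Real.exp (2 * bfun α h ν t) = Real.exp (bfun α h ν t) ^ 2 := by
    rw [← Real.exp_nat_mul]; norm_num
  rw [hE, div_le_iff₀ (by positivity)]
  simp only [w1fun, wfun, Afun]
  set s := Real.sin (ν * t)
  set c := Real.cos (ν * t)
  set E := Real.exp (bfun α h ν t)
  have hsc : s ^ 2 + c ^ 2 = 1 := Real.sin_sq_add_cos_sq _
  set r := α ⌊t / h⌋ / ν with hr
  have hr0 : 0 ≤ r := div_nonneg (h0 _) hν0.le
  have hr1 : r ≤ 1 := by rw [hr, div_le_one hν0]; exact h1 _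
  have hC : α ⌊t / h⌋ * s ^ 2 * s / ν = r * s ^ 3 := by rw [hr]; ring
  rw [hC, hlam]
  have e : (ν / γ) ^ 2 * (E * s / ν) ^ 2 = E ^ 2 * (s ^ 2 / γ ^ 2) := by field_simp
  rw [e]
  set C := c + r * s ^ 3 with hCd
  have hs1 : s ^ 2 ≤ 1 := by nlinarith [sq_nonneg c]
  have hx : (r * s ^ 3) ^ 2 ≤ s ^ 2 := by
    have : r ^ 2 ≤ 1 := by nlinarith
    have h4 : s ^ 4 ≤ 1 := by nlinarith [sq_nonneg s]
    calc (r * s ^ 3) ^ 2 = r ^ 2 * s ^ 4 * s ^ 2 := by ring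
      _ ≤ 1 * 1 * s ^ 2 := by gcongr
      _ = s ^ 2 := by ring
  have hc2 : c ^ 2 ≤ 2 * C ^ 2 + 2 * s ^ 2 := by
    have : c = C - r * s ^ 3 := by rw [hCd]; ring
    rw [this]; nlinarith [sq_nonneg (C + r * s ^ 3)]
  have hfin : 1 ≤ (C ^ 2 + s ^ 2 / γ ^ 2) * (2 + 3 * γ ^ 2) := by
    have : (C ^ 2 + s ^ 2 / γ ^ 2) * (2 + 3 * γ ^ 2) =
      2 * C ^ 2 + 3 * s ^ 2 + 3 * C ^ 2 * γ ^ 2 + 2 * (s ^ 2 / γ ^ 2) := by field_simp; ring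
    rw [this]
    have : 0 ≤ 3 * C ^ 2 * γ ^ 2 := by positivity
    have : 0 ≤ 2 * (s ^ 2 / γ ^ 2) := by positivity
    linarith
  have : ((E * C) ^ 2 + E ^ 2 * (s ^ 2 / γ ^ 2)) * (2 + 3 * γ ^ 2) =
    E ^ 2 * ((C ^ 2 + s ^ 2 / γ ^ 2) * (2 + 3 * γ ^ 2)) := by ring
  rw [this]
  nlinarith [sq_nonneg E]

end
lemma sol_unique {T0 T lam B : ℝ} {c u w w1 : ℝ → ℝ} (hT : T ≤ T0) (hlam : 0 < lam)
    (hB : ∀ t ∈ Icc 0 T, |c t| ≤ B) (hu : IsSol T0 lam c u)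
    (hw : ∀ t ∈ Icc 0 T, HasDerivAt w (w1 t) t)
    (hw1 : ∀ t ∈ Icc 0 T, HasDerivAt w1 (-(lam ^ 2 * c t * w t)) t)
    (h0 : u 0 = w 0) (h1 : der T0 u 0 = w1 0) :
    ∀ t ∈ Icc 0 T, u t = w t ∧ der T0 u t = w1 t := by
  have hsub : Icc 0 T ⊆ Icc 0 T0 := Icc_subset_Icc_right hT
  have hd : ∀ t ∈ Icc 0 T, HasDerivWithinAt
      (fun t => (der T0 u t - w1 t) ^ 2 + lam ^ 2 * (u t - w t) ^ 2)
      (2 * lam ^ 2 * (u t - w t) * (der T0 u t - w1 t) * (1 - c t)) (Icc 0 T0) t := by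
    intro t ht
    have a1 := (hu t (hsub ht)).1.sub (hw t ht).hasDerivWithinAt
    have a2 := (hu t (hsub ht)).2.sub (hw1 t ht).hasDerivWithinAt
    convert! (a2.pow 2).add ((a1.pow 2).const_mul (lam ^ 2)) using 1
    simp; ring
  have hN := eq_zero_of_abs_deriv_le_mul_abs_self_of_eq_zero_right
    (f := fun t => (der T0 u t - w1 t) ^ 2 + lam ^ 2 * (u t - w t) ^ 2)
    (f' := fun t => 2 * lam ^ 2 * (u t - w t) * (der T0 u t - w1 t) * (1 - c t))
    (K := lam * (1 + B)) (a := 0) (b := T)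
    (fun t ht => ((hd t ht).continuousWithinAt).mono hsub)
    (fun t ht => (hd t ⟨ht.1, ht.2.le⟩).mono_of_mem_nhdsWithin
      (Icc_mem_nhdsGE_of_mem ⟨ht.1, ht.2.trans_le hT⟩))
    (by simp [h0, h1])
    (by
      intro t ht
      have hb := hB t ⟨ht.1, ht.2.le⟩
      have hb' : |1 - c t| ≤ 1 + B := by
        have := abs_sub 1 (c t); rw [abs_one] at this; linarith
      set x := u t - w t
      set y := der T0 u t - w1 t
      simp only [Real.norm_eq_abs]
      rw [abs_of_nonneg (by positivity : 0 ≤ y ^ 2 + lam ^ 2 * x ^ 2)]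
      have e : |2 * lam ^ 2 * x * y * (1 - c t)| = lam * (2 * (lam * |x|) * |y|) * |1 - c t| := by
        simp only [abs_mul, abs_pow, abs_of_pos hlam, abs_two]; ring
      rw [e]
      have e2 : 2 * (lam * |x|) * |y| ≤ y ^ 2 + lam ^ 2 * x ^ 2 := by
        have := sq_nonneg (lam * |x| - |y|)
        have hx := sq_abs x
        have hy := sq_abs y
        nlinarith
      calc lam * (2 * (lam * |x|) * |y|) * |1 - c t|
          ≤ lam * (y ^ 2 + lam ^ 2 * x ^ 2) * (1 + B) := by gcongr
        _ = _ := by ring)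
  intro t ht
  have := hN t ht
  have a1 : (der T0 u t - w1 t) ^ 2 = 0 := by nlinarith [sq_nonneg (der T0 u t - w1 t), mul_nonneg (sq_nonneg lam) (sq_nonneg (u t - w t))]
  have a2 : lam ^ 2 * (u t - w t) ^ 2 = 0 := by linarith
  have a3 : u t - w t = 0 := by
    rcases mul_eq_zero.1 a2 with h | h
    · exact absurd h (by positivity)
    · exact pow_eq_zero_iff (two_ne_zero) |>.1 h
  exact ⟨by linarith, by linarith [pow_eq_zero_iff (two_ne_zero) |>.1 a1]⟩

lemma energy_dini {T0 a K μ1 lam : ℝ} {c u : ℝ → ℝ} (ha : 0 ≤ a) (hμ : 0 < μ1) (hK : 0 ≤ K)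
    (hu : IsSol T0 lam c u) (hc : ContinuousOn c (Icc a T0))
    (hLip : ∀ x ∈ Ico a T0, ∀ z ∈ Ico x T0, |c z - c x| ≤ K * (z - x))
    (hpos : ∀ x ∈ Ico a T0, μ1 ≤ c x) :
    ∀ t ∈ Icc a T0,
      ((der T0 u a) ^ 2 + lam ^ 2 * c a * (u a) ^ 2) * Real.exp (-(K / μ1) * (t - a)) ≤
      (der T0 u t) ^ 2 + lam ^ 2 * c t * (u t) ^ 2 := by
  have hsub : Icc a T0 ⊆ Icc 0 T0 := Icc_subset_Icc_left ha
  have hcu : ContinuousOn u (Icc a T0) := fun t ht =>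
    ((hu t (hsub ht)).1.continuousWithinAt).mono hsub
  have hcv : ContinuousOn (der T0 u) (Icc a T0) := fun t ht =>
    ((hu t (hsub ht)).2.continuousWithinAt).mono hsub
  have key := le_gronwallBound_of_liminf_deriv_right_le
    (f := fun t => -((der T0 u t) ^ 2 + lam ^ 2 * c t * (u t) ^ 2))
    (f' := fun t => lam ^ 2 * K * (u t) ^ 2)
    (δ := -((der T0 u a) ^ 2 + lam ^ 2 * c a * (u a) ^ 2)) (K := -(K / μ1)) (ε := 0)
    (a := a) (b := T0)
    ((((hcv.pow 2).add ((continuousOn_const.mul hc).mul (hcu.pow 2)))).neg)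
    (by
      intro x hx r hr
      have hxx : x ∈ Icc 0 T0 := hsub ⟨hx.1, hx.2.le⟩
      have hmem : Icc 0 T0 ∈ nhdsWithin x (Ici x) :=
        Icc_mem_nhdsGE_of_mem ⟨hxx.1, hx.2⟩
      have d1 : HasDerivWithinAt u (der T0 u x) (Ioi x) x :=
        ((hu x hxx).1.mono_of_mem_nhdsWithin hmem).mono Ioi_subset_Ici_self
      have d2 : HasDerivWithinAt (der T0 u) (-(lam ^ 2 * c x * u x)) (Ioi x) x :=
        ((hu x hxx).2.mono_of_mem_nhdsWithin hmem).mono Ioi_subset_Ici_self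
      have dH : HasDerivWithinAt (fun z => -(der T0 u z) ^ 2 - lam ^ 2 * c x * (u z) ^ 2
          + lam ^ 2 * K * ((z - x) * (u z) ^ 2)) (lam ^ 2 * K * (u x) ^ 2) (Ioi x) x := by
        convert! (((d2.pow 2).neg).sub ((d1.pow 2).const_mul (lam ^ 2 * c x))).add
          ((((hasDerivWithinAt_id x _).sub_const x).mul (d1.pow 2)).const_mul (lam ^ 2 * K)) using 1
        simp; ring
      have hev := dH.limsup_slope_le' self_notMem_Ioi hr
      have hI : ∀ᶠ z in nhdsWithin x (Ioi x), z ∈ Ioo x T0 := Ioo_mem_nhdsGT hx.2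
      refine Eventually.frequently ?_
      filter_upwards [hev, hI] with z hz hzI
      refine lt_of_le_of_lt ?_ hz
      rw [slope_def_field, div_eq_inv_mul]
      have hzx : 0 < z - x := sub_pos.2 hzI.1
      gcongr ?_ * ?_
      have hl := hLip x hx z ⟨hzI.1.le, hzI.2⟩
      have hl2 := (abs_le.1 hl).1
      have : lam ^ 2 * (u z) ^ 2 * (-(K * (z - x))) ≤ lam ^ 2 * (u z) ^ 2 * (c z - c x) := by gcongr
      simp only [sub_self, zero_mul, mul_zero]
      linarith)
    le_rfl
    (by
      intro x hx
      have h1 := hpos x hx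
      have h2 : lam ^ 2 * K * (u x) ^ 2 = K / μ1 * (lam ^ 2 * μ1 * (u x) ^ 2) := by field_simp
      have h3 : K / μ1 * (lam ^ 2 * μ1 * (u x) ^ 2) ≤ K / μ1 * (lam ^ 2 * c x * (u x) ^ 2) := by gcongr
      have h4 : 0 ≤ K / μ1 * (der T0 u x) ^ 2 := by positivity
      linarith)
  intro t ht
  have := key t ht
  rw [gronwallBound_ε0] at this
  linarith

lemma lip_of_memPS {T0 μ1 μ2 : ℝ} {ω θ c : ℝ → ℝ} (hθmono : AntitoneOn θ (Ioo 0 T0))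
    (hc : MemPS T0 μ1 μ2 ω θ c) {a : ℝ} (ha : 0 < a) :
    ∀ x ∈ Ico a T0, ∀ z ∈ Ico x T0, |c z - c x| ≤ θ a * (z - x) := by
  intro x hx z hz
  have hsub : Icc x z ⊆ Ioo 0 T0 := fun y hy => ⟨ha.trans_le (hx.1.trans hy.1), hy.2.trans_lt hz.2⟩
  obtain ⟨K, hK⟩ := (hc.2.1.mono hsub).exists_lipschitzOnWith_of_compact isCompact_Icc
  rw [← uIcc_of_le hz.1] at hK
  rw [← hK.absolutelyContinuousOnInterval.integral_deriv_eq_sub]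
  have := intervalIntegral.norm_integral_le_of_norm_le_const_ae (a := x) (b := z) (C := θ a) (f := deriv c)
    (by
      have h1 := (ae_restrict_iff' measurableSet_Ioo).1 hc.2.2.2.2
      filter_upwards [h1] with y hy hyI
      rw [uIoc_of_le hz.1] at hyI
      have hy' : y ∈ Ioo 0 T0 := hsub ⟨hyI.1.le, hyI.2⟩
      exact (hy hy').trans (hθmono ⟨ha, hx.1.trans_lt hx.2⟩ hy' (hx.1.trans hyI.1.le)))
  rwa [Real.norm_eq_abs, abs_of_nonneg (sub_nonneg.2 hz.1)] at this

lemma theta_int {T0 : ℝ} {θ : ℝ → ℝ}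
    (hθcont : ContinuousOn θ (Ioo 0 T0)) (hθpos : ∀ t ∈ Ioo 0 T0, 0 < θ t)
    (hθmono : AntitoneOn θ (Ioo 0 T0)) :
    ∀ p q, 0 < p → p ≤ q → q ≤ T0 → IntervalIntegrable θ volume p q := by
  intro p q hp hpq hq
  rcases hpq.eq_or_lt with he | hlt
  · rw [he]
  rw [intervalIntegrable_iff_integrableOn_Ioo_of_le hpq]
  have hsub : Ioo p q ⊆ Ioo 0 T0 := fun x hx => ⟨hp.trans hx.1, hx.2.trans_le hq⟩
  refine IntegrableOn.of_bound (C := θ p) (by simp)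
    ((hθcont.mono hsub).aestronglyMeasurable measurableSet_Ioo) ?_
  rw [ae_restrict_iff' measurableSet_Ioo]
  refine Eventually.of_forall fun x hx => ?_
  rw [Real.norm_eq_abs, abs_of_pos (hθpos x (hsub hx))]
  exact hθmono ⟨hp, hlt.trans_le hq⟩ (hsub hx) hx.1.le

lemma theta_int_nonneg {T0 : ℝ} {θ : ℝ → ℝ} (hθpos : ∀ t ∈ Ioo 0 T0, 0 < θ t) :
    ∀ p q, 0 < p → p ≤ q → q ≤ T0 → 0 ≤ ∫ t in p..q, θ t := by
  intro p q hp hpq hq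
  rw [intervalIntegral.integral_of_le hpq, integral_Ioc_eq_integral_Ioo]
  exact setIntegral_nonneg measurableSet_Ioo fun x hx =>
    (hθpos x ⟨hp.trans hx.1, hx.2.trans_le hq⟩).le

lemma min_int {T0 Λ : ℝ} {θ : ℝ → ℝ}
    (hθcont : ContinuousOn θ (Ioo 0 T0)) (hθpos : ∀ t ∈ Ioo 0 T0, 0 < θ t)
    (hθmono : AntitoneOn θ (Ioo 0 T0)) :
    ∀ p q, 0 < p → p ≤ q → q ≤ T0 →
      IntervalIntegrable (fun t => min Λ (θ t)) volume p q := by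
  intro p q hp hpq hq
  have h1 := theta_int hθcont hθpos hθmono p q hp hpq hq
  have h2 : IntervalIntegrable (fun _ : ℝ => Λ) volume p q := intervalIntegrable_const
  exact ⟨h2.1.inf h1.1, h2.2.inf h1.2⟩

/-- The key upper bound for `m`. -/
lemma mFun_le {T0 lam : ℝ} {ω θ : ℝ → ℝ} (hlam : 0 < lam) (hω0 : 0 < ω (1 / lam))
    (hθcont : ContinuousOn θ (Ioo 0 T0)) (hθpos : ∀ t ∈ Ioo 0 T0, 0 < θ t)
    (hθmono : AntitoneOn θ (Ioo 0 T0)) {z y : ℝ} (hz : 0 < z) (hzy : z ≤ y) (hy : y < T0) :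
    mFun T0 ω θ lam ≤ lam * ω (1 / lam) * z +
      (∫ t in z..y, min (lam * ω (1 / lam)) (θ t)) + ∫ t in y..T0, θ t := by
  set Λ := lam * ω (1 / lam) with hΛ
  have hΛ0 : 0 < Λ := by positivity
  have hInt := theta_int hθcont hθpos hθmono
  have hnn := theta_int_nonneg hθpos
  have hm : ∀ s ∈ Ioc 0 T0, mFun T0 ω θ lam ≤ Λ * s + ∫ t in s..T0, θ t := by
    intro s hs
    refine csInf_le ⟨0, ?_⟩ ⟨s, hs, rfl⟩
    rintro _ ⟨s, hs, rfl⟩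
    have := hnn s T0 hs.1 hs.2 le_rfl
    have h2 := mul_nonneg hΛ0.le hs.1.le
    simp only; linarith
  have hsuby : Ioo z y ⊆ Ioo 0 T0 := fun x hx => ⟨hz.trans hx.1, hx.2.trans hy⟩
  -- choose the crossing point
  obtain ⟨s, hsz, hsy, hs1, hs2⟩ : ∃ s, z ≤ s ∧ s ≤ y ∧ (∀ t ∈ Ioo z s, Λ ≤ θ t) ∧
      (∀ t ∈ Ioo s y, θ t ≤ Λ) := by
    set S := {t | t ∈ Icc z y ∧ (t = z ∨ Λ ≤ θ t)} with hS
    have hne : z ∈ S := ⟨⟨le_rfl, hzy⟩, Or.inl rfl⟩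
    have hbd : BddAbove S := ⟨y, fun t ht => ht.1.2⟩
    refine ⟨sSup S, le_csSup hbd hne, csSup_le ⟨z, hne⟩ fun t ht => ht.1.2, ?_, ?_⟩
    · intro t ht
      obtain ⟨x, hxS, hx⟩ := exists_lt_of_lt_csSup ⟨z, hne⟩ ht.2
      have hx2 : Λ ≤ θ x := hxS.2.resolve_left (by linarith [ht.1])
      exact hx2.trans (hθmono ⟨hz.trans ht.1, (hx.trans_le hxS.1.2).trans hy⟩
        ⟨hz.trans (ht.1.trans hx), hxS.1.2.trans_lt hy⟩ hx.le)
    · intro t ht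
      by_contra hcon
      push Not at hcon
      have : t ∈ S := ⟨⟨(le_csSup hbd hne).trans ht.1.le, ht.2.le⟩, Or.inr hcon.le⟩
      exact absurd (le_csSup hbd this) (not_le.2 ht.1)
  have hmin := min_int (Λ := Λ) hθcont hθpos hθmono
  have hsplit : ∫ t in z..y, min Λ (θ t) = (∫ t in z..s, min Λ (θ t)) + ∫ t in s..y, min Λ (θ t) :=
    (intervalIntegral.integral_add_adjacent_intervals (hmin z s hz hsz (hsy.trans hy.le))
      (hmin s y (hz.trans_le hsz) hsy hy.le)).symm
  have i1 : ∫ t in z..s, min Λ (θ t) = Λ * (s - z) := by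
    rw [intervalIntegral.integral_of_le hsz, integral_Ioc_eq_integral_Ioo,
      setIntegral_congr_fun (g := fun _ => Λ) measurableSet_Ioo
        (fun t ht => min_eq_left (hs1 t ht))]
    simp [hsz, mul_comm]
  have i2 : ∫ t in s..y, min Λ (θ t) = ∫ t in s..y, θ t := by
    rw [intervalIntegral.integral_of_le hsy, intervalIntegral.integral_of_le hsy,
      integral_Ioc_eq_integral_Ioo, integral_Ioc_eq_integral_Ioo]
    exact setIntegral_congr_fun measurableSet_Ioo (fun t ht => min_eq_right (hs2 t ht))
  have i3 : (∫ t in s..y, θ t) + ∫ t in y..T0, θ t = ∫ t in s..T0, θ t :=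
    intervalIntegral.integral_add_adjacent_intervals (hInt s y (hz.trans_le hsz) hsy hy.le)
      (hInt y T0 (hz.trans_le hzy) hy.le le_rfl)
  have := hm s ⟨hz.trans_le hsz, hsy.trans hy.le⟩
  rw [hsplit, i1, i2]
  linarith
/-- The amplitudes on each lattice cell. -/
noncomputable def alph (T κ Λ h : ℝ) (θ : ℝ → ℝ) (k : ℤ) : ℝ :=
  if 0 ≤ k ∧ ((k : ℝ) + 1) * h ≤ T then κ * min Λ (θ (((k : ℝ) + 1) * h)) else 0

lemma alph_bounds {T0 T κ Λ h : ℝ} {θ : ℝ → ℝ} (hh : 0 < h) (hκ : 0 ≤ κ) (hΛ : 0 ≤ Λ) (hT : T < T0)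
    (hθpos : ∀ t ∈ Ioo 0 T0, 0 < θ t) (k : ℤ) :
    0 ≤ alph T κ Λ h θ k ∧ alph T κ Λ h θ k ≤ κ * Λ := by
  unfold alph
  split_ifs with hk
  · have hk0 : (0:ℝ) ≤ k := by exact_mod_cast hk.1
    have := hθpos (((k : ℝ) + 1) * h) ⟨by positivity, hk.2.trans_lt hT⟩
    exact ⟨mul_nonneg hκ (le_min hΛ this.le), mul_le_mul_of_nonneg_left (min_le_left _ _) hκ⟩
  · exact ⟨le_rfl, by positivity⟩

lemma growth {T0 T κ Λ h ν M : ℝ} {θ : ℝ → ℝ}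
    (hθcont : ContinuousOn θ (Ioo 0 T0)) (hθpos : ∀ t ∈ Ioo 0 T0, 0 < θ t)
    (hθmono : AntitoneOn θ (Ioo 0 T0)) (hh : 0 < h) (hν : ν * h = Real.pi) (hν0 : 0 < ν)
    (hκ : 0 ≤ κ) (hT : T + h < T0) (hα : ∀ k, |alph T κ Λ h θ k| ≤ M) (n : ℕ) (hn : n * h ≤ T) :
    κ / 2 * (∫ t in h..((n + 1) * h), min Λ (θ t)) ≤ bfun (alph T κ Λ h θ) h ν (n * h) := by
  induction n with
  | zero => simp [bfun]
  | succ n ih =>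
    push_cast at hn ⊢
    have hn' : (n:ℝ) * h ≤ T := by nlinarith
    have h1 := ih hn'
    have h2 := bfun_step hh hν hν0 hα n
    rw [Int.cast_natCast] at h2
    have ha : alph T κ Λ h θ n = κ * min Λ (θ (((n : ℝ) + 1) * h)) := by
      unfold alph
      rw [if_pos ⟨by positivity, by exact_mod_cast hn⟩]; simp
    rw [h2, ha]
    have hn0 : (0:ℝ) ≤ n := by positivity
    have hmin := min_int (Λ := Λ) hθcont hθpos hθmono
    have hq1 : h ≤ ((n:ℝ) + 1) * h := by nlinarith
    have hq2 : ((n:ℝ) + 1) * h ≤ ((n:ℝ) + 1 + 1) * h := by nlinarith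
    have hq3 : ((n:ℝ) + 1 + 1) * h < T0 := by nlinarith
    rw [← intervalIntegral.integral_add_adjacent_intervals
      (hmin h _ hh hq1 (hq2.trans hq3.le)) (hmin _ _ (hh.trans_le hq1) hq2 hq3.le)]
    have h3 : ∫ t in (((n:ℝ) + 1) * h)..(((n:ℝ) + 1 + 1) * h), min Λ (θ t) ≤
        ∫ t in (((n:ℝ) + 1) * h)..(((n:ℝ) + 1 + 1) * h), min Λ (θ (((n : ℝ) + 1) * h)) := by
      refine intervalIntegral.integral_mono_on hq2 (hmin _ _ (hh.trans_le hq1) hq2 hq3.le)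
        intervalIntegrable_const ?_
      intro x hx
      exact min_le_min le_rfl (hθmono ⟨hh.trans_le hq1, hq2.trans_lt hq3⟩
        ⟨(hh.trans_le hq1).trans_le hx.1, hx.2.trans_lt hq3⟩ hx.1)
    rw [intervalIntegral.integral_const] at h3
    have h4 : (((n:ℝ) + 1 + 1) * h - ((n:ℝ) + 1) * h) = h := by ring
    rw [h4, smul_eq_mul] at h3
    have h5 := mul_le_mul_of_nonneg_left h3 (by positivity : 0 ≤ κ / 2)
    linarith

lemma growth_m {T0 T κ lam h ν M : ℝ} {ω θ : ℝ → ℝ} (hlam : 0 < lam) (hω0 : 0 < ω (1 / lam))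
    (hθcont : ContinuousOn θ (Ioo 0 T0)) (hθpos : ∀ t ∈ Ioo 0 T0, 0 < θ t)
    (hθmono : AntitoneOn θ (Ioo 0 T0)) (hh : 0 < h) (hν : ν * h = Real.pi) (hν0 : 0 < ν)
    (hκ : 0 ≤ κ) (hT : T + h < T0)
    (hα : ∀ k, |alph T κ (lam * ω (1 / lam)) h θ k| ≤ M) {τ : ℝ} (hτ : 0 < τ) (hτT : τ ≤ T) :
    κ / 2 * (mFun T0 ω θ lam - lam * ω (1 / lam) * h - ∫ t in τ..T0, θ t) ≤
      bfun (alph T κ (lam * ω (1 / lam)) h θ) h ν τ := by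
  set n := ⌊τ / h⌋₊ with hn
  have n1 : (n:ℝ) * h ≤ τ := by
    rw [← le_div_iff₀ hh]; exact Nat.floor_le (by positivity)
  have n2 : τ < ((n:ℝ) + 1) * h := by
    rw [← div_lt_iff₀ hh]; exact Nat.lt_floor_add_one _
  have g := growth hθcont hθpos hθmono hh hν hν0 hκ hT hα n (n1.trans hτT)
  have h0 : ∀ k, 0 ≤ alph T κ (lam * ω (1 / lam)) h θ k := fun k =>
    (alph_bounds hh hκ (by positivity) (by linarith) hθpos k).1
  have mono := bfun_mono hh hν hα h0 n1
  have hy : ((n:ℝ) + 1) * h < T0 := by nlinarith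
  have hm := mFun_le hlam hω0 hθcont hθpos hθmono hh (by nlinarith [(Nat.cast_nonneg n : (0:ℝ) ≤ n)] : h ≤ ((n:ℝ) + 1) * h) hy
  have hadd := intervalIntegral.integral_add_adjacent_intervals
    (theta_int hθcont hθpos hθmono τ _ hτ n2.le hy.le)
    (theta_int hθcont hθpos hθmono _ T0 (hτ.trans n2) hy.le le_rfl)
  have hnn := theta_int_nonneg hθpos τ _ hτ n2.le hy.le
  refine le_trans ?_ (g.trans mono)
  gcongr
  linarith

noncomputable def Pk (a ν lam t : ℝ) : ℝ :=
  (4 * ν * a * Real.sin (ν * t) * Real.cos (ν * t) + a ^ 2 * Real.sin (ν * t) ^ 4) / lam ^ 2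

lemma Pk_lip {a ν lam γ : ℝ} (hlam : 0 < lam) (hγ : 0 < γ) (hν : ν = γ * lam) (ha : 0 ≤ a)
    (haν : a ≤ ν) (s t : ℝ) : |Pk a ν lam s - Pk a ν lam t| ≤ 8 * γ ^ 2 * a * |s - t| := by
  have hν0 : 0 < ν := by rw [hν]; positivity
  have hd : ∀ x ∈ (univ : Set ℝ), HasDerivWithinAt (Pk a ν lam)
      ((4 * ν ^ 2 * a * (Real.cos (ν * x) ^ 2 - Real.sin (ν * x) ^ 2) +
        4 * a ^ 2 * ν * Real.sin (ν * x) ^ 3 * Real.cos (ν * x)) / lam ^ 2) univ x := by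
    intro x _
    have h1 : HasDerivAt (fun y => ν * y) ν x := by simpa using (hasDerivAt_id x).const_mul ν
    rw [hasDerivWithinAt_univ]
    convert! ((((h1.sin.const_mul (4 * ν * a)).mul h1.cos).add
      ((h1.sin.pow 4).const_mul (a ^ 2))).div_const (lam ^ 2)) using 1
    simp; ring
  have hb : ∀ x ∈ (univ : Set ℝ), ‖((4 * ν ^ 2 * a * (Real.cos (ν * x) ^ 2 - Real.sin (ν * x) ^ 2) +
        4 * a ^ 2 * ν * Real.sin (ν * x) ^ 3 * Real.cos (ν * x)) / lam ^ 2)‖ ≤ 8 * γ ^ 2 * a := by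
    intro x _
    rw [Real.norm_eq_abs, abs_div, abs_of_pos (by positivity : 0 < lam ^ 2), div_le_iff₀ (by positivity)]
    have hc1 := Real.abs_cos_le_one (ν * x)
    have hs1 := Real.abs_sin_le_one (ν * x)
    have hsc := Real.sin_sq_add_cos_sq (ν * x)
    set s := Real.sin (ν * x)
    set c := Real.cos (ν * x)
    have e1 : |c ^ 2 - s ^ 2| ≤ 1 := by rw [abs_le]; constructor <;> nlinarith [sq_nonneg s, sq_nonneg c]
    have e2 : |s ^ 3 * c| ≤ 1 := by
      rw [abs_mul, abs_pow]
      exact mul_le_one₀ (pow_le_one₀ (abs_nonneg _) hs1) (abs_nonneg _) hc1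
    have e3 : |4 * ν ^ 2 * a * (c ^ 2 - s ^ 2)| ≤ 4 * ν ^ 2 * a := by
      rw [abs_mul, abs_of_nonneg (by positivity : 0 ≤ 4 * ν ^ 2 * a)]
      exact mul_le_of_le_one_right (by positivity) e1
    have e4 : |4 * a ^ 2 * ν * s ^ 3 * c| ≤ 4 * a ^ 2 * ν := by
      rw [mul_assoc _ (s ^ 3), abs_mul, abs_of_nonneg (by positivity : 0 ≤ 4 * a ^ 2 * ν)]
      exact mul_le_of_le_one_right (by positivity) e2
    have e5 : 4 * a ^ 2 * ν ≤ 4 * ν ^ 2 * a := by nlinarith [mul_nonneg ha hν0.le]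
    have e6 : 8 * γ ^ 2 * a * lam ^ 2 = 8 * ν ^ 2 * a := by rw [hν]; ring
    rw [e6]
    linarith [abs_add_le (4 * ν ^ 2 * a * (c ^ 2 - s ^ 2)) (4 * a ^ 2 * ν * s ^ 3 * c)]
  have := convex_univ.norm_image_sub_le_of_norm_hasDerivWithin_le hd hb (mem_univ t) (mem_univ s)
  simpa [Real.norm_eq_abs] using this

lemma Pk_bound {a ν lam γ : ℝ} (hlam : 0 < lam) (hγ : 0 < γ) (hν : ν = γ * lam) (ha : 0 ≤ a)
    (haν : a ≤ ν) (t : ℝ) : |Pk a ν lam t| ≤ 3 * γ * (a / lam) := by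
  have hν0 : 0 < ν := by rw [hν]; positivity
  rw [Pk, abs_div, abs_of_pos (by positivity : 0 < lam ^ 2), div_le_iff₀ (by positivity)]
  have hsc := Real.sin_sq_add_cos_sq (ν * t)
  have hs1 := Real.abs_sin_le_one (ν * t)
  set s := Real.sin (ν * t)
  set c := Real.cos (ν * t)
  have e1 : |2 * s * c| ≤ 1 := by
    rw [abs_le]; constructor <;> nlinarith [sq_nonneg (s - c), sq_nonneg (s + c)]
  have e3 : |4 * ν * a * s * c| ≤ 2 * ν * a := by
    rw [show 4 * ν * a * s * c = 2 * ν * a * (2 * s * c) by ring, abs_mul,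
      abs_of_nonneg (by positivity : 0 ≤ 2 * ν * a)]
    exact mul_le_of_le_one_right (by positivity) e1
  have e4 : |a ^ 2 * s ^ 4| ≤ a ^ 2 := by
    rw [abs_mul, abs_of_nonneg (by positivity : 0 ≤ a ^ 2), abs_pow]
    exact mul_le_of_le_one_right (by positivity) (pow_le_one₀ (abs_nonneg _) hs1)
  have e5 : a ^ 2 ≤ ν * a := by nlinarith
  have e6 : 3 * γ * (a / lam) * lam ^ 2 = 3 * (ν * a) := by rw [hν]; field_simp
  rw [e6]
  linarith [abs_add_le (4 * ν * a * s * c) (a ^ 2 * s ^ 4)]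

noncomputable def Pfun (α : ℤ → ℝ) (h ν lam t : ℝ) : ℝ := Pk (α ⌊t / h⌋) ν lam t

lemma Pfun_lip {α : ℤ → ℝ} {h ν lam γ M : ℝ} (hh : 0 < h) (hνh : ν * h = Real.pi) (hlam : 0 < lam)
    (hγ : 0 < γ) (hν : ν = γ * lam) (ha : ∀ k, 0 ≤ α k) (haν : ∀ k, α k ≤ ν) (hM : ∀ k, α k ≤ M)
    (s t : ℝ) : |Pfun α h ν lam s - Pfun α h ν lam t| ≤ 8 * γ ^ 2 * M * |s - t| := by
  refine glue_lip hh (fun k t => Pk (α k) ν lam t) (fun k s t => ?_) (fun k j => ?_) s t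
  · refine (Pk_lip hlam hγ hν (ha k) (haν k) s t).trans ?_
    gcongr; exact hM k
  · simp [Pk, sin_lattice hνh j]
lemma Pfun_zero {κ Λ h ν lam T : ℝ} {θ : ℝ → ℝ} (hh : 0 < h) {t : ℝ} (ht : T ≤ t) :
    Pfun (alph T κ Λ h θ) h ν lam t = 0 := by
  have h1 := (floor_bounds hh t).2
  have : alph T κ Λ h θ ⌊t / h⌋ = 0 := by
    unfold alph
    rw [if_neg]
    rintro ⟨_, h2⟩
    linarith
  simp [Pfun, Pk, this]

lemma memPS_pert {T0 μ1 μ2 T1 γ η T κ lam h ν : ℝ} {ω θ cstar : ℝ → ℝ}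
    (hω : IsModulusOfContinuity ω)
    (hθpos : ∀ t ∈ Ioo 0 T0, 0 < θ t) (hθmono : AntitoneOn θ (Ioo 0 T0))
    (hγ : 0 < γ) (hη : η ∈ Ioo 0 1)
    (hcstar : MemD T0 μ1 μ2 ω θ T1 γ η cstar)
    (hT : T = T1 / 2) (hT1 : T1 ∈ Ioo 0 T0) (hlam : 0 < lam) (hν : ν = γ * lam)
    (hh : 0 < h) (hνh : ν * h = Real.pi) (hκ : 0 ≤ κ) (hκ1 : γ * κ ≤ 1 / 16)
    (hκ2 : γ ^ 2 * κ ≤ 1 / 16) (G1 : κ * ω (1 / lam) ≤ γ)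
    (G3 : ω (1 / lam) ≤ γ ^ 2 - μ1) (G3' : ω (1 / lam) ≤ μ2 - γ ^ 2)
    (G4 : ω (1 / lam) ≤ η * ω T) :
    (∀ t, |Pfun (alph T κ (lam * ω (1 / lam)) h θ) h ν lam t| ≤ ω (1 / lam)) ∧
    MemPS T0 μ1 μ2 ω θ
      (fun t => cstar t - Pfun (alph T κ (lam * ω (1 / lam)) h θ) h ν lam t) := by
  obtain ⟨hPS, hconst, hD⟩ := hcstar
  obtain ⟨c1, c2, c3, c4, c5⟩ := hPS
  obtain ⟨w1, w2, w3, w4⟩ := hω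
  obtain ⟨hT10, hT11⟩ := hT1
  have hTpos : 0 < T := by linarith
  have hTT0 : T < T0 := by linarith
  have hTT1 : T < T1 := by linarith
  have hw0 : 0 < ω (1 / lam) := w1 _ (by positivity)
  have hω0 : 0 ≤ ω 0 := by
    have := c4 0 ⟨le_rfl, by linarith⟩ 0 ⟨le_rfl, by linarith⟩
    simpa using this
  set Λ := lam * ω (1 / lam) with hΛ
  have hΛ0 : 0 < Λ := by positivity
  set α := alph T κ Λ h θ with hαdef
  have hα0 : ∀ k, 0 ≤ α k := fun k => (alph_bounds hh hκ hΛ0.le hTT0 hθpos k).1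
  have hα1 : ∀ k, α k ≤ κ * Λ := fun k => (alph_bounds hh hκ hΛ0.le hTT0 hθpos k).2
  have hαν : ∀ k, α k ≤ ν := fun k => (hα1 k).trans (by
    rw [hν, hΛ]; nlinarith)
  set P := Pfun α h ν lam with hP
  have hPz : ∀ t, T ≤ t → P t = 0 := fun t ht => Pfun_zero hh ht
  have hPb : ∀ t, |P t| ≤ 3 / 16 * ω (1 / lam) := by
    intro t
    refine (Pk_bound hlam hγ hν (hα0 _) (hαν _) t).trans ?_
    have : α ⌊t / h⌋ / lam ≤ κ * ω (1 / lam) := by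
      rw [div_le_iff₀ hlam]; refine (hα1 _).trans (le_of_eq ?_); rw [hΛ]; ring
    calc 3 * γ * (α ⌊t / h⌋ / lam) ≤ 3 * γ * (κ * ω (1 / lam)) := by gcongr
      _ = 3 * (γ * κ) * ω (1 / lam) := by ring
      _ ≤ 3 * (1 / 16) * ω (1 / lam) := by gcongr
      _ = _ := by ring
  have hPL : ∀ s t, |P s - P t| ≤ Λ * |s - t| := by
    intro s t
    refine (Pfun_lip hh hνh hlam hγ hν hα0 hαν hα1 s t).trans ?_
    have : 8 * γ ^ 2 * (κ * Λ) ≤ Λ := by nlinarith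
    gcongr
  have hPω : ∀ s t, |P s - P t| ≤ ω |s - t| := by
    intro s t
    rcases (abs_nonneg (s - t)).eq_or_lt with he | hpos
    · have := hPL s t
      rw [← he] at this ⊢
      simp only [mul_zero] at this
      linarith
    rcases le_total (1 / lam) |s - t| with hle | hle
    · have := w3 _ _ (by positivity) hle
      have h1 := hPb s
      have h2 := hPb t
      have h3 := abs_sub (P s) (P t)
      linarith
    · have h1 := w4 _ _ hpos hle
      have h2 := w1 _ hpos
      rw [div_le_div_iff₀ h2 hw0] at h1
      refine (hPL s t).trans ?_
      have : lam * (|s - t| * ω (1 / lam)) ≤ lam * (1 / lam * ω |s - t|) := by gcongr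
      calc Λ * |s - t| = lam * (|s - t| * ω (1 / lam)) := by rw [hΛ]; ring
        _ ≤ _ := this
        _ = ω |s - t| := by field_simp
  have hPcont : Continuous P := by
    have : LipschitzWith (Real.toNNReal Λ) P := by
      refine LipschitzWith.of_dist_le_mul fun s t => ?_
      rw [Real.coe_toNNReal _ hΛ0.le, Real.dist_eq, Real.dist_eq]; exact hPL s t
    exact this.continuous
  have hPll : LocallyLipschitzOn (Ioo 0 T0) P := by
    have : LipschitzWith (Real.toNNReal Λ) P := by
      refine LipschitzWith.of_dist_le_mul fun s t => ?_
      rw [Real.coe_toNNReal _ hΛ0.le, Real.dist_eq, Real.dist_eq]; exact hPL s t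
    exact this.locallyLipschitz.locallyLipschitzOn
  refine ⟨fun t => (hPb t).trans (by linarith), c1.sub hPcont.continuousOn, c2.sub hPll, ?_, ?_, ?_⟩
  · intro t ht
    rcases le_total T t with hle | hle
    · simp only [hPz t hle, sub_zero]; exact c3 t ht
    · have h1 := hconst t ⟨ht.1.le, by linarith⟩
      have h2 := abs_le.1 (hPb t)
      simp only [h1]
      constructor <;> linarith [h2.1, h2.2]
  · have key : ∀ t ∈ Icc 0 T0, ∀ s ∈ Icc 0 T0, t ≤ s →
        |(cstar t - P t) - (cstar s - P s)| ≤ ω |t - s| := by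
      intro t ht s hs hts
      rcases le_total s T1 with h1 | h1
      · rw [hconst t ⟨ht.1, hts.trans h1⟩, hconst s ⟨hs.1, h1⟩]
        rw [show γ ^ 2 - P t - (γ ^ 2 - P s) = P s - P t by ring, abs_sub_comm t]
        exact hPω s t
      rcases le_total T t with h2 | h2
      · rw [hPz t h2, hPz s (h2.trans hts), sub_zero, sub_zero]; exact c4 t ht s hs
      · rw [hPz s (by linarith), sub_zero]
        have a1 := hD t ht s hs
        have a2 := hPb t
        have a3 : ω T ≤ ω |t - s| := w3 _ _ hTpos.le (by
          rw [abs_sub_comm, abs_of_nonneg (by linarith)]; linarith)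
        have a4 : η * ω T ≤ η * ω |t - s| := mul_le_mul_of_nonneg_left a3 hη.1.le
        have a5 := abs_sub (cstar t - cstar s) (P t)
        rw [show cstar t - P t - cstar s = cstar t - cstar s - P t by ring]
        linarith
    intro t ht s hs
    rcases le_total t s with hts | hts
    · exact key t ht s hs hts
    · rw [abs_sub_comm, abs_sub_comm t]; exact key s hs t ht hts
  · have hcount : (range fun k : ℤ => (k : ℝ) * h).Countable := countable_range _
    rw [ae_restrict_iff' measurableSet_Ioo] at c5 ⊢
    filter_upwards [c5, hcount.ae_notMem volume] with t ht1 ht2 ht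
    rcases lt_or_ge T t with hle | hle
    · have : (fun t => cstar t - P t) =ᶠ[nhds t] cstar := by
        filter_upwards [Ioi_mem_nhds hle] with y hy
        rw [hPz y (le_of_lt hy), sub_zero]
      rw [this.deriv_eq]; exact ht1 ht
    · obtain ⟨f1, f2⟩ := floor_bounds hh t
      have f1' : (⌊t / h⌋ : ℝ) * h < t := lt_of_le_of_ne f1 fun he => ht2 ⟨_, he⟩
      have hθt := hθpos t ht
      rw [← Real.norm_eq_abs]
      refine norm_deriv_le_of_lip' hθt.le ?_
      filter_upwards [Ioo_mem_nhds f1' f2, Ioo_mem_nhds ht.1 (hle.trans_lt hTT1)] with y hy hy2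
      rw [hconst t ⟨ht.1.le, by linarith⟩, hconst y ⟨hy2.1.le, hy2.2.le⟩, Real.norm_eq_abs,
        Real.norm_eq_abs, show γ ^ 2 - P y - (γ ^ 2 - P t) = P t - P y by ring, abs_sub_comm]
      have hfl : ⌊y / h⌋ = ⌊t / h⌋ := floor_eq_of_Ico hh _ hy.1.le hy.2
      simp only [hP, Pfun, hfl]
      refine (Pk_lip hlam hγ hν (hα0 _) (hαν _) y t).trans ?_
      gcongr
      have hαθ : α ⌊t / h⌋ ≤ κ * θ t := by
        rw [hαdef]; unfold alph
        split_ifs with hk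
        · have hk0 : (0:ℝ) ≤ ⌊t / h⌋ := by exact_mod_cast hk.1
          refine mul_le_mul_of_nonneg_left ((min_le_right _ _).trans ?_) hκ
          exact hθmono ht ⟨by positivity, hk.2.trans_lt hTT0⟩ f2.le
        · positivity
      calc 8 * γ ^ 2 * α ⌊t / h⌋ ≤ 8 * γ ^ 2 * (κ * θ t) := by gcongr
        _ = 8 * (γ ^ 2 * κ) * θ t := by ring
        _ ≤ 8 * (1 / 16) * θ t := by gcongr
        _ ≤ θ t := by linarith

/-- Energy lower bound for the perturbed coefficient. -/
lemma energy_pert {T0 μ1 μ2 T1 γ η T κ lam h ν : ℝ} {ω θ cstar : ℝ → ℝ}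
    (hμ1 : 0 < μ1)
    (hω : IsModulusOfContinuity ω)
    (hθcont : ContinuousOn θ (Ioo 0 T0))
    (hθpos : ∀ t ∈ Ioo 0 T0, 0 < θ t) (hθmono : AntitoneOn θ (Ioo 0 T0))
    (hγ : 0 < γ) (hη : η ∈ Ioo 0 1)
    (hcstar : MemD T0 μ1 μ2 ω θ T1 γ η cstar)
    (hT : T = T1 / 2) (hT1 : T1 ∈ Ioo 0 T0) (hlam : 0 < lam) (hν : ν = γ * lam)
    (hh : 0 < h) (hνh : ν * h = Real.pi) (hκ : 0 ≤ κ)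
    (G1 : κ * ω (1 / lam) ≤ γ) (G2 : T + h < T0)
    (hPb : ∀ t, |Pfun (alph T κ (lam * ω (1 / lam)) h θ) h ν lam t| ≤ ω (1 / lam))
    {u : ℝ → ℝ} (hu : IsSol T0 lam
      (fun t => cstar t - Pfun (alph T κ (lam * ω (1 / lam)) h θ) h ν lam t) u)
    (hu0 : u 0 = 0) (hu1 : der T0 u 0 = 1)
    (hc : ContinuousOn (fun t => cstar t - Pfun (alph T κ (lam * ω (1 / lam)) h θ) h ν lam t)
      (Icc 0 T0)) {τ t : ℝ} (hτ : 0 < τ) (hτT : τ ≤ T) (ht : t ∈ Icc τ T0) :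
    (min 1 (γ ^ 2) / (2 + 3 * γ ^ 2) * Real.exp (-(θ T / μ1) * T0) / (1 + γ ^ 2 + ω T0)) *
      Real.exp (κ * (mFun T0 ω θ lam - lam * ω (1 / lam) * h - ∫ t in τ..T0, θ t)) ≤
      (der T0 u t) ^ 2 + lam ^ 2 * (u t) ^ 2 := by
  have hPS := hcstar.1
  obtain ⟨hT10, hT11⟩ := hT1
  have hTpos : 0 < T := by linarith
  have hTT0 : T < T0 := by linarith
  have hT0 : 0 < T0 := by linarith
  have hTT1 : T < T1 := by linarith
  have hw0 : 0 < ω (1 / lam) := hω.1 _ (by positivity)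
  have hwT0 : 0 < ω T0 := hω.1 _ hT0
  have hθT : 0 < θ T := hθpos T ⟨hTpos, hTT0⟩
  set Λ := lam * ω (1 / lam) with hΛ
  have hΛ0 : 0 < Λ := by positivity
  set α := alph T κ Λ h θ with hαdef
  have hα0 : ∀ k, 0 ≤ α k := fun k => (alph_bounds hh hκ hΛ0.le hTT0 hθpos k).1
  have hα1 : ∀ k, α k ≤ κ * Λ := fun k => (alph_bounds hh hκ hΛ0.le hTT0 hθpos k).2
  have hαν : ∀ k, α k ≤ ν := fun k => (hα1 k).trans (by
    rw [hν, hΛ]; nlinarith)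
  have hαM : ∀ k, |α k| ≤ ν := fun k => by rw [abs_of_nonneg (hα0 k)]; exact hαν k
  have hν0 : 0 < ν := by rw [hν]; positivity
  have hgrow := growth_m (ω := ω) hlam hw0 hθcont hθpos hθmono hh hνh hν0 hκ G2 hαM hτ hτT
  rw [← hΛ, ← hαdef] at hgrow
  set X := κ * (mFun T0 ω θ lam - Λ * h - ∫ t in τ..T0, θ t) with hX
  have hex : ∀ s, τ ≤ s → Real.exp X / (2 + 3 * γ ^ 2) ≤
      (w1fun α h ν s) ^ 2 + lam ^ 2 * (wfun α h ν s) ^ 2 := by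
    intro s hs
    refine le_trans ?_ (exact_energy hh hν0 hγ hν hα0 hαν s)
    have := bfun_mono hh hνh hαM hα0 hs
    gcongr
    linarith
  have huniq := sol_unique (T := T) (B := γ ^ 2 + ω (1 / lam)) (w := wfun α h ν) (w1 := w1fun α h ν)
    hTT0.le hlam (by
      intro s hs
      rw [hcstar.2.1 s ⟨hs.1, hs.2.trans hTT1.le⟩]
      have := abs_sub (γ ^ 2) (Pfun α h ν lam s)
      rw [abs_of_pos (by positivity : 0 < γ ^ 2)] at this
      linarith [hPb s]) hu (fun s _ => wfun_hasDerivAt hh hνh hν0 hαM s)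
    (by
      intro s hs
      convert w1fun_hasDerivAt hh hνh hν0 hαM s using 2
      rw [hcstar.2.1 s ⟨hs.1, hs.2.trans hTT1.le⟩, Pfun, Pk, hν]
      field_simp
      ring)
    (by simp [hu0, wfun]) (by simp [hu1, w1fun, bfun])
  have hmin1 : min 1 (γ ^ 2) ≤ 1 := min_le_left _ _
  have hmin2 : min 1 (γ ^ 2) ≤ γ ^ 2 := min_le_right _ _
  have hmin0 : 0 < min 1 (γ ^ 2) := lt_min one_pos (by positivity)
  have hexp1 : Real.exp (-(θ T / μ1) * T0) ≤ 1 := by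
    rw [Real.exp_le_one_iff]
    have : 0 < θ T / μ1 * T0 := by positivity
    linarith
  have hexp0 := Real.exp_pos (-(θ T / μ1) * T0)
  set Q := Real.exp (-(θ T / μ1) * T0)
  have hX0 := Real.exp_pos X
  have hγ2 : 0 < γ ^ 2 := by positivity
  have hre : min 1 (γ ^ 2) / (2 + 3 * γ ^ 2) * Q / (1 + γ ^ 2 + ω T0) * Real.exp X =
      (min 1 (γ ^ 2) * (Real.exp X / (2 + 3 * γ ^ 2))) * Q / (1 + γ ^ 2 + ω T0) := by ring
  rw [hre, div_le_iff₀ (by positivity)]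
  have hpos0 : 0 < Real.exp X / (2 + 3 * γ ^ 2) := by positivity
  rcases le_total t T with htT | htT
  · obtain ⟨e1, e2⟩ := huniq t ⟨hτ.le.trans ht.1, htT⟩
    rw [e1, e2]
    have := hex t ht.1
    set Y := Real.exp X / (2 + 3 * γ ^ 2)
    set Z := w1fun α h ν t ^ 2 + lam ^ 2 * wfun α h ν t ^ 2
    calc min 1 (γ ^ 2) * Y * Q ≤ 1 * Y * 1 := by gcongr
      _ = Y := by ring
      _ ≤ Z := this
      _ ≤ Z * (1 + γ ^ 2 + ω T0) := le_mul_of_one_le_right (hpos0.le.trans this) (by linarith)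
  · have hlip := lip_of_memPS hθmono hPS hTpos
    have hz : ∀ s, T ≤ s → Pfun α h ν lam s = 0 := fun s hs => Pfun_zero hh hs
    have hen := energy_dini (K := θ T) (μ1 := μ1) hTpos.le hμ1 hθT.le hu
      (hc.mono (Icc_subset_Icc_left hTpos.le))
      (by
        intro x hx z hzz
        rw [hz x hx.1, hz z (hx.1.trans hzz.1), sub_zero, sub_zero]
        exact hlip x hx z hzz)
      (by
        intro x hx
        rw [hz x hx.1, sub_zero]
        exact (hPS.2.2.1 x ⟨hTpos.trans_le hx.1, hx.2⟩).1) t ⟨htT, ht.2⟩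
    rw [hz t htT, hz T le_rfl, sub_zero, sub_zero, hcstar.2.1 T ⟨hTpos.le, hTT1.le⟩] at hen
    obtain ⟨e1, e2⟩ := huniq T ⟨hTpos.le, le_rfl⟩
    have hE := hex T hτT
    rw [← e1, ← e2] at hE
    set Y := Real.exp X / (2 + 3 * γ ^ 2)
    have hct : cstar t ≤ γ ^ 2 + ω T0 := by
      have a1 := hPS.2.2.2.1 t ⟨by linarith, ht.2⟩ 0 ⟨le_rfl, hT0.le⟩
      rw [hcstar.2.1 0 ⟨le_rfl, hT10.le⟩, sub_zero, abs_of_nonneg (by linarith : 0 ≤ t)] at a1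
      have a2 := hω.2.2.1 t T0 (by linarith) ht.2
      linarith [(abs_le.1 a1).2]
    have hQ : Q ≤ Real.exp (-(θ T / μ1) * (t - T)) := by
      apply Real.exp_le_exp.2
      have : θ T / μ1 * (t - T) ≤ θ T / μ1 * T0 := by
        gcongr; linarith [ht.2]
      linarith
    calc min 1 (γ ^ 2) * Y * Q
        ≤ min 1 (γ ^ 2) * (der T0 u T ^ 2 + lam ^ 2 * u T ^ 2) * Real.exp (-(θ T / μ1) * (t - T)) := by
          gcongr
      _ ≤ (der T0 u T ^ 2 + lam ^ 2 * γ ^ 2 * u T ^ 2) * Real.exp (-(θ T / μ1) * (t - T)) := by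
          gcongr
          have a1 := mul_le_mul_of_nonneg_right hmin1 (sq_nonneg (der T0 u T))
          have a2 := mul_le_mul_of_nonneg_right hmin2 (by positivity : 0 ≤ lam ^ 2 * u T ^ 2)
          linarith
      _ ≤ der T0 u t ^ 2 + lam ^ 2 * cstar t * u t ^ 2 := hen
      _ ≤ (der T0 u t ^ 2 + lam ^ 2 * u t ^ 2) * (1 + γ ^ 2 + ω T0) := by
          have a1 := mul_le_mul_of_nonneg_right hct (by positivity : 0 ≤ lam ^ 2 * u t ^ 2)
          have a2 : 0 ≤ lam ^ 2 * u t ^ 2 := by positivity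
          have a3 : 0 ≤ der T0 u t ^ 2 * (γ ^ 2 + ω T0) := by positivity
          linarith

/-- Proposition `prop:final`: asymptotic activators for initially
constant coefficients. -/
theorem asymptotic_activators_for_initially_constant
    (T0 μ1 μ2 T1 γ η : ℝ) (ω θ : ℝ → ℝ)
    (hT0 : 0 < T0) (hμ1 : 0 < μ1) (hμ12 : μ1 < μ2)
    (hω : IsModulusOfContinuity ω)
    (hθcont : ContinuousOn θ (Ioo 0 T0))
    (hθpos : ∀ t ∈ Ioo 0 T0, 0 < θ t)
    (hθmono : AntitoneOn θ (Ioo 0 T0))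
    (hm : Tendsto (mFun T0 ω θ) atTop atTop)
    (hT1 : T1 ∈ Ioo 0 T0) (hγ : 0 < γ) (hγ2 : γ ^ 2 ∈ Ioo μ1 μ2) (hη : η ∈ Ioo 0 1)
    (cstar : ℝ → ℝ) (hcstar : MemD T0 μ1 μ2 ω θ T1 γ η cstar) :
    ∃ cfam : ℝ → ℝ → ℝ,
      (∀ lam : ℝ, 0 < lam → MemPS T0 μ1 μ2 ω θ (cfam lam)) ∧
      (∀ δ ∈ Ioo 0 T0, ∃ Mδ lamδ : ℝ, 0 < Mδ ∧ 0 < lamδ ∧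
        ∀ lam : ℝ, lamδ ≤ lam → ∀ u : ℝ → ℝ,
          IsSol T0 lam (cfam lam) u → u 0 = 0 → der T0 u 0 = 1 →
          ∀ t ∈ Icc δ T0,
            Mδ * Real.exp (2 * (M3 μ1 μ2 * mFun T0 ω θ lam)) ≤
              (der T0 u t) ^ 2 + lam ^ 2 * (u t) ^ 2) ∧
      TendstoUniformlyOn (fun lam t => cfam lam t) cstar atTop (Icc 0 T0) := by

  have hω' := hω
  obtain ⟨w1, w2, w3, w4⟩ := hω'
  obtain ⟨hT10, hT11⟩ := id hT1
  set T := T1 / 2 with hT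
  have hTpos : 0 < T := by linarith
  set κ := min 1 γ / (16 * γ ^ 2) with hκdef
  have hmin0 : 0 < min 1 γ := lt_min one_pos hγ
  have hκ0 : 0 < κ := by positivity
  have hκ1 : γ * κ ≤ 1 / 16 := by
    have : γ * κ = min 1 γ / γ / 16 := by rw [hκdef]; field_simp
    rw [this]
    have : min 1 γ / γ ≤ 1 := by rw [div_le_one hγ]; exact min_le_right _ _
    linarith
  have hκ2 : γ ^ 2 * κ ≤ 1 / 16 := by
    have : γ ^ 2 * κ = min 1 γ / 16 := by rw [hκdef]; field_simp
    rw [this]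
    linarith [min_le_left 1 γ]
  have hμ2 : 0 < μ2 := hμ1.trans hμ12
  have hM3 : 2 * M3 μ1 μ2 ≤ κ := by
    have hsq : Real.sqrt μ1 ≤ γ := by
      rw [Real.sqrt_le_left hγ.le]; exact hγ2.1.le
    have h1 : Real.sqrt μ1 / Real.pi ≤ γ :=
      (div_le_self (Real.sqrt_nonneg _) (by linarith [Real.pi_gt_three])).trans hsq
    have h2 : min 1 (Real.sqrt μ1 / Real.pi) ≤ min 1 γ := min_le_min le_rfl h1
    have h3 : 1 / (128 * μ2) ≤ 1 / (128 * γ ^ 2) := by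
      have := hγ2.2.le
      gcongr
    have h4 : M3 μ1 μ2 ≤ 1 / (128 * γ ^ 2) * min 1 γ := by
      unfold M3
      exact mul_le_mul h3 h2 (le_min zero_le_one (by positivity)) (by positivity)
    have h5 : κ = 8 * (1 / (128 * γ ^ 2) * min 1 γ) := by rw [hκdef]; field_simp; norm_num
    have h6 : 0 < 1 / (128 * γ ^ 2) * min 1 γ := by positivity
    linarith
  have htend : Tendsto (fun lam : ℝ => ω (1 / lam)) atTop (nhds 0) := by
    have h1 : Tendsto (fun lam : ℝ => 1 / lam) atTop (nhdsWithin 0 (Ioi 0)) := by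
      simpa [one_div] using! (tendsto_inv_atTop_nhdsGT_zero (𝕜 := ℝ))
    exact w2.comp h1
  have htendh : Tendsto (fun lam : ℝ => Real.pi / (γ * lam)) atTop (nhds 0) :=
    Tendsto.const_div_atTop (tendsto_id.const_mul_atTop hγ) _
  have hev : ∀ᶠ lam : ℝ in atTop, 0 < lam ∧ ω (1 / lam) ≤ γ / κ ∧ Real.pi / (γ * lam) < T0 - T ∧
      ω (1 / lam) ≤ γ ^ 2 - μ1 ∧ ω (1 / lam) ≤ μ2 - γ ^ 2 ∧ ω (1 / lam) ≤ η * ω T := by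
    filter_upwards [eventually_gt_atTop 0,
      htend.eventually_le_const (by positivity : (0:ℝ) < γ / κ),
      htendh.eventually_lt_const (by linarith : (0:ℝ) < T0 - T),
      htend.eventually_le_const (by linarith [hγ2.1] : (0:ℝ) < γ ^ 2 - μ1),
      htend.eventually_le_const (by linarith [hγ2.2] : (0:ℝ) < μ2 - γ ^ 2),
      htend.eventually_le_const (mul_pos hη.1 (w1 T hTpos))] with lam a b c d e f
    exact ⟨a, b, c, d, e, f⟩
  obtain ⟨lam0, hlam0⟩ := eventually_atTop.1 hev
  have hlam0pos : 0 < lam0 := (hlam0 lam0 le_rfl).1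
  set P : ℝ → ℝ → ℝ := fun lam => Pfun (alph T κ (lam * ω (1 / lam)) (Real.pi / (γ * lam)) θ)
    (Real.pi / (γ * lam)) (γ * lam) lam with hP
  have hmain : ∀ lam, lam0 ≤ lam → (∀ t, |P lam t| ≤ ω (1 / lam)) ∧
      MemPS T0 μ1 μ2 ω θ (fun t => cstar t - P lam t) := by
    intro lam hl
    obtain ⟨a, b, c, d, e, f⟩ := hlam0 lam hl
    exact memPS_pert hω hθpos hθmono hγ hη hcstar hT hT1 a rfl (by positivity)
      (by field_simp) hκ0.le hκ1 hκ2 (by rw [le_div_iff₀ hκ0] at b; linarith) d e f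
  refine ⟨fun lam t => if lam0 ≤ lam then cstar t - P lam t else cstar t, ?_, ?_, ?_⟩
  · intro lam _
    by_cases hl : lam0 ≤ lam
    · simp only [hl, if_true]; exact (hmain lam hl).2
    · simp only [hl, if_false]; exact hcstar.1
  · intro δ hδ
    have hτ : 0 < min δ T := lt_min hδ.1 hTpos
    set τ := min δ T with hτd
    have hwT0 : 0 < ω T0 := w1 _ hT0
    refine ⟨(min 1 (γ ^ 2) / (2 + 3 * γ ^ 2) * Real.exp (-(θ T / μ1) * T0) / (1 + γ ^ 2 + ω T0)) *
      Real.exp (-(κ * (Real.pi * γ + ∫ t in τ..T0, θ t))), lam0, ?_, hlam0pos, ?_⟩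
    · have : 0 < min 1 (γ ^ 2) := lt_min one_pos (by positivity)
      positivity
    intro lam hl u hu hu0 hu1 t ht
    simp only [hl, if_true] at hu
    obtain ⟨a, b, c, d, e, f⟩ := hlam0 lam hl
    have hE := energy_pert hμ1 hω hθcont hθpos hθmono hγ hη hcstar hT hT1 a rfl (by positivity)
      (by field_simp) hκ0.le (by rw [le_div_iff₀ hκ0] at b; linarith) (by linarith)
      (hmain lam hl).1 hu hu0 hu1 (hmain lam hl).2.1 hτ (min_le_right _ _)
      ⟨(min_le_left _ _).trans ht.1, ht.2⟩
    refine le_trans ?_ hE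
    rw [mul_assoc, ← Real.exp_add]
    have hm0 : 0 ≤ mFun T0 ω θ lam := by
      apply Real.sInf_nonneg
      rintro _ ⟨s, hs, rfl⟩
      have h1 := theta_int_nonneg hθpos s T0 hs.1 hs.2 le_rfl
      have h2 := w1 (1 / lam) (by positivity)
      have h3 := hs.1
      simp only
      positivity
    have hLh : lam * ω (1 / lam) * (Real.pi / (γ * lam)) ≤ Real.pi * γ := by
      have e1 : lam * ω (1 / lam) * (Real.pi / (γ * lam)) = Real.pi * (ω (1 / lam) / γ) := by
        field_simp
      rw [e1]
      gcongr
      rw [div_le_iff₀ hγ]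
      nlinarith
    have hmin : 0 ≤ min 1 (γ ^ 2) := le_min zero_le_one (by positivity)
    gcongr
    have h1 := mul_le_mul_of_nonneg_right hM3 hm0
    have h2 := mul_le_mul_of_nonneg_left hLh hκ0.le
    linarith
  · rw [Metric.tendstoUniformlyOn_iff]
    intro ε hε
    filter_upwards [eventually_ge_atTop lam0, htend.eventually_lt_const hε] with lam hl hlt t _
    simp only [hl, if_true, Real.dist_eq]
    rw [show cstar t - (cstar t - P lam t) = P lam t by ring]
    exact ((hmain lam hl).1 t).trans_lt hlt
end

section
/- Let T₀ > 0, let 0 < μ₁ < μ₂, let θ : (0,T₀) → (0,∞) be continuous and nonincreasing, and let c : [0,T₀] → ℝ be continuous, locally Lipschitz on (0,T₀), with μ₁ ≤ c(t) ≤ μ₂ for all t ∈ (0,T₀) and |c'(t)| ≤ θ(t) for almost every t ∈ (0,T₀). Then for every λ > 0, every solution u of u'' + λ²·c(t)·u = 0 on [0,T₀] satisfies, for all 0 < s ≤ t ≤ T₀: u'(t)² + λ²·u(t)² ≤ √M₁·(u'(s)² + λ²·u(s)²)·exp((1/μ₁)·∫_s^t θ(τ) dτ), where M₁ := (max{1,μ₂}/min{1,μ₁})².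 -/
open Set Filter MeasureTheory

theorem acOn_of_hasDerivAt {f f' : ℝ → ℝ} {a b : ℝ} (hab : a ≤ b)
    (hd : ∀ x ∈ Icc a b, HasDerivAt f (f' x) x) (hc : ContinuousOn f' (Icc a b)) :
    AbsolutelyContinuousOnInterval f a b := by
  obtain ⟨C, hC⟩ := isCompact_Icc.exists_bound_of_continuousOn hc
  have hL : LipschitzOnWith (Real.toNNReal C) f (uIcc a b) := by
    rw [uIcc_of_le hab]
    refine Convex.lipschitzOnWith_of_nnnorm_hasDerivWithin_le (convex_Icc a b)
      (fun x hx => (hd x hx).hasDerivWithinAt) (fun x hx => ?_)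
    rw [← NNReal.coe_le_coe, coe_nnnorm]
    exact (hC x hx).trans (Real.le_coe_toNNReal C)
  exact hL.absolutelyContinuousOnInterval

theorem energy_core
    (T0 μ1 μ2 : ℝ) (θ : ℝ → ℝ) (hμ1 : 0 < μ1)
    (hθcont : ContinuousOn θ (Ioo 0 T0))
    (c : ℝ → ℝ) (hccont : ContinuousOn c (Icc 0 T0))
    (hclip : LocallyLipschitzOn (Ioo 0 T0) c)
    (hcbound : ∀ t ∈ Ioo 0 T0, μ1 ≤ c t ∧ c t ≤ μ2)
    (hcder : ∀ᵐ t ∂(volume.restrict (Ioo 0 T0)), |deriv c t| ≤ θ t)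
    (lam : ℝ) (u v : ℝ → ℝ)
    (hu : ∀ t ∈ Ioo 0 T0, HasDerivAt u (v t) t)
    (hv : ∀ t ∈ Ioo 0 T0, HasDerivAt v (-(lam ^ 2 * c t * u t)) t)
    (s t : ℝ) (hs : 0 < s) (hst : s ≤ t) (ht : t < T0) :
    (v t) ^ 2 + lam ^ 2 * (c t * (u t) ^ 2) ≤
      ((v s) ^ 2 + lam ^ 2 * (c s * (u s) ^ 2)) * Real.exp (1 / μ1 * ∫ τ in s..t, θ τ) := by
  have hsub : Icc s t ⊆ Ioo 0 T0 := fun x hx => ⟨hs.trans_le hx.1, hx.2.trans_lt ht⟩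
  have hucont : ContinuousOn u (Icc s t) := fun x hx => (hu x (hsub hx)).continuousAt.continuousWithinAt
  have hvcont : ContinuousOn v (Icc s t) := fun x hx => (hv x (hsub hx)).continuousAt.continuousWithinAt
  have hcc : ContinuousOn c (Icc s t) := hccont.mono (hsub.trans Ioo_subset_Icc_self)
  have hθc : ContinuousOn θ (Icc s t) := hθcont.mono hsub
  -- the exponential weight
  set w : ℝ → ℝ := fun x => Real.exp (-(1 / μ1 * ∫ τ in s..x, θ τ)) with hw
  have hΘ : ∀ x ∈ Icc s t, HasDerivAt (fun y => ∫ τ in s..y, θ τ) (θ x) x := by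
    intro x hx
    refine intervalIntegral.integral_hasDerivAt_right ?_ ?_ ?_
    · apply ContinuousOn.intervalIntegrable
      rw [uIcc_of_le hx.1]
      exact hθc.mono (Icc_subset_Icc_right hx.2)
    · exact hθcont.stronglyMeasurableAtFilter isOpen_Ioo x (hsub hx)
    · exact hθcont.continuousAt (isOpen_Ioo.mem_nhds (hsub hx))
  have hwd : ∀ x ∈ Icc s t, HasDerivAt w (w x * (-(1 / μ1 * θ x))) x := by
    intro x hx
    exact (((hΘ x hx).const_mul (1 / μ1)).neg).exp
  have hwcont : ContinuousOn w (Icc s t) := fun x hx => (hwd x hx).continuousAt.continuousWithinAt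
  have acw : AbsolutelyContinuousOnInterval w s t :=
    acOn_of_hasDerivAt hst hwd (by fun_prop)
  have acu : AbsolutelyContinuousOnInterval u s t :=
    acOn_of_hasDerivAt hst (fun x hx => hu x (hsub hx)) hvcont
  have acv : AbsolutelyContinuousOnInterval v s t :=
    acOn_of_hasDerivAt hst (fun x hx => hv x (hsub hx)) (by fun_prop)
  have acc : AbsolutelyContinuousOnInterval c s t := by
    obtain ⟨K, hK⟩ := (hclip.mono hsub).exists_lipschitzOnWith_of_compact isCompact_Icc
    rw [← uIcc_of_le hst] at hK
    exact hK.absolutelyContinuousOnInterval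
  set F : ℝ → ℝ := (v * v + (fun x => lam ^ 2 * (c * (u * u)) x)) * w with hF
  have acF : AbsolutelyContinuousOnInterval F s t :=
    ((acv.mul acv).add ((acc.mul (acu.mul acu)).const_mul (lam ^ 2))).mul acw
  have hae : ∀ᵐ x, x ∈ Icc s t → deriv F x ≤ 0 := by
    have h1 := acc.ae_differentiableAt
    rw [ae_restrict_iff' measurableSet_Ioo] at hcder
    filter_upwards [h1, hcder] with x hx1 hx2 hx
    have hdc := (hx1 (by rwa [uIcc_of_le hst])).hasDerivAt
    have hb := abs_le.1 (hx2 (hsub hx))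
    have hcb := (hcbound x (hsub hx)).1
    have hux := hu x (hsub hx)
    have hvx := hv x (hsub hx)
    have hd := ((hvx.mul hvx).add ((hdc.mul (hux.mul hux)).const_mul (lam ^ 2))).mul (hwd x hx)
    have hd' := hd.deriv
    change deriv F x = _ at hd'
    rw [hd']
    simp only [Pi.mul_apply, Pi.add_apply]
    have hwp : 0 < w x := Real.exp_pos _
    have hθ0 : 0 ≤ θ x := by linarith
    have key : lam ^ 2 * (deriv c x * (u x * u x))
        ≤ (v x * v x + lam ^ 2 * (c x * (u x * u x))) * (1 / μ1 * θ x) := by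
      have e1 : lam ^ 2 * (deriv c x * (u x * u x)) ≤ lam ^ 2 * (θ x * (u x * u x)) := by
        gcongr
        · exact mul_self_nonneg _
        · exact hb.2
      have e2 : lam ^ 2 * (θ x * (u x * u x)) = lam ^ 2 * (μ1 * (u x * u x)) * (1 / μ1 * θ x) := by
        field_simp
      have e3 : lam ^ 2 * (μ1 * (u x * u x)) ≤ lam ^ 2 * (c x * (u x * u x)) := by
        gcongr
        exact mul_self_nonneg _
      have e4 : 0 ≤ 1 / μ1 * θ x := by positivity
      have e5 := mul_self_nonneg (v x)
      rw [e2] at e1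
      exact e1.trans (mul_le_mul_of_nonneg_right (by linarith) e4)
    have := mul_nonneg hwp.le (sub_nonneg.2 key)
    linarith
  have hint := acF.integral_deriv_eq_sub
  have hle : ∫ x in s..t, deriv F x ≤ 0 := by
    rw [intervalIntegral.integral_of_le hst]
    apply integral_nonpos_of_ae
    rw [EventuallyLE, ae_restrict_iff' measurableSet_Ioc]
    filter_upwards [hae] with x hx hx'
    exact hx (Ioc_subset_Icc_self hx')
  have hfin : F t ≤ F s := by linarith
  simp only [hF, hw, Pi.mul_apply, Pi.add_apply, intervalIntegral.integral_same, mul_zero,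
    Real.exp_zero, inv_one, mul_one, Real.exp_neg] at hfin
  rw [← div_eq_mul_inv, div_le_iff₀ (Real.exp_pos _)] at hfin
  simpa only [pow_two (v _), pow_two (u _)] using hfin

/-- hyperbolic energy estimate away from the origin, second step in the
proof of Theorem 1.(1). -/
theorem energy_estimate_away_from_origin
    (T0 μ1 μ2 : ℝ) (θ : ℝ → ℝ)
    (hT0 : 0 < T0) (hμ1 : 0 < μ1) (hμ12 : μ1 < μ2)
    (hθcont : ContinuousOn θ (Ioo 0 T0))
    (hθpos : ∀ t ∈ Ioo 0 T0, 0 < θ t)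
    (hθmono : AntitoneOn θ (Ioo 0 T0))
    (c : ℝ → ℝ) (hccont : ContinuousOn c (Icc 0 T0))
    (hclip : LocallyLipschitzOn (Ioo 0 T0) c)
    (hcbound : ∀ t ∈ Ioo 0 T0, μ1 ≤ c t ∧ c t ≤ μ2)
    (hcder : ∀ᵐ t ∂(volume.restrict (Ioo 0 T0)), |deriv c t| ≤ θ t)
    (lam : ℝ) (hlam : 0 < lam)
    (u : ℝ → ℝ) (hu : IsSol T0 lam c u) :
    ∀ s : ℝ, ∀ t : ℝ, 0 < s → s ≤ t → t ≤ T0 →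
      (der T0 u t) ^ 2 + lam ^ 2 * (u t) ^ 2 ≤
        Real.sqrt (M1 μ1 μ2) * ((der T0 u s) ^ 2 + lam ^ 2 * (u s) ^ 2) *
          Real.exp (1 / μ1 * ∫ τ in s..t, θ τ) := by
  have hμ2 : 0 < μ2 := hμ1.trans hμ12
  have hmin : 0 < min 1 μ1 := lt_min one_pos hμ1
  have hmax : 0 < max 1 μ2 := lt_max_of_lt_left one_pos
  have hsq : Real.sqrt (M1 μ1 μ2) = max 1 μ2 / min 1 μ1 := by
    rw [M1, Real.sqrt_sq (by positivity)]
  have hone : 1 ≤ max 1 μ2 / min 1 μ1 := by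
    rw [le_div_iff₀ hmin, one_mul]
    exact (min_le_left _ _).trans (le_max_left _ _)
  have hnb : ∀ x ∈ Ioo 0 T0, Icc 0 T0 ∈ nhds x := fun x hx => Icc_mem_nhds hx.1 hx.2
  have hu1 : ∀ x ∈ Ioo 0 T0, HasDerivAt u (der T0 u x) x := fun x hx =>
    (hu x (Ioo_subset_Icc_self hx)).1.hasDerivAt (hnb x hx)
  have hv1 : ∀ x ∈ Ioo 0 T0, HasDerivAt (der T0 u) (-(lam ^ 2 * c x * u x)) x := fun x hx =>
    (hu x (Ioo_subset_Icc_self hx)).2.hasDerivAt (hnb x hx)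
  have main : ∀ s t : ℝ, 0 < s → s ≤ t → t < T0 →
      (der T0 u t) ^ 2 + lam ^ 2 * (u t) ^ 2 ≤
        Real.sqrt (M1 μ1 μ2) * ((der T0 u s) ^ 2 + lam ^ 2 * (u s) ^ 2) *
          Real.exp (1 / μ1 * ∫ τ in s..t, θ τ) := by
    intro s t hs hst ht
    have h := energy_core T0 μ1 μ2 θ hμ1 hθcont c hccont hclip hcbound hcder lam u (der T0 u)
      hu1 hv1 s t hs hst ht
    have hct := (hcbound t ⟨hs.trans_le hst, ht⟩).1
    have hcs := (hcbound s ⟨hs, hst.trans_lt ht⟩).2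
    have a1 : min 1 μ1 * ((der T0 u t) ^ 2 + lam ^ 2 * (u t) ^ 2) ≤
        (der T0 u t) ^ 2 + lam ^ 2 * (c t * (u t) ^ 2) := by
      have e1 := mul_le_mul_of_nonneg_right (min_le_left 1 μ1) (sq_nonneg (der T0 u t))
      have e2 := mul_le_mul_of_nonneg_right ((min_le_right 1 μ1).trans hct)
        (mul_nonneg (sq_nonneg lam) (sq_nonneg (u t)))
      linarith
    have a2 : (der T0 u s) ^ 2 + lam ^ 2 * (c s * (u s) ^ 2) ≤
        max 1 μ2 * ((der T0 u s) ^ 2 + lam ^ 2 * (u s) ^ 2) := by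
      have e1 := mul_le_mul_of_nonneg_right (le_max_left 1 μ2) (sq_nonneg (der T0 u s))
      have e2 := mul_le_mul_of_nonneg_right (hcs.trans (le_max_right 1 μ2))
        (mul_nonneg (sq_nonneg lam) (sq_nonneg (u s)))
      linarith
    have a3 := a1.trans (h.trans (mul_le_mul_of_nonneg_right a2 (Real.exp_pos _).le))
    rw [mul_comm (min 1 μ1), ← le_div_iff₀ hmin] at a3
    rw [hsq]
    refine a3.trans (le_of_eq ?_)
    ring
  intro s t hs hst ht
  rcases ht.lt_or_eq with ht' | rfl
  · exact main s t hs hst ht'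
  rcases hst.eq_or_lt with rfl | hst'
  · rw [hsq, intervalIntegral.integral_same, mul_zero, Real.exp_zero, mul_one]
    exact le_mul_of_one_le_left (by positivity) hone
  have hcontu : ContinuousWithinAt u (Icc 0 t) t := (hu t ⟨hT0.le, le_rfl⟩).1.continuousWithinAt
  have hcontv : ContinuousWithinAt (der t u) (Icc 0 t) t :=
    (hu t ⟨hT0.le, le_rfl⟩).2.continuousWithinAt
  have hcE : ContinuousWithinAt (fun x => (der t u x) ^ 2 + lam ^ 2 * (u x) ^ 2) (Ioo s t) t :=
    ((hcontv.pow 2).add ((hcontu.pow 2).const_mul (lam ^ 2))).mono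
      (fun x hx => ⟨(hs.trans hx.1).le, hx.2.le⟩)
  have hne : (nhdsWithin t (Ioo s t)).NeBot := by
    rw [nhdsWithin_Ioo_eq_nhdsLT hst']; infer_instance
  have hθint : IntegrableOn θ (Ioo s t) := by
    haveI : IsFiniteMeasure (volume.restrict (Ioo s t)) := ⟨by simp⟩
    refine Integrable.of_bound (C := θ s) ?_ ?_
    · exact (hθcont.mono (Ioo_subset_Ioo_left hs.le)).aestronglyMeasurable measurableSet_Ioo
    · rw [ae_restrict_iff' measurableSet_Ioo]
      refine Eventually.of_forall fun x hx => ?_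
      have hx' : x ∈ Ioo 0 t := ⟨hs.trans hx.1, hx.2⟩
      rw [Real.norm_of_nonneg (hθpos x hx').le]
      exact hθmono ⟨hs, hst'⟩ hx' hx.1.le
  refine le_of_tendsto hcE ?_
  filter_upwards [self_mem_nhdsWithin] with x hx
  refine (main s x hs hx.1.le hx.2).trans ?_
  have hmono : ∫ τ in s..x, θ τ ≤ ∫ τ in s..t, θ τ := by
    rw [intervalIntegral.integral_of_le hx.1.le, intervalIntegral.integral_of_le hst,
      integral_Ioc_eq_integral_Ioo (y := t)]
    refine setIntegral_mono_set hθint ?_ ?_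
    · rw [EventuallyLE, ae_restrict_iff' measurableSet_Ioo]
      exact Eventually.of_forall fun y hy => (hθpos y ⟨hs.trans hy.1, hy.2⟩).le
    · exact LE.le.eventuallyLE fun y hy => ⟨hy.1, hy.2.trans_lt hx.2⟩
  have : (0:ℝ) < 1 / μ1 := by positivity
  gcongr
end
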